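/- arXiv:2009.03981 — 5 statements merged into one kernel-verified Lean document; each statement's English description precedes it below -/
import Mathlib

section
/- Let 1 ≤ k ≤ n−1 and let (V,η,ξ) be a left cyclic polarized arrangement of n hyperplanes in k-space. Fix an n×k matrix A whose columns form a basis of V, a representative w ∈ ℝ^n of η, and the row vector ξ̂ ∈ ℝ^{1×k} of ξ in this basis. Then for every sign sequence α ∈ {+1,−1}^n: the region Δ_α is nonempty (α is feasible) if and only if var_l(α) ≤ k, and the linear function x ↦ ξ̂x is bounded above on Δ_α (α is bounded) if and only if var_l(α) ≥ k. In particular the bounded feasible sign sequences are exactly those with var_l(α) = k. -/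
open scoped BigOperators

/-- `W` lies in the totally positive Grassmannian `Gr^{>0}_{d,m}`: there is an `m × d` real
matrix whose columns span `W` and all of whose `d × d` minors (determinants of the square
submatrices on any `d` rows taken in increasing order) are strictly positive. -/
def IsTotallyPositive (d m : ℕ) (W : Set (Fin m → ℝ)) : Prop :=
  ∃ M : Matrix (Fin m) (Fin d) ℝ,
    (Submodule.span ℝ (Set.range fun j i => M i j) : Set (Fin m → ℝ)) = W ∧
    ∀ s : Fin d → Fin m, StrictMono s → 0 < (M.submatrix s id).det

/-- `η` (represented by `w ∈ ℝ^n`) is positively oriented with respect to `V`: the first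
coordinate of the orthogonal projection `u` of `w` onto `V^⊥` is strictly positive. -/
def PosOriented {n : ℕ} (V : Set (Fin n → ℝ)) (w : Fin n → ℝ) : Prop :=
  ∃ u : Fin n → ℝ, w - u ∈ V ∧ (∀ v ∈ V, ∑ i, u i * v i = 0) ∧
    ∀ i : Fin n, (i : ℕ) = 0 → 0 < u i

/-- The arrangement `(V, η)` of `n` hyperplanes in `k`-space, with `η` represented by `w`,
is cyclic: `V ∈ Gr^{>0}_{k,n}`, `V + ⟨w⟩ ∈ Gr^{>0}_{k+1,n}`, and `η` is positively
oriented with respect to `V`. -/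
def IsCyclicArr (n k : ℕ) (V : Set (Fin n → ℝ)) (w : Fin n → ℝ) : Prop :=
  IsTotallyPositive k n V ∧
  IsTotallyPositive (k + 1) n {y | ∃ v ∈ V, ∃ t : ℝ, y = v + t • w} ∧
  PosOriented V w

/-- The polarized arrangement `(V, η, ξ)` (with `η` represented by `w`) is left cyclic. -/
def IsLeftCyclic (n k : ℕ) (V : Set (Fin n → ℝ)) (w : Fin n → ℝ)
    (ξ : (Fin n → ℝ) → ℝ) : Prop :=
  IsTotallyPositive (k + 1) n {y | ∃ v ∈ V, ∃ t : ℝ, y = v + t • w} ∧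
  IsTotallyPositive k (n + 1) {y | ∃ v ∈ V, y = Fin.cons (ξ v) v} ∧
  PosOriented V w

/-- The polarized arrangement `(V, η, ξ)` (with `η` represented by `w`) is right cyclic. -/
def IsRightCyclic (n k : ℕ) (V : Set (Fin n → ℝ)) (w : Fin n → ℝ)
    (ξ : (Fin n → ℝ) → ℝ) : Prop :=
  IsTotallyPositive (k + 1) n {y | ∃ v ∈ V, ∃ t : ℝ, y = v + t • w} ∧
  IsTotallyPositive k (n + 1) {y | ∃ v ∈ V, y = Fin.snoc v ((-1) ^ k * ξ v)} ∧
  PosOriented V w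

/-- The sign variation `var(β)` of a sign sequence `β` of length `m+1`: the number of
indices `i` with `β_i ≠ β_{i+1}`. -/
noncomputable def varCount {m : ℕ} (β : Fin (m + 1) → ℝ) : ℕ :=
  (Finset.univ.filter fun i : Fin m => β i.castSucc ≠ β i.succ).card

/-- `var_l(α) := var(+1, α_1, …, α_n)`. -/
noncomputable def varL {n : ℕ} (α : Fin n → ℝ) : ℕ := varCount (Fin.cons 1 α)

/-- `var_r(α) := var(α_1, …, α_n, (−1)^k)`. -/
noncomputable def varR {n : ℕ} (k : ℕ) (α : Fin n → ℝ) : ℕ := varCount (Fin.snoc α ((-1) ^ k))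

/-- Inserting a new row `i` in front of the increasing rows `P` gives a minor of a totally positive
matrix whose sign is determined by the number of rows of `P` preceding `i`. -/
theorem neg_one_pow_mul_det_cons_pos {m d : ℕ} (M : Matrix (Fin m) (Fin (d + 1)) ℝ)
    (hM : ∀ s : Fin (d + 1) → Fin m, StrictMono s → 0 < (M.submatrix s id).det)
    {P : Fin d → Fin m} (hP : StrictMono P) {i : Fin m} (hi : i ∉ Set.range P) :
    0 < (-1) ^ (Finset.univ.filter fun j => P j < i).card *
      (M.submatrix (Fin.cons i P) id).det := by
  set c := (Finset.univ.filter fun j => P j < i).card with hc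
  have hcd : c < d + 1 := by
    have := Finset.card_filter_le (Finset.univ : Finset (Fin d)) (fun j => P j < i)
    rw [Finset.card_univ, Fintype.card_fin] at this
    omega
  have key : ∀ j : Fin d, P j < i ↔ (j : ℕ) < c := by
    intro j
    constructor
    · intro h
      have : Finset.Iic j ⊆ Finset.univ.filter fun j => P j < i := by
        intro l hl
        simp only [Finset.mem_filter, Finset.mem_univ, true_and]
        exact (hP.monotone (Finset.mem_Iic.1 hl)).trans_lt h
      have := Finset.card_le_card this
      rw [Fin.card_Iic] at this
      omega
    · intro h
      by_contra h'
      have : (Finset.univ.filter fun j => P j < i) ⊆ Finset.Iio j := by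
        intro l hl
        simp only [Finset.mem_filter, Finset.mem_univ, true_and] at hl
        exact Finset.mem_Iio.2 (hP.lt_iff_lt.1 (hl.trans_le (not_lt.1 h')))
      have := Finset.card_le_card this
      rw [Fin.card_Iio] at this
      omega
  have hmono : StrictMono ((⟨c, hcd⟩ : Fin (d + 1)).insertNth i P : Fin (d + 1) → Fin m) := by
    intro a b hab
    rcases Fin.eq_self_or_eq_succAbove ⟨c, hcd⟩ a with rfl | ⟨a, rfl⟩ <;>
    rcases Fin.eq_self_or_eq_succAbove ⟨c, hcd⟩ b with rfl | ⟨b, rfl⟩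
    · exact absurd hab (lt_irrefl _)
    · rw [Fin.insertNth_apply_same, Fin.insertNth_apply_succAbove]
      have hb : ¬ P b < i := by
        rw [key]
        intro h
        rw [Fin.succAbove_of_castSucc_lt _ _ (by simpa [Fin.lt_def] using h)] at hab
        simp only [Fin.lt_def, Fin.val_castSucc] at hab
        omega
      exact lt_of_le_of_ne (not_lt.1 hb) fun h => hi ⟨b, h.symm⟩
    · rw [Fin.insertNth_apply_same, Fin.insertNth_apply_succAbove, key]
      by_contra h
      rw [Fin.succAbove_of_le_castSucc _ _ (by simpa [Fin.le_def] using h)] at hab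
      simp only [Fin.lt_def, Fin.val_succ] at hab
      omega
    · rw [Fin.insertNth_apply_succAbove, Fin.insertNth_apply_succAbove]
      exact hP ((Fin.strictMono_succAbove _).lt_iff_lt.1 hab)
  have hperm : M.submatrix (Fin.cons i P) id =
      (M.submatrix ((⟨c, hcd⟩ : Fin (d + 1)).insertNth i P) id).submatrix
        (Fin.cycleRange ⟨c, hcd⟩).symm id := by
    ext a b
    simp only [Matrix.submatrix_apply, id]
    rw [Fin.insertNth_apply_cycleRange_symm]
  rw [hperm, Matrix.det_permute, Equiv.Perm.sign_symm, Fin.sign_cycleRange]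
  have := hM _ hmono
  push_cast
  rw [← mul_assoc, ← mul_pow]
  simpa using this

/-- The column space of a totally positive matrix contains a vector vanishing exactly on the
rows `P`, with signs alternating from one gap of `P` to the next. -/
theorem exists_mulVec_sign {m d : ℕ} (M : Matrix (Fin m) (Fin (d + 1)) ℝ)
    (hM : ∀ s : Fin (d + 1) → Fin m, StrictMono s → 0 < (M.submatrix s id).det)
    {P : Fin d → Fin m} (hP : StrictMono P) :
    ∃ c : Fin (d + 1) → ℝ, c 0 = (M.submatrix P Fin.succ).det ∧
      (∀ j, M.mulVec c (P j) = 0) ∧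
      ∀ i, i ∉ Set.range P →
        0 < (-1) ^ (Finset.univ.filter fun j => P j < i).card * M.mulVec c i := by
  have hdet : ∀ i, M.mulVec (fun l => (-1) ^ (l : ℕ) * (M.submatrix P l.succAbove).det) i =
      (M.submatrix (Fin.cons i P) id).det := by
    intro i
    rw [Matrix.det_succ_row_zero, Matrix.mulVec, dotProduct]
    refine Finset.sum_congr rfl fun l _ => ?_
    have : (M.submatrix (Fin.cons i P) id).submatrix Fin.succ l.succAbove =
        M.submatrix P l.succAbove := by
      ext a b
      simp
    rw [this]
    simp only [Matrix.submatrix_apply, Fin.cons_zero, id]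
    ring
  refine ⟨fun l => (-1) ^ (l : ℕ) * (M.submatrix P l.succAbove).det, ?_, fun j => ?_,
    fun i hi => ?_⟩
  · simp [Fin.succAbove_zero]
  · rw [hdet]
    refine Matrix.det_zero_of_row_eq (Fin.succ_ne_zero j).symm ?_
    ext l
    simp
  · rw [hdet]
    exact neg_one_pow_mul_det_cons_pos M hM hP hi

/-- The maximal minors of a `(d + 1) × d` matrix give a linear relation among its rows. -/
theorem sum_neg_one_pow_mul_mulVec_mul_det {d : ℕ} (B : Matrix (Fin (d + 1)) (Fin d) ℝ)
    (x : Fin d → ℝ) :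
    ∑ j : Fin (d + 1), (-1) ^ (j : ℕ) * B.mulVec x j * (B.submatrix j.succAbove id).det = 0 := by
  have hcol : ∀ l : Fin d, ∑ j : Fin (d + 1),
      (-1) ^ (j : ℕ) * B j l * (B.submatrix j.succAbove id).det = 0 := by
    intro l
    have h : (Matrix.of fun j => (Fin.cons (B j l) (B j) : Fin (d + 1) → ℝ)).det = 0 := by
      refine Matrix.det_zero_of_column_eq (Fin.succ_ne_zero l).symm fun j => ?_
      simp
    rw [Matrix.det_succ_column_zero] at h
    exact h
  simp only [Matrix.mulVec, dotProduct, Finset.mul_sum, Finset.sum_mul]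
  rw [Finset.sum_comm]
  refine Finset.sum_eq_zero fun l _ => ?_
  calc _ = x l * ∑ j : Fin (d + 1),
      (-1) ^ (j : ℕ) * B j l * (B.submatrix j.succAbove id).det := by
        rw [Finset.mul_sum]
        exact Finset.sum_congr rfl fun j _ => by ring
    _ = 0 := by rw [hcol, mul_zero]

/-- The matrix `(w | A)` obtained by prepending the column `w` to `A`. -/
def prependCol {n k : ℕ} (w : Fin n → ℝ) (A : Matrix (Fin n) (Fin k) ℝ) :
    Matrix (Fin n) (Fin (k + 1)) ℝ :=
  Matrix.of fun i => Fin.cons (w i) (A i)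

theorem prependCol_mulVec {n k : ℕ} (w : Fin n → ℝ) (A : Matrix (Fin n) (Fin k) ℝ)
    (c : Fin (k + 1) → ℝ) (i : Fin n) :
    (prependCol w A).mulVec c i = c 0 * w i + A.mulVec (Fin.tail c) i := by
  simp [prependCol, Matrix.mulVec, dotProduct, Fin.sum_univ_succ, Fin.tail, mul_comm]

/-- Laplace expansion along the first column, which may be translated by the column space
of `A`. -/
theorem det_prependCol_submatrix {n k : ℕ} (w : Fin n → ℝ) (A : Matrix (Fin n) (Fin k) ℝ)
    (x : Fin k → ℝ) (s : Fin (k + 1) → Fin n) :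
    ((prependCol w A).submatrix s id).det =
      ∑ j : Fin (k + 1), (-1) ^ (j : ℕ) * (w (s j) + A.mulVec x (s j)) *
        (A.submatrix (s ∘ j.succAbove) id).det := by
  have h := sum_neg_one_pow_mul_mulVec_mul_det (A.submatrix s id) x
  rw [Matrix.det_succ_column_zero]
  simp only [mul_add, add_mul, Finset.sum_add_distrib]
  exact (add_eq_left.2 h).symm

/-- The positions `i` at which `α i` differs from its predecessor in `(1, α)`. -/
noncomputable def changes {n : ℕ} (α : Fin n → ℝ) : Finset (Fin n) :=
  Finset.univ.filter fun i : Fin n =>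
    (Fin.cons 1 α : Fin (n + 1) → ℝ) i.castSucc ≠ (Fin.cons 1 α : Fin (n + 1) → ℝ) i.succ

theorem card_changes {n : ℕ} (α : Fin n → ℝ) : (changes α).card = varL α := rfl

theorem eq_neg_one_pow_card_changes {n : ℕ} {α : Fin n → ℝ} (hα : ∀ i, α i = 1 ∨ α i = -1)
    (i : Fin n) : α i = (-1) ^ ((changes α).filter fun d => d ≤ i).card := by
  have hβ : ∀ i : Fin (n + 1), (Fin.cons 1 α : Fin (n + 1) → ℝ) i = 1 ∨
      (Fin.cons 1 α : Fin (n + 1) → ℝ) i = -1 := by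
    intro i
    refine Fin.cases ?_ (fun i => ?_) i
    · simp
    · simpa using hα i
  have key : ∀ i : Fin (n + 1), (Fin.cons 1 α : Fin (n + 1) → ℝ) i =
      (-1) ^ ((changes α).filter fun d => d.castSucc < i).card := by
    intro i
    induction i using Fin.induction with
    | zero => simp
    | succ i ih =>
      by_cases hi : i ∈ changes α
      · have : ((changes α).filter fun d => d.castSucc < i.succ) =
            insert i ((changes α).filter fun d => d.castSucc < i.castSucc) := by
          ext d
          simp only [Finset.mem_filter, Finset.mem_insert, Fin.lt_def, Fin.val_castSucc,
            Fin.val_succ, Fin.ext_iff]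
          constructor
          · rintro ⟨h1, h2⟩
            by_cases h : (d : ℕ) = i
            · exact Or.inl h
            · exact Or.inr ⟨h1, by omega⟩
          · rintro (h | ⟨h1, h2⟩)
            · rw [Fin.ext h]
              exact ⟨hi, by omega⟩
            · exact ⟨h1, by omega⟩
        rw [this, Finset.card_insert_of_notMem (by simp), pow_succ, ← ih]
        have hne := (Finset.mem_filter.1 hi).2
        rcases hβ i.castSucc with h1 | h1 <;> rcases hβ i.succ with h2 | h2 <;>
          rw [h1, h2] at hne <;> rw [h1, h2] <;> first | exact absurd rfl hne | norm_num
      · have : ((changes α).filter fun d => d.castSucc < i.succ) =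
            ((changes α).filter fun d => d.castSucc < i.castSucc) := by
          refine Finset.filter_congr fun d hd => ?_
          have : d ≠ i := fun h => hi (h ▸ hd)
          simp only [Fin.lt_def, Fin.val_castSucc, Fin.val_succ, ne_eq, Fin.ext_iff] at this ⊢
          omega
        rw [this, ← ih]
        by_contra h
        exact hi (Finset.mem_filter.2 ⟨Finset.mem_univ _, Ne.symm h⟩)
  calc α i = _ := key i.succ
    _ = _ := by
      congr 2
      exact Finset.filter_congr fun d _ => Fin.castSucc_lt_succ_iff

/-- If `(1, α)` changes sign at most `k ≤ n` times, then `α` agrees, away from some `k`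
positions, with the pattern changing sign at each of those positions. -/
theorem exists_strictMono_sign_of_varL_le {n k : ℕ} {α : Fin n → ℝ}
    (hα : ∀ i, α i = 1 ∨ α i = -1) (hk : varL α ≤ k) (hkn : k ≤ n) :
    ∃ P : Fin k → Fin n, StrictMono P ∧ ∀ i, i ∉ Set.range P →
      α i = (-1) ^ (Finset.univ.filter fun j => P j < i).card := by
  have hS : ∃ S : Finset (Fin n), changes α ⊆ S ∧ S.card = k ∧
      ∀ i ∉ S, ∀ p ∈ S, p < i → p ∈ changes α := by
    induction k, hk using Nat.le_induction with
    | base => exact ⟨changes α, subset_rfl, rfl, fun _ _ p hp _ => hp⟩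
    | succ k _ ih =>
      obtain ⟨S, hDS, hcard, hS⟩ := ih (by omega)
      have hne : (Sᶜ).Nonempty := by
        rw [← Finset.card_pos, Finset.card_compl, Fintype.card_fin]
        omega
      refine ⟨insert (Sᶜ.max' hne) S, hDS.trans (Finset.subset_insert _ _), ?_, ?_⟩
      · rw [Finset.card_insert_of_notMem (Finset.mem_compl.1 (Finset.max'_mem _ _)), hcard]
      · intro i hi p hp hpi
        rw [Finset.mem_insert, not_or] at hi
        rcases Finset.mem_insert.1 hp with rfl | hp
        · exact absurd (Finset.le_max' _ i (Finset.mem_compl.2 hi.2)) (not_le.2 hpi)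
        · exact hS i hi.2 p hp hpi
  obtain ⟨S, hDS, hcard, hS⟩ := hS
  refine ⟨S.orderEmbOfFin hcard, (S.orderEmbOfFin hcard).strictMono, fun i hi => ?_⟩
  rw [Finset.range_orderEmbOfFin, Finset.mem_coe] at hi
  rw [eq_neg_one_pow_card_changes hα i]
  congr 1
  rw [← Finset.card_map (S.orderEmbOfFin hcard).toEmbedding]
  congr 1
  ext d
  simp only [Finset.mem_filter, Finset.mem_map, Finset.mem_univ, true_and,
    RelEmbedding.coe_toEmbedding]
  constructor
  · rintro ⟨hd, hdi⟩
    have : d ∈ Set.range (S.orderEmbOfFin hcard) := by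
      rw [Finset.range_orderEmbOfFin]
      exact hDS hd
    obtain ⟨j, rfl⟩ := this
    exact ⟨j, lt_of_le_of_ne hdi fun h => hi (h ▸ hDS hd), rfl⟩
  · rintro ⟨j, hj, rfl⟩
    exact ⟨hS i hi _ (Finset.orderEmbOfFin_mem _ _ _) hj, hj.le⟩

/-- If `(1, α)` changes sign at least `m` times, then `α` has an alternating subsequence of
length `m` starting with `-1`. -/
theorem exists_strictMono_alternating_of_le_varL {n m : ℕ} {α : Fin n → ℝ}
    (hα : ∀ i, α i = 1 ∨ α i = -1) (hm : m ≤ varL α) :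
    ∃ p : Fin m → Fin n, StrictMono p ∧ ∀ j, α (p j) = (-1) ^ ((j : ℕ) + 1) := by
  set e := (changes α).orderEmbOfFin (card_changes α)
  refine ⟨fun j => e (Fin.castLE hm j), fun a b hab => e.strictMono hab, fun j => ?_⟩
  rw [eq_neg_one_pow_card_changes hα]
  congr 1
  have : ((changes α).filter fun d => d ≤ e (Fin.castLE hm j)) =
      (Finset.Iic (Fin.castLE hm j)).map e.toEmbedding := by
    ext d
    simp only [Finset.mem_filter, Finset.mem_map, Finset.mem_Iic, RelEmbedding.coe_toEmbedding]
    constructor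
    · rintro ⟨hd, hdj⟩
      have : d ∈ Set.range e := by
        rw [Finset.range_orderEmbOfFin]
        exact hd
      obtain ⟨l, rfl⟩ := this
      exact ⟨l, e.le_iff_le.1 hdj, rfl⟩
    · rintro ⟨l, hl, rfl⟩
      exact ⟨Finset.orderEmbOfFin_mem _ _ _, e.le_iff_le.2 hl⟩
  rw [this, Finset.card_map, Fin.card_Iic, Fin.val_castLE]

theorem exists_feasible_of_varL_le {n k : ℕ} {w : Fin n → ℝ} {A : Matrix (Fin n) (Fin k) ℝ}
    (hA : ∀ s : Fin k → Fin n, StrictMono s → 0 < (A.submatrix s id).det)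
    (hN : ∀ s : Fin (k + 1) → Fin n, StrictMono s →
      0 < ((prependCol w A).submatrix s id).det)
    {α : Fin n → ℝ} (hα : ∀ i, α i = 1 ∨ α i = -1) (hk : varL α ≤ k) (hkn : k ≤ n) :
    ∃ x : Fin k → ℝ, ∀ i, 0 ≤ α i * (w i + A.mulVec x i) := by
  obtain ⟨P, hP, hsign⟩ := exists_strictMono_sign_of_varL_le hα hk hkn
  obtain ⟨c, hc0, hzero, hpos⟩ := exists_mulVec_sign (prependCol w A) hN hP
  have hc : 0 < c 0 := by
    rw [hc0]
    exact hA P hP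
  have hy : ∀ i, w i + A.mulVec ((c 0)⁻¹ • Fin.tail c) i =
      (c 0)⁻¹ * (prependCol w A).mulVec c i := by
    intro i
    rw [prependCol_mulVec, Matrix.mulVec_smul, Pi.smul_apply, smul_eq_mul]
    field_simp
  refine ⟨(c 0)⁻¹ • Fin.tail c, fun i => ?_⟩
  rw [hy]
  by_cases hi : i ∈ Set.range P
  · obtain ⟨j, rfl⟩ := hi
    simp [hzero]
  · rw [hsign i hi, mul_left_comm]
    exact (mul_pos (inv_pos.2 hc) (hpos i hi)).le

/-- If the coordinates of a point of `w + V` weakly alternate in sign along `s`, starting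
with the sign of `σ`, then so does the sign of the corresponding minor. -/
theorem mul_det_prependCol_nonneg {n k : ℕ} {w : Fin n → ℝ} {A : Matrix (Fin n) (Fin k) ℝ}
    (hA : ∀ s : Fin k → Fin n, StrictMono s → 0 < (A.submatrix s id).det)
    {s : Fin (k + 1) → Fin n} (hs : StrictMono s) (x : Fin k → ℝ) (σ : ℝ)
    (h : ∀ j : Fin (k + 1), 0 ≤ σ * (-1) ^ (j : ℕ) * (w (s j) + A.mulVec x (s j))) :
    0 ≤ σ * ((prependCol w A).submatrix s id).det := by
  rw [det_prependCol_submatrix w A x s, Finset.mul_sum]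
  refine Finset.sum_nonneg fun j _ => ?_
  have := mul_nonneg (h j) (hA _ (hs.comp (Fin.strictMono_succAbove j))).le
  linarith

theorem varL_le_of_feasible {n k : ℕ} {w : Fin n → ℝ} {A : Matrix (Fin n) (Fin k) ℝ}
    (hA : ∀ s : Fin k → Fin n, StrictMono s → 0 < (A.submatrix s id).det)
    (hN : ∀ s : Fin (k + 1) → Fin n, StrictMono s →
      0 < ((prependCol w A).submatrix s id).det)
    {α : Fin n → ℝ} (hα : ∀ i, α i = 1 ∨ α i = -1)
    {x : Fin k → ℝ} (hx : ∀ i, 0 ≤ α i * (w i + A.mulVec x i)) : varL α ≤ k := by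
  by_contra h
  obtain ⟨p, hp, hsign⟩ := exists_strictMono_alternating_of_le_varL hα (Nat.lt_of_not_le h)
  have := mul_det_prependCol_nonneg (w := w) hA hp x (-1) fun j => by
    have := hx (p j)
    rw [hsign, pow_succ'] at this
    exact this
  linarith [hN p hp]

/-- The orthogonal projection of `w` having positive first coordinate rules out that all
maximal minors of `(w | A)` are negative. -/
theorem not_det_prependCol_neg {n k : ℕ} {w : Fin n → ℝ} {A : Matrix (Fin n) (Fin k) ℝ}
    (hkn : k + 1 ≤ n)
    (hA : ∀ s : Fin k → Fin n, StrictMono s → 0 < (A.submatrix s id).det)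
    {x : Fin k → ℝ} (horth : ∀ y, ∑ i, (w i + A.mulVec x i) * A.mulVec y i = 0)
    (hfirst : ∀ i : Fin n, (i : ℕ) = 0 → 0 < w i + A.mulVec x i) :
    ¬ ∀ s : Fin (k + 1) → Fin n, StrictMono s →
      ((prependCol w A).submatrix s id).det < 0 := by
  intro hneg
  have hN : ∀ s : Fin (k + 1) → Fin n, StrictMono s →
      0 < ((prependCol (-w) A).submatrix s id).det := by
    intro s hs
    have h1 := det_prependCol_submatrix w A 0 s
    have h2 := det_prependCol_submatrix (-w) A 0 s
    simp only [Matrix.mulVec_zero, Pi.zero_apply, add_zero, Pi.neg_apply, mul_neg, neg_mul,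
      Finset.sum_neg_distrib] at h1 h2
    rw [h2, ← h1]
    linarith [hneg s hs]
  set u : Fin n → ℝ := fun i => w i + A.mulVec x i with hu
  set α : Fin n → ℝ := fun i => if 0 < u i then 1 else -1 with hαdef
  have hα : ∀ i, α i = 1 ∨ α i = -1 := by
    intro i
    simp only [hαdef]
    split_ifs <;> simp
  have hαu : ∀ i, 0 ≤ α i * u i := by
    intro i
    simp only [hαdef]
    split_ifs <;> linarith
  have hzero : α ⟨0, by omega⟩ = 1 := if_pos (hfirst _ rfl)
  by_cases hvar : varL α ≤ k
  · obtain ⟨y, hy⟩ := exists_feasible_of_varL_le hA hN hα hvar (by omega)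
    have h1 : 0 ≤ ∑ i, u i * (-w i + A.mulVec y i) := by
      refine Finset.sum_nonneg fun i _ => ?_
      have h := mul_nonneg (hy i) (hαu i)
      have hsq : α i * α i = 1 := by rcases hα i with h | h <;> rw [h] <;> norm_num
      calc (0 : ℝ) ≤ _ := h
        _ = (α i * α i) * (u i * (-w i + A.mulVec y i)) := by
          simp only [Pi.neg_apply]
          ring
        _ = _ := by rw [hsq, one_mul]
    have h2 : ∑ i, u i * (-w i + A.mulVec y i) = -∑ i, u i * u i := by
      have : ∀ i, u i * (-w i + A.mulVec y i) = -(u i * u i) + u i * A.mulVec (x + y) i := by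
        intro i
        rw [Matrix.mulVec_add, Pi.add_apply]
        simp only [hu]
        ring
      rw [Finset.sum_congr rfl fun i _ => this i, Finset.sum_add_distrib, horth, add_zero,
        Finset.sum_neg_distrib]
    have h3 : 0 < ∑ i, u i * u i :=
      Finset.sum_pos' (fun i _ => mul_self_nonneg _)
        ⟨⟨0, by omega⟩, Finset.mem_univ _, mul_pos (hfirst _ rfl) (hfirst _ rfl)⟩
    linarith
  · obtain ⟨p, hp, hsign⟩ := exists_strictMono_alternating_of_le_varL hα (Nat.lt_of_not_le hvar)
    have hp0 : (⟨0, by omega⟩ : Fin n) < p 0 := by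
      refine lt_of_le_of_ne (Nat.zero_le _) fun h => ?_
      have := hsign 0
      rw [← h, hzero] at this
      norm_num at this
    have hq : StrictMono (Fin.cons ⟨0, by omega⟩ (p ∘ Fin.castSucc) : Fin (k + 1) → Fin n) := by
      intro a b
      refine Fin.cases ?_ (fun b => ?_) b
      · intro h
        exact absurd h (Fin.not_lt_zero a)
      · refine Fin.cases ?_ (fun a => ?_) a
        · intro _
          simp only [Fin.cons_zero, Fin.cons_succ, Function.comp]
          exact hp0.trans_le (hp.monotone (Fin.zero_le _))
        · intro h
          simp only [Fin.cons_succ, Function.comp]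
          exact hp (Fin.castSucc_lt_castSucc_iff.2 (Fin.succ_lt_succ_iff.1 h))
    have := mul_det_prependCol_nonneg (w := w) hA hq x 1 fun j => by
      refine Fin.cases ?_ (fun j => ?_) j
      · simpa using (hfirst ⟨0, by omega⟩ rfl).le
      · have := hαu (p j.castSucc)
        rw [hsign] at this
        simpa using this
    linarith [hneg _ hq]

/-- If the column spaces agree, corresponding maximal minors differ by a common nonzero factor. -/
theorem exists_det_submatrix_eq_mul {n d : ℕ} (hdn : d ≤ n) {M N : Matrix (Fin n) (Fin d) ℝ}
    (hM : ∀ s : Fin d → Fin n, StrictMono s → 0 < (M.submatrix s id).det)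
    (hNM : ∀ j, ∃ c, M.mulVec c = fun i => N i j) (hMN : ∀ j, ∃ c, N.mulVec c = fun i => M i j) :
    ∃ r : ℝ, r ≠ 0 ∧ ∀ s : Fin d → Fin n,
      (N.submatrix s id).det = (M.submatrix s id).det * r := by
  choose C hC using hNM
  choose C' hC' using hMN
  have hN : ∀ s : Fin d → Fin n,
      (N.submatrix s id).det = (M.submatrix s id).det * (Matrix.of C).transpose.det := by
    intro s
    rw [← Matrix.det_mul]
    congr 1
    ext i j
    exact (congrFun (hC j) (s i)).symm
  have hM' : ∀ s : Fin d → Fin n,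
      (M.submatrix s id).det = (N.submatrix s id).det * (Matrix.of C').transpose.det := by
    intro s
    rw [← Matrix.det_mul]
    congr 1
    ext i j
    exact (congrFun (hC' j) (s i)).symm
  refine ⟨_, fun h => ?_, hN⟩
  have := hM (Fin.castLE hdn) (Fin.strictMono_castLE hdn)
  rw [hM', hN, h, mul_zero, zero_mul] at this
  exact lt_irrefl _ this

theorem mem_span_columns_iff {n d : ℕ} (M : Matrix (Fin n) (Fin d) ℝ) (y : Fin n → ℝ) :
    y ∈ Submodule.span ℝ (Set.range fun j i => M i j) ↔ ∃ c, M.mulVec c = y := by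
  rw [Submodule.mem_span_range_iff_exists_fun]
  refine exists_congr fun c => ?_
  have : ∑ j, c j • (fun i => M i j) = M.mulVec c := by
    ext i
    simp [Matrix.mulVec, dotProduct, mul_comm]
  rw [this]

theorem bddAbove_of_le_varL {n k : ℕ} {w : Fin n → ℝ} {M : Matrix (Fin (n + 1)) (Fin k) ℝ}
    (hM : ∀ s : Fin k → Fin (n + 1), StrictMono s → 0 < (M.submatrix s id).det)
    {α : Fin n → ℝ} (hα : ∀ i, α i = 1 ∨ α i = -1) (hk : k ≤ varL α) :
    BddAbove ((fun x => M.mulVec x 0) ''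
      {x | ∀ i : Fin n, 0 ≤ α i * (w i + M.mulVec x i.succ)}) := by
  obtain ⟨p, hp, hsign⟩ := exists_strictMono_alternating_of_le_varL hα hk
  have hq : StrictMono (Fin.cons 0 (Fin.succ ∘ p) : Fin (k + 1) → Fin (n + 1)) := by
    intro a b
    refine Fin.cases ?_ (fun b => ?_) b
    · intro h
      exact absurd h (Fin.not_lt_zero a)
    · refine Fin.cases ?_ (fun a => ?_) a
      · intro _
        exact Fin.succ_pos _
      · intro h
        exact Fin.succ_lt_succ_iff.2 (hp (Fin.succ_lt_succ_iff.1 h))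
  set q : Fin (k + 1) → Fin (n + 1) := Fin.cons 0 (Fin.succ ∘ p)
  have hpos : ∀ j : Fin (k + 1), 0 < ((M.submatrix q id).submatrix j.succAbove id).det :=
    fun j => hM _ (hq.comp (Fin.strictMono_succAbove j))
  set m : Fin (k + 1) → ℝ := fun j => ((M.submatrix q id).submatrix j.succAbove id).det
  refine ⟨(∑ j : Fin k, m j.succ * (α (p j) * w (p j))) / m 0, ?_⟩
  rintro _ ⟨x, hx, rfl⟩
  rw [le_div_iff₀ (hpos 0)]
  have hrel : ∑ j : Fin (k + 1), (-1) ^ (j : ℕ) * (M.submatrix q id).mulVec x j * m j = 0 :=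
    sum_neg_one_pow_mul_mulVec_mul_det (M.submatrix q id) x
  rw [Fin.sum_univ_succ] at hrel
  have hle : ∑ j : Fin k, -((-1) ^ (j.succ : ℕ) * (M.submatrix q id).mulVec x j.succ * m j.succ) ≤
      ∑ j : Fin k, m j.succ * (α (p j) * w (p j)) := by
    refine Finset.sum_le_sum fun j _ => ?_
    have h := mul_nonneg (hpos j.succ).le (hx (p j))
    have hj : (M.submatrix q id).mulVec x j.succ = M.mulVec x (p j).succ := rfl
    rw [hj, Fin.val_succ, ← hsign]
    have : 0 ≤ m j.succ * (α (p j) * (w (p j) + M.mulVec x (p j).succ)) := h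
    linarith
  rw [Finset.sum_neg_distrib] at hle
  have h0 : (M.submatrix q id).mulVec x 0 = M.mulVec x 0 := rfl
  rw [h0, Fin.val_zero, pow_zero, one_mul] at hrel
  show M.mulVec x 0 * m 0 ≤ _
  linarith

theorem not_bddAbove_of_varL_lt {n k : ℕ} {w : Fin n → ℝ} {M : Matrix (Fin (n + 1)) (Fin k) ℝ}
    (hM : ∀ s : Fin k → Fin (n + 1), StrictMono s → 0 < (M.submatrix s id).det)
    {α : Fin n → ℝ} (hα : ∀ i, α i = 1 ∨ α i = -1) (hk : varL α < k) (hkn : k ≤ n)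
    {x₀ : Fin k → ℝ} (hx₀ : ∀ i : Fin n, 0 ≤ α i * (w i + M.mulVec x₀ i.succ)) :
    ¬ BddAbove ((fun x => M.mulVec x 0) ''
      {x | ∀ i : Fin n, 0 ≤ α i * (w i + M.mulVec x i.succ)}) := by
  obtain ⟨d, rfl⟩ : ∃ d, k = d + 1 := ⟨k - 1, by omega⟩
  obtain ⟨P, hP, hsign⟩ :=
    exists_strictMono_sign_of_varL_le hα (Nat.lt_succ_iff.1 hk) (by omega)
  obtain ⟨c, -, hzero, hpos⟩ :=
    exists_mulVec_sign M hM (P := Fin.succ ∘ P) fun a b hab => Fin.succ_lt_succ_iff.2 (hP hab)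
  have hc0 : 0 < M.mulVec c 0 := by
    have := hpos 0 (by
      rintro ⟨j, hj⟩
      exact Fin.succ_ne_zero _ hj)
    simpa using this
  have hc : ∀ i : Fin n, 0 ≤ α i * M.mulVec c i.succ := by
    intro i
    by_cases hi : i ∈ Set.range P
    · obtain ⟨j, rfl⟩ := hi
      have := hzero j
      rw [Function.comp_apply] at this
      rw [this, mul_zero]
    · have := hpos i.succ (by
        rintro ⟨j, hj⟩
        exact hi ⟨j, Fin.succ_injective _ hj⟩)
      simp only [Function.comp_apply, Fin.succ_lt_succ_iff] at this
      rw [hsign i hi]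
      exact this.le
  rintro ⟨b, hb⟩
  set t := (|b - M.mulVec x₀ 0| + 1) / M.mulVec c 0 with ht
  have ht0 : 0 ≤ t := by positivity
  have hmul : ∀ i, M.mulVec (x₀ + t • c) i = M.mulVec x₀ i + t * M.mulVec c i := by
    intro i
    rw [Matrix.mulVec_add, Matrix.mulVec_smul, Pi.add_apply, Pi.smul_apply, smul_eq_mul]
  have h := hb ⟨x₀ + t • c, fun i => ?_, rfl⟩
  · have h' : M.mulVec x₀ 0 + t * M.mulVec c 0 ≤ b := by
      rw [← hmul]
      exact h
    rw [ht, div_mul_cancel₀ _ hc0.ne'] at h'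
    linarith [le_abs_self (b - M.mulVec x₀ 0)]
  · rw [hmul]
    have := mul_nonneg ht0 (hc i)
    linarith [hx₀ i]

/-- Corollary 2.16: for a left cyclic polarized arrangement `(V,η,ξ)` of
`n` hyperplanes in `k`-space presented by matrix data `(A, w, ξ̂)`, a sign sequence `α` is
feasible iff `var_l(α) ≤ k` and bounded iff `var_l(α) ≥ k`. -/
theorem leftCyclic_feasible_bounded_iff_varL
    (n k : ℕ) (hk1 : 1 ≤ k) (hkn : k ≤ n - 1)
    (V : Submodule ℝ (Fin n → ℝ)) (hV : Module.finrank ℝ V = k)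
    (w : Fin n → ℝ) (hw : w ∉ V)
    (ξ : (Fin n → ℝ) →ₗ[ℝ] ℝ)
    (hcyc : IsLeftCyclic n k (V : Set (Fin n → ℝ)) w ξ)
    (A : Matrix (Fin n) (Fin k) ℝ)
    (hAspan : (Submodule.span ℝ (Set.range fun j i => A i j) : Set (Fin n → ℝ)) =
      (V : Set (Fin n → ℝ)))
    (hAind : LinearIndependent ℝ (fun j i => A i j))
    (xihat : Fin k → ℝ)
    (hxihat : ∀ x : Fin k → ℝ, ξ (A.mulVec x) = ∑ j, xihat j * x j)
    (α : Fin n → ℝ) (hα : ∀ i, α i = 1 ∨ α i = -1) :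
    (({x : Fin k → ℝ | ∀ i, 0 ≤ α i * (w i + A.mulVec x i)}).Nonempty ↔ varL α ≤ k) ∧
    (BddAbove ((fun x => ∑ j, xihat j * x j) ''
        {x : Fin k → ℝ | ∀ i, 0 ≤ α i * (w i + A.mulVec x i)}) ↔ k ≤ varL α) := by
  obtain ⟨⟨M, hMspan, hMpos⟩, ⟨M', hM'span, hM'pos⟩, u, hwu, hu, hu0⟩ := hcyc
  set B : Matrix (Fin n) (Fin k) ℝ := M'.submatrix Fin.succ id
  have hBpos : ∀ s : Fin k → Fin n, StrictMono s → 0 < (B.submatrix s id).det :=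
    fun s hs => hM'pos (Fin.succ ∘ s) fun a b hab => Fin.succ_lt_succ_iff.2 (hs hab)
  have hM'iff : ∀ y, (∃ c, M'.mulVec c = y) ↔ ∃ v ∈ V, y = Fin.cons (ξ v) v := by
    intro y
    rw [← mem_span_columns_iff, ← SetLike.mem_coe, hM'span]
    rfl
  have hMiff : ∀ y, (∃ c, M.mulVec c = y) ↔ ∃ v ∈ V, ∃ t : ℝ, y = v + t • w := by
    intro y
    rw [← mem_span_columns_iff, ← SetLike.mem_coe, hMspan]
    rfl
  have hAiff : ∀ y, (∃ x, A.mulVec x = y) ↔ y ∈ V := by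
    intro y
    rw [← mem_span_columns_iff, ← SetLike.mem_coe, hAspan]
    rfl
  have hBV : ∀ c, B.mulVec c ∈ V ∧ M'.mulVec c 0 = ξ (B.mulVec c) := by
    intro c
    obtain ⟨v, hv, hcv⟩ := (hM'iff _).1 ⟨c, rfl⟩
    have : B.mulVec c = v := by
      ext i
      exact congrFun hcv i.succ
    rw [this]
    exact ⟨hv, congrFun hcv 0⟩
  have hVB : ∀ v ∈ V, ∃ c, B.mulVec c = v := by
    intro v hv
    obtain ⟨c, hc⟩ := (hM'iff _).2 ⟨v, hv, rfl⟩
    exact ⟨c, funext fun i => congrFun hc i.succ⟩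
  have hNpos : ∀ s : Fin (k + 1) → Fin n, StrictMono s →
      0 < ((prependCol w B).submatrix s id).det := by
    obtain ⟨r, hr, hdet⟩ := exists_det_submatrix_eq_mul (N := prependCol w B) (by omega) hMpos
      (fun j => by
        rw [hMiff]
        refine Fin.cases ?_ (fun j => ?_) j
        · exact ⟨0, V.zero_mem, 1, by ext i; simp [prependCol]⟩
        · refine ⟨B.mulVec (Pi.single j 1), (hBV _).1, 0, ?_⟩
          ext i
          simp [prependCol])
      (fun j => by
        obtain ⟨v, hv, t, hvt⟩ := (hMiff (fun i => M i j)).1 ⟨Pi.single j 1, by ext i; simp⟩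
        obtain ⟨c, hc⟩ := hVB v hv
        refine ⟨Fin.cons t c, ?_⟩
        ext i
        rw [prependCol_mulVec, Fin.tail_cons, Fin.cons_zero, hc, add_comm]
        exact (congrFun hvt i).symm)
    rcases lt_or_gt_of_ne hr with hr | hr
    · exfalso
      obtain ⟨x, hx⟩ := hVB _ (V.neg_mem hwu)
      have hxu : ∀ i, w i + B.mulVec x i = u i := by
        intro i
        rw [hx]
        simp
      refine not_det_prependCol_neg (w := w) (x := x) (by omega) hBpos (fun y => ?_)
        (fun i hi => ?_) fun s hs => ?_
      · simp only [hxu]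
        exact hu _ (hBV y).1
      · rw [hxu]
        exact hu0 i hi
      · rw [hdet]
        exact mul_neg_of_pos_of_neg (hMpos s hs) hr
    · intro s hs
      rw [hdet]
      exact mul_pos (hMpos s hs) hr
  have himage : ((fun x => ∑ j, xihat j * x j) ''
        {x : Fin k → ℝ | ∀ i, 0 ≤ α i * (w i + A.mulVec x i)}) =
      (fun c => M'.mulVec c 0) ''
        {c : Fin k → ℝ | ∀ i : Fin n, 0 ≤ α i * (w i + M'.mulVec c i.succ)} := by
    ext t
    constructor
    · rintro ⟨x, hx, rfl⟩
      obtain ⟨c, hc⟩ := hVB _ ((hAiff _).1 ⟨x, rfl⟩)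
      refine ⟨c, fun i => ?_, ?_⟩
      · have := hx i
        rw [← hc] at this
        exact this
      · simp only
        rw [(hBV c).2, hc, hxihat]
    · rintro ⟨c, hc, rfl⟩
      obtain ⟨x, hx⟩ := (hAiff _).2 (hBV c).1
      refine ⟨x, fun i => ?_, ?_⟩
      · rw [hx]
        exact hc i
      · simp only
        rw [(hBV c).2, ← hx, hxihat]
  have hfeas : varL α ≤ k → ∃ c : Fin k → ℝ, ∀ i, 0 ≤ α i * (w i + B.mulVec c i) :=
    fun h => exists_feasible_of_varL_le hBpos hNpos hα h (by omega)
  constructor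
  · rw [← Set.image_nonempty (f := fun x => ∑ j, xihat j * x j), himage, Set.image_nonempty]
    exact ⟨fun ⟨c, hc⟩ => varL_le_of_feasible hBpos hNpos hα hc, hfeas⟩
  · rw [himage]
    refine ⟨fun h => ?_, bddAbove_of_le_varL hM'pos hα⟩
    by_contra hk
    obtain ⟨c, hc⟩ := hfeas (by omega)
    exact not_bddAbove_of_varL_lt hM'pos hα (not_le.1 hk) (by omega) hc h
end

section
/- Let 1 ≤ k ≤ n−1 and let (V,η,ξ) be a right cyclic polarized arrangement of n hyperplanes in k-space. Fix an n×k matrix A whose columns form a basis of V, a representative w ∈ ℝ^n of η, and the row vector ξ̂ ∈ ℝ^{1×k} of ξ in this basis. Then for every sign sequence α ∈ {+1,−1}^n: the region Δ_α is nonempty (α is feasible) if and only if var_r(α) ≤ k, and the linear function x ↦ ξ̂x is bounded above on Δ_α (α is bounded) if and only if var_r(α) ≥ k. In particular the bounded feasible sign sequences are exactly those with var_r(α) = k. -/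
open scoped BigOperators

namespace TotallyPositive

open Matrix

/-- The linear form `y ↦ ∑ j, (-1)^j y_{s_j} det M_{s ∖ s_j}` attached to a `(d+1)`-tuple of rows
of an `m × d` matrix `M`; it vanishes on the column space of `M`. -/
noncomputable def circuitForm {m d : ℕ} (M : Matrix (Fin m) (Fin d) ℝ) (s : Fin (d + 1) → Fin m) :
    (Fin m → ℝ) →ₗ[ℝ] ℝ :=
  ∑ j : Fin (d + 1), ((-1) ^ (j : ℕ) * (M.submatrix (s ∘ j.succAbove) id).det) • LinearMap.proj (s j)

theorem circuitForm_apply {m d : ℕ} (M : Matrix (Fin m) (Fin d) ℝ) (s : Fin (d + 1) → Fin m)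
    (y : Fin m → ℝ) :
    circuitForm M s y =
      ∑ j : Fin (d + 1), (-1) ^ (j : ℕ) * (M.submatrix (s ∘ j.succAbove) id).det * y (s j) := by
  simp [circuitForm]

theorem circuitForm_eq_det {m d : ℕ} (M : Matrix (Fin m) (Fin d) ℝ) (s : Fin (d + 1) → Fin m)
    (y : Fin m → ℝ) :
    circuitForm M s y =
      (Matrix.of fun j => (Fin.cons (y (s j)) (M (s j)) : Fin (d + 1) → ℝ)).det := by
  rw [circuitForm_apply, Matrix.det_succ_column_zero]
  refine Finset.sum_congr rfl fun j _ => ?_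
  have : (Matrix.of fun j => (Fin.cons (y (s j)) (M (s j)) : Fin (d + 1) → ℝ)).submatrix
      j.succAbove Fin.succ = M.submatrix (s ∘ j.succAbove) id := by
    ext a b
    simp
  rw [this]
  simp
  ring

theorem circuitForm_mulVec {m d : ℕ} (M : Matrix (Fin m) (Fin d) ℝ) (s : Fin (d + 1) → Fin m)
    (c : Fin d → ℝ) : circuitForm M s (M *ᵥ c) = 0 := by
  rw [circuitForm_eq_det, ← Matrix.exists_mulVec_eq_zero_iff]
  refine ⟨Fin.cons (-1) c, fun h => ?_, ?_⟩
  · simpa using congrFun h 0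
  · ext j
    simp [Matrix.mulVec, dotProduct, Fin.sum_univ_succ]

theorem circuitForm_nonneg {m d : ℕ} {M : Matrix (Fin m) (Fin d) ℝ}
    (hM : ∀ s : Fin d → Fin m, StrictMono s → 0 < (M.submatrix s id).det)
    {s : Fin (d + 1) → Fin m} (hs : StrictMono s) {y : Fin m → ℝ}
    (hy : ∀ j : Fin (d + 1), 0 ≤ (-1) ^ (j : ℕ) * y (s j)) : 0 ≤ circuitForm M s y := by
  rw [circuitForm_apply]
  refine Finset.sum_nonneg fun j _ => ?_
  have := mul_nonneg (hM _ (hs.comp (Fin.strictMono_succAbove j))).le (hy j)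
  linarith

theorem circuitForm_pos {m d : ℕ} {M : Matrix (Fin m) (Fin d) ℝ}
    (hM : ∀ s : Fin d → Fin m, StrictMono s → 0 < (M.submatrix s id).det)
    {s : Fin (d + 1) → Fin m} (hs : StrictMono s) {y : Fin m → ℝ}
    (hy : ∀ j : Fin (d + 1), 0 ≤ (-1) ^ (j : ℕ) * y (s j)) (hy0 : 0 < y (s 0)) : 0 < circuitForm M s y := by
  rw [circuitForm_apply]
  refine Finset.sum_pos' (fun j _ => ?_) ⟨0, Finset.mem_univ _, ?_⟩
  · have := mul_nonneg (hM _ (hs.comp (Fin.strictMono_succAbove j))).le (hy j)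
    linarith
  · simpa using mul_pos (hM _ (hs.comp (Fin.strictMono_succAbove 0))) hy0

theorem varCount_succ {m : ℕ} (β : Fin (m + 2) → ℝ) :
    varCount β = varCount (fun i : Fin (m + 1) => β i.castSucc) +
      if β (Fin.last m).castSucc ≠ β (Fin.last (m + 1)) then 1 else 0 := by
  unfold varCount
  simp only [Finset.card_filter]
  rw [Fin.sum_univ_castSucc]
  simp

theorem varCount_le {m : ℕ} (β : Fin (m + 1) → ℝ) : varCount β ≤ m :=
  (Finset.card_filter_le _ _).trans (by simp)

theorem sign_last {m : ℕ} (β : Fin (m + 1) → ℝ) (hβ : ∀ i, β i = 1 ∨ β i = -1) :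
    β (Fin.last m) = (-1) ^ varCount β * β 0 := by
  induction m with
  | zero => simp [varCount]
  | succ m ih =>
    have h := ih (fun i => β i.castSucc) fun i => hβ _
    rw [varCount_succ]
    simp only [Fin.castSucc_zero] at h
    split_ifs with hne
    · rw [pow_succ, mul_right_comm, ← h]
      rcases hβ (Fin.last m).castSucc with h1 | h1 <;> rcases hβ (Fin.last (m + 1)) with h2 | h2 <;>
        simp [h1, h2] at hne ⊢
    · rw [add_zero, ← h]
      exact (not_not.mp hne).symm

theorem first_sign_eq_one {m : ℕ} {β : Fin (m + 1) → ℝ} (hβ : ∀ i, β i = 1 ∨ β i = -1)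
    (h : β (Fin.last m) = (-1) ^ varCount β) : β 0 = 1 := by
  rw [sign_last β hβ] at h
  exact mul_eq_left₀ (pow_ne_zero _ (by norm_num)) |>.mp h

theorem strictMono_snoc {m d : ℕ} {s : Fin d → Fin m} (hs : StrictMono s) :
    StrictMono (Fin.snoc (fun j => (s j).castSucc) (Fin.last m) : Fin (d + 1) → Fin (m + 1)) := by
  intro i j hij
  induction j using Fin.lastCases with
  | last =>
    induction i using Fin.lastCases with
    | last => exact absurd hij (lt_irrefl _)
    | cast i => simp [Fin.castSucc_lt_last]
  | cast j =>
    induction i using Fin.lastCases with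
    | last => exact absurd hij (not_lt.mpr (Fin.le_last _))
    | cast i => simpa using hs (by simpa using hij)

/-- A sign sequence with at least `d` sign changes has an alternating subsequence of length `d + 1`
starting at its first entry. -/
theorem exists_alternating {m : ℕ} (β : Fin (m + 1) → ℝ) (hβ : ∀ i, β i = 1 ∨ β i = -1)
    {d : ℕ} (hd : d ≤ varCount β) :
    ∃ s : Fin (d + 1) → Fin (m + 1), StrictMono s ∧ s 0 = 0 ∧
      ∀ j : Fin (d + 1), β (s j) = (-1) ^ (j : ℕ) * β 0 := by
  induction m generalizing d with
  | zero =>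
    obtain rfl : d = 0 := by have := varCount_le β; omega
    have : Subsingleton (Fin (0 + 1)) := Fin.subsingleton_one
    exact ⟨fun _ => 0, Subsingleton.strictMono _, rfl, fun j => by simp [Subsingleton.elim j 0]⟩
  | succ m ih =>
    have ih := fun {d} => ih (fun i => β i.castSucc) (fun i => hβ _) (d := d)
    by_cases h : d ≤ varCount (fun i : Fin (m + 1) => β i.castSucc)
    · obtain ⟨s, hs, h0, hj⟩ := ih h
      exact ⟨fun j => (s j).castSucc, fun i j hij => by simpa using hs hij, by simp [h0], by
        simpa using hj⟩
    · have hv := varCount_succ β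
      obtain ⟨e, rfl⟩ : ∃ e, d = e + 1 := ⟨d - 1, by omega⟩
      have he : varCount (fun i : Fin (m + 1) => β i.castSucc) = e := by
        split_ifs at hv <;> omega
      obtain ⟨s, hs, h0, hj⟩ := ih he.ge
      refine ⟨_, strictMono_snoc hs, ?_, fun j => ?_⟩
      · rw [← Fin.castSucc_zero, Fin.snoc_castSucc, h0]
        rfl
      · induction j using Fin.lastCases with
        | last =>
          rw [Fin.snoc_last, sign_last β hβ]
          have : varCount β = e + 1 := by split_ifs at hv <;> omega
          simp [this]
        | cast j => simpa using hj j

theorem exists_small {ι : Type*} [Finite ι] (a b : ι → ℝ) (ha : ∀ i, 0 < a i) :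
    ∃ ε : ℝ, 0 < ε ∧ ∀ i, 0 < a i + ε * b i := by
  have h : ∀ᶠ ε in nhdsWithin (0 : ℝ) (Set.Ioi 0), ∀ i, 0 < a i + ε * b i := by
    refine Filter.eventually_all.mpr fun i => ?_
    have hc : Filter.Tendsto (fun ε : ℝ => a i + ε * b i) (nhdsWithin 0 (Set.Ioi 0))
        (nhds (a i)) := by
      have : Continuous fun ε : ℝ => a i + ε * b i := by fun_prop
      simpa using (this.tendsto 0).mono_left nhdsWithin_le_nhds
    exact hc.eventually (lt_mem_nhds (ha i))
  obtain ⟨ε, h1, h2⟩ := (h.and self_mem_nhdsWithin).exists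
  exact ⟨ε, h2, h1⟩

/-- The column space of a matrix with positive maximal minors contains vectors of every sign
pattern with fewer sign changes than the number of columns. -/
theorem exists_sign_pattern {m e : ℕ} (hem : e ≤ m) (M : Matrix (Fin (m + 1)) (Fin (e + 1)) ℝ)
    (hM : ∀ s : Fin (e + 1) → Fin (m + 1), StrictMono s → 0 < (M.submatrix s id).det)
    (β : Fin (m + 1) → ℝ) (hβ : ∀ i, β i = 1 ∨ β i = -1) (hv : varCount β ≤ e) :
    ∃ c, ∀ i, 0 < β i * (M *ᵥ c) i := by
  induction m generalizing e with
  | zero =>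
    obtain rfl : e = 0 := by omega
    have h := hM id strictMono_id
    rw [Matrix.submatrix_id_id, Matrix.det_fin_one] at h
    refine ⟨fun _ => β 0, fun i => ?_⟩
    rw [Fin.subsingleton_one.elim i 0]
    rcases hβ 0 with h1 | h1 <;> simpa [h1, Matrix.mulVec, dotProduct] using h
  | succ m ih =>
    have hvs := varCount_succ β
    set β' : Fin (m + 1) → ℝ := fun i => β i.castSucc with hβ'
    by_cases hlt : varCount β' < e
    · obtain ⟨e, rfl⟩ : ∃ e', e = e' + 1 := ⟨e - 1, by omega⟩
      let s₀ : Fin (e + 1) → Fin (m + 1) := Fin.castLE (by omega)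
      have hs₀ : StrictMono s₀ := Fin.strictMono_castLE _
      set t₀ : Fin (e + 2) → Fin (m + 2) :=
        Fin.snoc (fun j => (s₀ j).castSucc) (Fin.last (m + 1)) with ht₀
      have hN := hM t₀ (strictMono_snoc hs₀)
      set N := M.submatrix t₀ id with hNdef
      have hNN : N * N⁻¹ = 1 := Matrix.mul_nonsing_inv _ (isUnit_iff_ne_zero.mpr hN.ne')
      have hNi : 0 < (N⁻¹).det := by
        have := congrArg Matrix.det hNN
        rw [Matrix.det_mul, Matrix.det_one] at this
        exact pos_of_mul_pos_right (this ▸ one_pos) hN.le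
      set P := M * N⁻¹ with hP
      have hPminor : ∀ s : Fin (e + 2) → Fin (m + 2), StrictMono s →
          0 < (P.submatrix s id).det := fun s hs => by
        have : P.submatrix s id = M.submatrix s id * N⁻¹ := by
          ext i j; simp [hP, Matrix.mul_apply]
        rw [this, Matrix.det_mul]
        exact mul_pos (hM s hs) hNi
      have hPlast : ∀ j, P (Fin.last (m + 1)) j = (1 : Matrix _ _ ℝ) (Fin.last (e + 1)) j := by
        intro j
        rw [← hNN]
        simp [hP, hNdef, ht₀, Matrix.mul_apply]
      obtain ⟨c, hc⟩ := ih (e := e) (by omega) (P.submatrix Fin.castSucc Fin.castSucc)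
        (fun s hs => by
          have h := hPminor _ (strictMono_snoc hs)
          rw [Matrix.det_succ_row _ (Fin.last _)] at h
          rw [Fin.sum_univ_castSucc] at h
          simp only [Matrix.submatrix_apply, Fin.snoc_last, id, hPlast] at h
          rw [Finset.sum_eq_zero (fun i _ => by
            rw [Matrix.one_apply_ne (Fin.castSucc_lt_last i).ne']; ring)] at h
          simp only [Matrix.one_apply_eq, zero_add, Fin.succAbove_last,
            Matrix.submatrix_submatrix] at h
          rw [Even.neg_one_pow ⟨_, rfl⟩] at h
          convert h using 1
          simp only [one_mul]
          congr 1
          ext i j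
          simp) β' (fun i => hβ _) (by omega)
      have hl : ∀ x, (P *ᵥ x) (Fin.last (m + 1)) = x (Fin.last (e + 1)) := by
        intro x
        have : (P *ᵥ x) (Fin.last (m + 1)) = ((1 : Matrix _ _ ℝ) *ᵥ x) (Fin.last (e + 1)) := by
          simp only [Matrix.mulVec, dotProduct, hPlast]
        rw [this, Matrix.one_mulVec]
      let x₀ : Fin (e + 2) → ℝ := Fin.snoc c 0
      let x₁ : Fin (e + 2) → ℝ := Pi.single (Fin.last _) (β (Fin.last _))
      have hx₀ : ∀ i : Fin (m + 1), (P *ᵥ x₀) i.castSucc =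
          (P.submatrix Fin.castSucc Fin.castSucc *ᵥ c) i := by
        intro i
        simp [x₀, Matrix.mulVec, dotProduct, Fin.sum_univ_castSucc]
      obtain ⟨ε, hε, h⟩ := exists_small (fun i : Fin (m + 1) => β' i * (P *ᵥ x₀) i.castSucc)
        (fun i => β' i * (P *ᵥ x₁) i.castSucc) (fun i => by rw [hx₀]; exact hc i)
      refine ⟨N⁻¹ *ᵥ (x₀ + ε • x₁), fun i => ?_⟩
      rw [Matrix.mulVec_mulVec, ← hP]
      induction i using Fin.lastCases with
      | last =>
        rw [hl]
        rcases hβ (Fin.last (m + 1)) with h1 | h1 <;> simp [x₀, x₁, h1, hε]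
      | cast i =>
        have := h i
        simp only [Matrix.mulVec_add, Matrix.mulVec_smul, Pi.add_apply, Pi.smul_apply, smul_eq_mul]
        simp only [hβ'] at this
        linarith
    · have he : varCount β' = e := by omega
      have heq : varCount β = e := by omega
      obtain ⟨c, hc⟩ := ih (e := e) (he ▸ varCount_le β') (M.submatrix Fin.castSucc id)
        (fun s hs => hM (fun j => (s j).castSucc) fun i j hij => by simpa using hs hij)
        β' (fun i => hβ _) he.le
      refine ⟨c, fun i => ?_⟩
      induction i using Fin.lastCases with
      | cast i => exact hc i
      | last =>
        obtain ⟨s, hs, h0, hj⟩ := exists_alternating β' (fun i => hβ _) he.ge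
        have hlast : β (Fin.last (m + 1)) = (-1) ^ e * β 0 := heq ▸ sign_last β hβ
        have hβ0 : β' 0 = β 0 := rfl
        by_contra hneg
        have hpos : 0 < circuitForm M (Fin.snoc (fun j => (s j).castSucc) (Fin.last (m + 1)))
            (β 0 • (M *ᵥ c)) := by
          refine circuitForm_pos hM (strictMono_snoc hs) (fun j => ?_) ?_
          · induction j using Fin.lastCases with
            | last =>
              simp only [Fin.snoc_last, Fin.val_last, Pi.smul_apply, smul_eq_mul]
              rw [hlast] at hneg
              rw [pow_succ]
              linarith
            | cast j =>
              simp only [Fin.snoc_castSucc, Fin.val_castSucc, Pi.smul_apply, smul_eq_mul]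
              have := hc (s j)
              rw [hj j, hβ0] at this
              rw [mul_assoc] at this
              exact this.le
          · rw [show (0 : Fin (e + 2)) = (0 : Fin (e + 1)).castSucc from rfl, Fin.snoc_castSucc, h0]
            exact hc 0
        rw [map_smul, circuitForm_mulVec, smul_zero] at hpos
        exact lt_irrefl _ hpos

theorem mem_span_cols_iff {m d : ℕ} (M : Matrix (Fin m) (Fin d) ℝ) (y : Fin m → ℝ) :
    (∃ c, M *ᵥ c = y) ↔ y ∈ Submodule.span ℝ (Set.range fun j i => M i j) := by
  change _ ↔ y ∈ Submodule.span ℝ (Set.range M.col)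
  rw [← Matrix.range_mulVecLin]
  rfl

theorem submatrix_comp_mulVec {m m' d : ℕ} (M : Matrix (Fin m) (Fin d) ℝ) (f : Fin m' → Fin m)
    (c : Fin d → ℝ) (i : Fin m') : (M.submatrix f id *ᵥ c) i = (M *ᵥ c) (f i) := rfl

/-- If the column space of `M` together with `w` lies in a totally positive `(d+1)`-space, then all
values of the circuit forms of `M` at `w` have the same sign. -/
theorem circuitForm_pos_of_pos {m d : ℕ} (M : Matrix (Fin m) (Fin d) ℝ)
    (N : Matrix (Fin m) (Fin (d + 1)) ℝ)
    (hN : ∀ s : Fin (d + 1) → Fin m, StrictMono s → 0 < (N.submatrix s id).det)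
    {w : Fin m → ℝ} (hw : ∃ g, N *ᵥ g = w) (hM : ∀ j, ∃ g, N *ᵥ g = fun i => M i j)
    {s t : Fin (d + 1) → Fin m} (hs : StrictMono s) (ht : StrictMono t)
    (hpos : 0 < circuitForm M s w) : 0 < circuitForm M t w := by
  obtain ⟨g₀, hg₀⟩ := hw
  choose g hg using hM
  let G : Matrix (Fin (d + 1)) (Fin (d + 1)) ℝ :=
    Matrix.of fun i => Fin.cons (g₀ i) fun j => g j i
  have key : ∀ r : Fin (d + 1) → Fin m,
      circuitForm M r w = (N.submatrix r id).det * G.det := by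
    intro r
    rw [circuitForm_eq_det, ← Matrix.det_mul]
    congr 1
    ext a b
    refine Fin.cases ?_ (fun b => ?_) b
    · simp [G, ← hg₀, Matrix.mul_apply, Matrix.mulVec, dotProduct]
    · have := congrFun (hg b) (r a)
      simp only [Matrix.mulVec, dotProduct] at this
      simp [G, ← this, Matrix.mul_apply]
  rw [key] at hpos ⊢
  exact mul_pos (hN t ht) (pos_of_mul_pos_right hpos (hN s hs).le)

theorem exists_circuitForm_pos_of_orthogonal {m e : ℕ} (hem : e ≤ m)
    (M : Matrix (Fin (m + 1)) (Fin (e + 1)) ℝ)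
    (hM : ∀ s : Fin (e + 1) → Fin (m + 1), StrictMono s → 0 < (M.submatrix s id).det)
    {u : Fin (m + 1) → ℝ} (hu : 0 < u 0) (horth : ∀ c, ∑ i, u i * (M *ᵥ c) i = 0) :
    ∃ s : Fin (e + 2) → Fin (m + 1), StrictMono s ∧ 0 < circuitForm M s u := by
  classical
  let β : Fin (m + 1) → ℝ := fun i => if u i < 0 then -1 else 1
  have hβ : ∀ i, β i = 1 ∨ β i = -1 := fun i => by
    by_cases h : u i < 0 <;> simp [β, h]
  have hβu : ∀ i, 0 ≤ β i * u i := fun i => by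
    by_cases h : u i < 0
    · simpa [β, h] using h.le
    · simpa [β, h] using not_lt.mp h
  have hβ0 : β 0 = 1 := by simp [β, hu.le]
  by_cases hv : varCount β ≤ e
  · obtain ⟨c, hc⟩ := exists_sign_pattern hem M hM β hβ hv
    have : 0 < ∑ i, u i * (M *ᵥ c) i := by
      refine Finset.sum_pos' (fun i _ => ?_) ⟨0, Finset.mem_univ _, ?_⟩
      · have h1 := mul_nonneg (hβu i) (hc i).le
        rcases hβ i with h | h <;> rw [h] at h1 <;> linarith
      · have := hc 0
        rw [hβ0, one_mul] at this
        exact mul_pos hu this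
    exact absurd (horth c) this.ne'
  · obtain ⟨s, hs, h0, hj⟩ := exists_alternating β hβ (d := e + 1) (by omega)
    refine ⟨s, hs, circuitForm_pos hM hs (fun j => ?_) (h0 ▸ hu)⟩
    have := hβu (s j)
    rwa [hj j, hβ0, mul_one] at this

theorem varR_eq {p : ℕ} (k : ℕ) (α : Fin (p + 1) → ℝ) :
    varR k α = varCount α + if α (Fin.last p) ≠ (-1) ^ k then 1 else 0 := by
  simp [varR, varCount_succ]

theorem exists_alternating_of_lt_varR {p k : ℕ} {α : Fin (p + 1) → ℝ}
    (hα : ∀ i, α i = 1 ∨ α i = -1) (h : k < varR k α) :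
    ∃ s : Fin (k + 1) → Fin (p + 1), StrictMono s ∧
      ∀ j : Fin (k + 1), α (s j) = -(-1) ^ (j : ℕ) := by
  rw [varR_eq] at h
  rcases hα 0 with h0 | h0
  · have hlt : k + 1 ≤ varCount α := by
      by_contra hcon
      split_ifs at h with hne
      · have : varCount α = k := by omega
        exact hne (by rw [sign_last α hα, h0, this, mul_one])
      · omega
    obtain ⟨s, hs, -, hj⟩ := exists_alternating α hα hlt
    exact ⟨s ∘ Fin.succ, hs.comp (Fin.strictMono_succ), fun j => by simp [hj, h0, pow_succ]⟩
  · obtain ⟨s, hs, -, hj⟩ := exists_alternating α hα (d := k) (by split_ifs at h <;> omega)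
    exact ⟨s, hs, fun j => by simp [hj, h0]⟩

end TotallyPositive

/-- for a right cyclic polarized arrangement `(V,η,ξ)` of `n` hyperplanes
in `k`-space presented by matrix data `(A, w, ξ̂)`, a sign sequence `α` is feasible iff
`var_r(α) ≤ k` and bounded iff `var_r(α) ≥ k`. -/
theorem rightCyclic_feasible_bounded_iff_varR
    (n k : ℕ) (hk1 : 1 ≤ k) (hkn : k ≤ n - 1)
    (V : Submodule ℝ (Fin n → ℝ)) (hV : Module.finrank ℝ V = k)
    (w : Fin n → ℝ) (hw : w ∉ V)
    (ξ : (Fin n → ℝ) →ₗ[ℝ] ℝ)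
    (hcyc : IsRightCyclic n k (V : Set (Fin n → ℝ)) w ξ)
    (A : Matrix (Fin n) (Fin k) ℝ)
    (hAspan : (Submodule.span ℝ (Set.range fun j i => A i j) : Set (Fin n → ℝ)) =
      (V : Set (Fin n → ℝ)))
    (hAind : LinearIndependent ℝ (fun j i => A i j))
    (xihat : Fin k → ℝ)
    (hxihat : ∀ x : Fin k → ℝ, ξ (A.mulVec x) = ∑ j, xihat j * x j)
    (α : Fin n → ℝ) (hα : ∀ i, α i = 1 ∨ α i = -1) :
    (({x : Fin k → ℝ | ∀ i, 0 ≤ α i * (w i + A.mulVec x i)}).Nonempty ↔ varR k α ≤ k) ∧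
    (BddAbove ((fun x => ∑ j, xihat j * x j) ''
        {x : Fin k → ℝ | ∀ i, 0 ≤ α i * (w i + A.mulVec x i)}) ↔ k ≤ varR k α) := by
  obtain ⟨p, rfl⟩ : ∃ p, n = p + 1 := ⟨n - 1, by omega⟩
  obtain ⟨e, rfl⟩ : ∃ e, k = e + 1 := ⟨k - 1, by omega⟩
  have hep : e + 1 ≤ p := by omega
  obtain ⟨⟨N, hNspan, hN⟩, ⟨M, hMspan, hM⟩, u, huw, huV, hu0⟩ := hcyc
  have hVA : ∀ v, v ∈ V ↔ ∃ x, A.mulVec x = v := fun v => by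
    rw [← SetLike.mem_coe, ← hAspan]
    exact (TotallyPositive.mem_span_cols_iff A v).symm
  have hNmem : ∀ v ∈ V, ∀ t : ℝ, ∃ g, N.mulVec g = v + t • w := fun v hv t => by
    rw [TotallyPositive.mem_span_cols_iff, ← SetLike.mem_coe, hNspan]
    exact ⟨v, hv, t, rfl⟩
  have hMV : ∀ c, ∃ v ∈ V, M.mulVec c = Fin.snoc v ((-1) ^ (e + 1) * ξ v) := fun c => by
    have : M.mulVec c ∈ (Submodule.span ℝ (Set.range fun j i => M i j) : Set _) :=
      (TotallyPositive.mem_span_cols_iff M _).mp ⟨c, rfl⟩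
    rwa [hMspan] at this
  have hVM : ∀ v ∈ V, ∃ c, M.mulVec c = Fin.snoc v ((-1) ^ (e + 1) * ξ v) := fun v hv => by
    rw [TotallyPositive.mem_span_cols_iff, ← SetLike.mem_coe, hMspan]
    exact ⟨v, hv, rfl⟩
  set M₀ := M.submatrix Fin.castSucc id
  have hM₀ : ∀ s : Fin (e + 1) → Fin (p + 1), StrictMono s → 0 < (M₀.submatrix s id).det :=
    fun s hs => hM (fun j => (s j).castSucc) fun i j hij => by simpa using hs hij
  have hM₀V : ∀ c, M₀.mulVec c ∈ V := fun c => by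
    obtain ⟨v, hv, h⟩ := hMV c
    convert hv using 1
    ext i
    rw [TotallyPositive.submatrix_comp_mulVec, h, Fin.snoc_castSucc]
  have hform : ∀ s, ∀ v ∈ V, TotallyPositive.circuitForm M₀ s v = 0 := fun s v hv => by
    obtain ⟨c, hc⟩ := hVM v hv
    have : v = M₀.mulVec c := by
      ext i
      rw [TotallyPositive.submatrix_comp_mulVec, hc, Fin.snoc_castSucc]
    rw [this, TotallyPositive.circuitForm_mulVec]
  have hwpos : ∀ s, StrictMono s → 0 < TotallyPositive.circuitForm M₀ s w := fun s hs => by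
    obtain ⟨t, ht, hpos⟩ := TotallyPositive.exists_circuitForm_pos_of_orthogonal (by omega) M₀ hM₀
      (hu0 0 rfl) fun c => huV _ (hM₀V c)
    have hwu := hform t _ huw
    rw [map_sub, sub_eq_zero] at hwu
    refine TotallyPositive.circuitForm_pos_of_pos M₀ N hN ?_ (fun j => ?_) ht hs (hwu ▸ hpos)
    · simpa using hNmem 0 V.zero_mem 1
    · have h := hNmem _ (hM₀V (Pi.single j 1)) 0
      rwa [Matrix.mulVec_single_one, zero_smul, add_zero] at h
  have hempty : e + 1 < varR (e + 1) α →
      ¬ ({x : Fin (e + 1) → ℝ | ∀ i, 0 ≤ α i * (w i + A.mulVec x i)}).Nonempty := by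
    rintro hlt ⟨x, hx⟩
    obtain ⟨s, hs, hj⟩ := TotallyPositive.exists_alternating_of_lt_varR hα hlt
    have h1 : 0 ≤ TotallyPositive.circuitForm M₀ s (-(w + A.mulVec x)) :=
      TotallyPositive.circuitForm_nonneg hM₀ hs fun j => by
        have := hx (s j)
        rw [hj] at this
        simp only [Pi.neg_apply, Pi.add_apply]
        linarith
    rw [map_neg, map_add, hform s _ ((hVA _).mpr ⟨x, rfl⟩), add_zero] at h1
    linarith [hwpos s hs]
  have hray : ∀ v : Fin (p + 1) → ℝ, (∀ i, 0 < α i * v i) →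
      ∃ T₀ : ℝ, ∀ T, T₀ ≤ T → ∀ i, 0 ≤ α i * (w i + T * v i) := fun v hv => by
    obtain ⟨ε, hε, h⟩ := TotallyPositive.exists_small (fun i => α i * v i) (fun i => α i * w i) hv
    refine ⟨ε⁻¹, fun T hT i => ?_⟩
    have h1 : 0 ≤ ε⁻¹ * (α i * v i + ε * (α i * w i)) :=
      mul_nonneg (inv_pos.mpr hε).le (h i).le
    rw [mul_add, inv_mul_cancel_left₀ hε.ne'] at h1
    have h2 := mul_le_mul_of_nonneg_right hT (hv i).le
    linarith
  refine ⟨⟨fun h => ?_, fun h => ?_⟩, fun h => ?_, fun h => ?_⟩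
  · by_contra hcon
    exact hempty (by omega) h
  · rw [TotallyPositive.varR_eq] at h
    by_cases hv : varCount α ≤ e
    · obtain ⟨c, hc⟩ := TotallyPositive.exists_sign_pattern (by omega) M₀ hM₀ α hα hv
      obtain ⟨x, hx⟩ := (hVA _).mp (hM₀V c)
      obtain ⟨T, hT⟩ := hray _ hc
      refine ⟨T • x, fun i => ?_⟩
      simpa [Matrix.mulVec_smul, hx] using hT T le_rfl i
    · have hve : varCount α = e + 1 := by omega
      have hlast : α (Fin.last p) = (-1) ^ (e + 1) := by
        by_contra hne
        simp [hne] at h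
        omega
      have hα0 : α 0 = 1 := TotallyPositive.first_sign_eq_one hα (by rw [hlast, hve])
      obtain ⟨g, hg⟩ := TotallyPositive.exists_sign_pattern hep N hN α hα hve.le
      obtain ⟨v, hv, t, hvt⟩ : N.mulVec g ∈ {y | ∃ v ∈ (V : Set _), ∃ t : ℝ, y = v + t • w} :=
        hNspan ▸ (TotallyPositive.mem_span_cols_iff N _).mp ⟨g, rfl⟩
      obtain ⟨s, hs, h0, hj⟩ := TotallyPositive.exists_alternating α hα hve.ge
      have hpos : 0 < TotallyPositive.circuitForm M₀ s (N.mulVec g) := by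
        refine TotallyPositive.circuitForm_pos hM₀ hs (fun j => ?_) ?_
        · have := (hg (s j)).le
          rwa [hj, hα0, mul_one] at this
        · have := hg 0
          rwa [hα0, one_mul, ← h0] at this
      rw [hvt, map_add, hform s v hv, zero_add, map_smul, smul_eq_mul] at hpos
      have ht : 0 < t := pos_of_mul_pos_left hpos (hwpos s hs).le
      obtain ⟨x, hx⟩ := (hVA _).mp hv
      refine ⟨t⁻¹ • x, fun i => ?_⟩
      have h1 := mul_nonneg (inv_pos.mpr ht).le (hg i).le
      rw [Matrix.mulVec_smul, hx]
      simp only [hvt, Pi.add_apply, Pi.smul_apply, smul_eq_mul] at h1 ⊢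
      calc 0 ≤ t⁻¹ * (α i * (v i + t * w i)) := h1
        _ = α i * (w i + t⁻¹ * v i) := by
          field_simp
          ring
  · by_contra hcon
    obtain ⟨c, hc⟩ := TotallyPositive.exists_sign_pattern (by omega) M hM
      (Fin.snoc α ((-1) ^ (e + 1))) (fun i => by
        induction i using Fin.lastCases with
        | last => simpa using neg_one_pow_eq_or ℝ (e + 1)
        | cast i => simpa using hα i) (show varR (e + 1) α ≤ e by omega)
    obtain ⟨v, hv, hcv⟩ := hMV c
    have hαv : ∀ i, 0 < α i * v i := fun i => by simpa [hcv] using hc i.castSucc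
    have hξ : 0 < ξ v := by
      have := hc (Fin.last _)
      rwa [hcv, Fin.snoc_last, Fin.snoc_last, ← mul_assoc, ← mul_pow, neg_one_mul, neg_neg,
        one_pow, one_mul] at this
    obtain ⟨x, hx⟩ := (hVA _).mp hv
    obtain ⟨T₀, hT₀⟩ := hray v hαv
    obtain ⟨B, hB⟩ := h
    have hbd : ∀ T, T₀ ≤ T → T * ξ v ≤ B := fun T hT => by
      refine hB ⟨T • x, fun i => ?_, ?_⟩
      · simpa [Matrix.mulVec_smul, hx] using hT₀ T hT i
      · simp only
        rw [← hxihat, Matrix.mulVec_smul, hx, map_smul, smul_eq_mul]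
    have h1 := hbd (max T₀ ((B + 1) / ξ v)) (le_max_left _ _)
    have h2 := mul_le_mul_of_nonneg_right (le_max_right T₀ ((B + 1) / ξ v)) hξ.le
    rw [div_mul_cancel₀ _ hξ.ne'] at h2
    linarith
  · rcases h.lt_or_eq with hlt | heq
    · rw [Set.not_nonempty_iff_eq_empty.mp (hempty hlt), Set.image_empty]
      exact bddAbove_empty
    · rw [TotallyPositive.varR_eq] at heq
      have hα0 : α 0 = 1 := by
        split_ifs at heq with hne
        · have hv : varCount α = e := by omega
          have hl := TotallyPositive.sign_last α hα
          rw [hv] at hl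
          rcases hα 0 with h0 | h0
          · exact h0
          · exact absurd (by rw [hl, h0, pow_succ]) hne
        · exact TotallyPositive.first_sign_eq_one hα (by rw [not_not.mp hne, heq, add_zero])
      obtain ⟨s, hs, -, hj⟩ := TotallyPositive.exists_alternating α hα (d := e)
        (by split_ifs at heq <;> omega)
      have hs' := TotallyPositive.strictMono_snoc hs
      set D : Fin (e + 2) → ℝ := fun j => (M.submatrix
        ((Fin.snoc (fun j => (s j).castSucc) (Fin.last (p + 1)) : Fin (e + 2) → Fin (p + 2)) ∘
          j.succAbove) id).det with hD
      have hDpos : ∀ j, 0 < D j := fun j => hM _ (hs'.comp (Fin.strictMono_succAbove j))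
      have hrel : ∀ v ∈ V, D (Fin.last _) * ξ v =
          -∑ j : Fin (e + 1), D j.castSucc * (α (s j) * v (s j)) := fun v hv => by
        obtain ⟨c, hc⟩ := hVM v hv
        have h0 := TotallyPositive.circuitForm_mulVec M
          (Fin.snoc (fun j => (s j).castSucc) (Fin.last (p + 1))) c
        rw [TotallyPositive.circuitForm_apply, Fin.sum_univ_castSucc, hc] at h0
        simp only [Fin.snoc_last, Fin.snoc_castSucc, Fin.val_last, Fin.val_castSucc] at h0
        have h1 : ((-1 : ℝ) ^ (e + 1)) * (-1) ^ (e + 1) = 1 := by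
          rw [← mul_pow, neg_one_mul, neg_neg, one_pow]
        simp only [hj, hα0, mul_one]
        rw [eq_neg_iff_add_eq_zero, add_comm, ← h0]
        congr 1
        · exact Finset.sum_congr rfl fun j _ => by simp only [hD]; ring
        · simp only [hD]
          linear_combination -(D (Fin.last _) * ξ v) * h1
      refine ⟨(∑ j : Fin (e + 1), D j.castSucc * (α (s j) * w (s j))) / D (Fin.last _), ?_⟩
      rintro _ ⟨x, hx, rfl⟩
      simp only
      rw [← hxihat, le_div_iff₀ (hDpos _), mul_comm, hrel _ ((hVA _).mpr ⟨x, rfl⟩),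
        ← Finset.sum_neg_distrib]
      refine Finset.sum_le_sum fun j _ => ?_
      have := mul_nonneg (hDpos j.castSucc).le (hx (s j))
      linarith
end

section
/- Let z_1 < z_2 < ⋯ < z_n be real numbers, let 1 ≤ k ≤ n, and let α ∈ {+1,−1}^n satisfy var_l(α) = k. With the convention α_0 := +1, let i_1 < i_2 < ⋯ < i_k be the elements of the set {i ∈ {0,1,…,n−1} : α_i ≠ α_{i+1}}. Then for a real polynomial f of degree k with leading coefficient (−1)^k, the following are equivalent: (a) α_i · f(z_i) > 0 for all 1 ≤ i ≤ n; (b) there exist real numbers r_1 < r_2 < ⋯ < r_k with f(z) = (r_1 − z)(r_2 − z)⋯(r_k − z) and such that for each j one has z_{i_j} < r_j < z_{i_j + 1}, where in the case i_1 = 0 the condition on r_1 is just r_1 < z_1. -/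
open scoped BigOperators
open Polynomial

/-- The `j`-th element (in increasing order) of a `k`-element finite set of indices. -/
def enumDots {n k : ℕ} (D : Finset (Fin n)) (h : D.card = k) (j : Fin k) : Fin n :=
  (D.orderIsoOfFin h j).1

/-- A sign sequence starting at `1` is determined by the set of positions where it changes. -/
lemma sign_eq_prod_changes {n : ℕ} (c : Fin (n + 1) → ℝ) (h0 : c 0 = 1)
    (hc : ∀ i, c i = 1 ∨ c i = -1) (m : Fin (n + 1)) :
    c m = ∏ d ∈ Finset.univ.filter (fun i : Fin n => c i.castSucc ≠ c i.succ),
      if d.castSucc < m then (-1 : ℝ) else 1 := by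
  induction m using Fin.induction with
  | zero => simp [h0]
  | succ i ih =>
    have hstep : ∀ d : Fin n, (if d.castSucc < i.succ then (-1 : ℝ) else 1) =
        (if d.castSucc < i.castSucc then -1 else 1) * (if d = i then -1 else 1) := by
      intro d
      rcases lt_trichotomy d i with h | h | h
      · simp [h, h.ne, Fin.lt_def, Nat.lt_succ_of_lt (Fin.lt_def.1 h)]
      · simp [h]
      · have h1 := Fin.lt_def.1 h
        simp [h.ne', Fin.lt_def, not_lt_of_gt h1, show ¬ (d : ℕ) < i + 1 by omega]
    rw [Finset.prod_congr rfl fun d _ => hstep d, Finset.prod_mul_distrib, ← ih,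
      Finset.prod_ite_eq']
    simp only [Finset.mem_filter, Finset.mem_univ, true_and]
    rcases hc i.castSucc with h1 | h1 <;> rcases hc i.succ with h2 | h2 <;>
      rw [h1, h2] <;> norm_num

lemma prod_enumDots {n k : ℕ} (D : Finset (Fin n)) (h : D.card = k) (g : Fin n → ℝ) :
    ∏ j : Fin k, g (enumDots D h j) = ∏ d ∈ D, g d := by
  rw [← Finset.prod_coe_sort D g]
  exact Fintype.prod_equiv (D.orderIsoOfFin h).toEquiv _ _ fun _ => rfl

lemma enumDots_mem {n k : ℕ} (D : Finset (Fin n)) (h : D.card = k) (j : Fin k) :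
    enumDots D h j ∈ D :=
  (D.orderIsoOfFin h j).2

lemma enumDots_strictMono {n k : ℕ} (D : Finset (Fin n)) (h : D.card = k) :
    StrictMono (enumDots D h) :=
  fun _ _ hab => (D.orderIsoOfFin h).strictMono hab

/-- A polynomial of positive degree `k` with leading coefficient `(-1) ^ k` is positive
arbitrarily far to the left. -/
lemma exists_lt_eval_pos {k : ℕ} (hk : 1 ≤ k) (f : Polynomial ℝ) (hdeg : f.natDegree = k)
    (hlead : f.leadingCoeff = (-1) ^ k) (a : ℝ) : ∃ x < a, 0 < f.eval x := by
  have hX : (-X : Polynomial ℝ).natDegree = 1 := by simp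
  have hnat : (f.comp (-X)).natDegree = k := by rw [natDegree_comp, hX, hdeg, mul_one]
  have hlc : (f.comp (-X)).leadingCoeff = 1 := by
    rw [leadingCoeff_comp (by rw [hX]; exact one_ne_zero), hdeg, hlead, leadingCoeff_neg,
      leadingCoeff_X, ← mul_pow]
    norm_num
  have ht := (f.comp (-X)).tendsto_atTop_of_leadingCoeff_nonneg
    (natDegree_pos_iff_degree_pos.1 (by omega)) (by rw [hlc]; exact zero_le_one)
  obtain ⟨y, hy, hya⟩ := ((ht.eventually_gt_atTop 0).and
    (Filter.eventually_gt_atTop (-a))).exists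
  exact ⟨-y, by linarith, by simpa [eval_comp] using hy⟩

/-- A polynomial of degree `k` with leading coefficient `(-1) ^ k` and `k` distinct roots `r j`
is the product of the factors `r j - X`. -/
lemma eq_prod_C_sub_X {k : ℕ} (f : Polynomial ℝ) (hdeg : f.natDegree = k)
    (hlead : f.leadingCoeff = (-1) ^ k) (r : Fin k → ℝ) (hr : Function.Injective r)
    (hroot : ∀ j, f.eval (r j) = 0) : f = ∏ j : Fin k, (C (r j) - X) := by
  have hf : f ≠ 0 := by
    rw [← leadingCoeff_ne_zero, hlead]
    exact pow_ne_zero _ (by norm_num)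
  have hneg : ∀ j, (C (r j) - X : Polynomial ℝ) = -(X - C (r j)) := fun j => (neg_sub _ _).symm
  have hgd : (∏ j : Fin k, (C (r j) - X) : Polynomial ℝ).degree = (k : WithBot ℕ) := by
    simp [degree_prod, hneg, degree_neg, degree_X_sub_C, -neg_sub]
  have hgl : (∏ j : Fin k, (C (r j) - X) : Polynomial ℝ).leadingCoeff = (-1) ^ k := by
    simp [leadingCoeff_prod, hneg, leadingCoeff_neg, -neg_sub]
  have hfd : f.degree = k := by rw [degree_eq_natDegree hf, hdeg]
  refine eq_of_degree_le_of_eval_index_eq (Finset.univ : Finset (Fin k)) (v := r)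
    hr.injOn (by simp [hfd]) (hfd.trans hgd.symm) (hlead.trans hgl.symm) fun j _ => ?_
  rw [hroot, eval_prod, Finset.prod_eq_zero (Finset.mem_univ j) (by simp)]

/-- A real polynomial with values of opposite sign at two points vanishes in between. -/
lemma exists_root_of_mul_neg (f : Polynomial ℝ) {a b : ℝ} (hab : a < b)
    (h : f.eval a * f.eval b < 0) : ∃ x, a < x ∧ x < b ∧ f.eval x = 0 := by
  have hcont : ContinuousOn (fun x => f.eval x) (Set.Icc a b) := f.continuous.continuousOn
  rcases mul_neg_iff.1 h with ⟨h1, h2⟩ | ⟨h1, h2⟩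
  · obtain ⟨x, hx, hx0⟩ := intermediate_value_Ioo' hab.le hcont ⟨h2, h1⟩
    exact ⟨x, hx.1, hx.2, hx0⟩
  · obtain ⟨x, hx, hx0⟩ := intermediate_value_Ioo hab.le hcont ⟨h1, h2⟩
    exact ⟨x, hx.1, hx.2, hx0⟩

/-- Proposition 3.15, left cyclic case: let `z_1 < ⋯ < z_n`, let
`α ∈ {+1,−1}^n` with `var_l(α) = k`, and let `i_1 < ⋯ < i_k` enumerate the positions
`i ∈ {0,…,n−1}` at which the extended sequence `(+1, α_1, …, α_n)` changes sign. Then for a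
real polynomial `f` of degree `k` with leading coefficient `(−1)^k`, one has
`α_i · f(z_i) > 0` for all `i` if and only if `f(z) = (r_1 − z)⋯(r_k − z)` for real numbers
`r_1 < ⋯ < r_k` with `z_{i_j} < r_j < z_{i_j+1}` for all `j` (no lower bound when `i_j = 0`).
(Here `z` is indexed by `Fin n`, with `z ⟨m⟩` standing for `z_{m+1}`.) -/
theorem leftCyclic_region_iff_symmetric_product_lagrangian
    (n k : ℕ) (hk1 : 1 ≤ k) (hkn : k ≤ n)
    (z : Fin n → ℝ) (hz : StrictMono z)
    (α : Fin n → ℝ) (hα : ∀ i, α i = 1 ∨ α i = -1)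
    (D : Finset (Fin n))
    (hD : D = Finset.univ.filter fun i : Fin n =>
      (Fin.cons 1 α : Fin (n + 1) → ℝ) i.castSucc ≠ (Fin.cons 1 α : Fin (n + 1) → ℝ) i.succ)
    (hcard : D.card = k)
    (f : Polynomial ℝ) (hdeg : f.natDegree = k) (hlead : f.leadingCoeff = (-1) ^ k) :
    (∀ i : Fin n, 0 < α i * f.eval (z i)) ↔
      ∃ r : Fin k → ℝ, StrictMono r ∧
        f = ∏ j : Fin k, (C (r j) - X) ∧
        ∀ j : Fin k,
          r j < z (enumDots D hcard j) ∧
          ((enumDots D hcard j : ℕ) ≠ 0 →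
            z ⟨(enumDots D hcard j : ℕ) - 1,
                Nat.lt_of_le_of_lt (Nat.sub_le _ _) (enumDots D hcard j).isLt⟩ < r j) := by
  have hsign : ∀ i, (Fin.cons 1 α : Fin (n + 1) → ℝ) i = 1 ∨
      (Fin.cons 1 α : Fin (n + 1) → ℝ) i = -1 :=
    Fin.cases (Or.inl rfl) fun i => hα i
  have hprod : ∀ i, α i = ∏ j : Fin k, if enumDots D hcard j ≤ i then (-1 : ℝ) else 1 := by
    intro i
    rw [prod_enumDots D hcard fun d => if d ≤ i then (-1 : ℝ) else 1, hD]
    have h := sign_eq_prod_changes (Fin.cons 1 α) (Fin.cons_zero _ _) hsign i.succ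
    simpa only [Fin.cons_succ, Fin.castSucc_lt_succ_iff] using h
  constructor
  · intro ha
    have hex : ∀ d ∈ D, ∃ x, f.eval x = 0 ∧ x < z d ∧ ((d : ℕ) ≠ 0 →
        z ⟨(d : ℕ) - 1, Nat.lt_of_le_of_lt (Nat.sub_le _ _) d.isLt⟩ < x) := by
      intro d hd
      rw [hD, Finset.mem_filter, Fin.cons_succ] at hd
      have hne := hd.2
      by_cases h0 : (d : ℕ) = 0
      · have hd0 : d.castSucc = 0 := Fin.ext h0
        rw [hd0, Fin.cons_zero] at hne
        have hneg := ha d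
        rw [(hα d).resolve_left hne.symm] at hneg
        obtain ⟨a, haz, hfa⟩ := exists_lt_eval_pos hk1 f hdeg hlead (z d)
        obtain ⟨x, -, hx, hx0⟩ := exists_root_of_mul_neg f haz
          (mul_neg_of_pos_of_neg hfa (by linarith))
        exact ⟨x, hx0, hx, fun h => absurd h0 h⟩
      · let e : Fin n := ⟨(d : ℕ) - 1, Nat.lt_of_le_of_lt (Nat.sub_le _ _) d.isLt⟩
        have hed : d.castSucc = e.succ := Fin.ext (by simp [e]; omega)
        rw [hed, Fin.cons_succ] at hne
        have he := ha e
        have hd' := ha d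
        have hmul : f.eval (z e) * f.eval (z d) < 0 := by
          rcases hα e with h1 | h1 <;> rcases hα d with h2 | h2 <;> rw [h1] at he hne <;>
            rw [h2] at hd' hne
          · exact absurd rfl hne
          · exact mul_neg_of_pos_of_neg (by linarith) (by linarith)
          · exact mul_neg_of_neg_of_pos (by linarith) (by linarith)
          · exact absurd rfl hne
        obtain ⟨x, hx1, hx2, hx0⟩ := exists_root_of_mul_neg f
          (hz (Fin.lt_def.2 (by simp only [e]; omega))) hmul
        exact ⟨x, hx0, hx2, fun _ => hx1⟩
    choose r hr0 hr1 hr2 using fun j => hex _ (enumDots_mem D hcard j)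
    have hmono : StrictMono r := by
      intro a b hab
      have hlt := Fin.lt_def.1 (enumDots_strictMono D hcard hab)
      refine (hr1 a).trans (lt_of_le_of_lt (hz.monotone (Fin.le_def.2 ?_)) (hr2 b (by omega)))
      exact Nat.le_sub_one_of_lt hlt
    exact ⟨r, hmono, eq_prod_C_sub_X f hdeg hlead r hmono.injective hr0,
      fun j => ⟨hr1 j, hr2 j⟩⟩
  · rintro ⟨r, -, rfl, hr⟩ i
    rw [hprod i, eval_prod, ← Finset.prod_mul_distrib]
    refine Finset.prod_pos fun j _ => ?_
    simp only [eval_sub, eval_C, eval_X]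
    split_ifs with h
    · have := (hr j).1.trans_le (hz.monotone h)
      linarith
    · have hlt := Fin.lt_def.1 (not_le.1 h)
      have := (hz.monotone (Fin.le_def.2 (Nat.le_sub_one_of_lt hlt))).trans_lt
        ((hr j).2 (by omega))
      linarith
end

section
/- Let 1 ≤ k ≤ n−1, let V ⊆ ℝ^n be a k-dimensional linear subspace, let w ∈ ℝ^n ∖ V represent η ∈ ℝ^n/V, let x ∈ ℝ^n ∖ V^⊥, and let ξ be the linear functional v ↦ ⟨x,v⟩ on V. Let alt : ℝ^n → ℝ^n be the linear isomorphism multiplying the i-th coordinate by (−1)^{i−1} (so it negates all even-index coordinates). Then the polarized arrangement (V,η,ξ) is right cyclic if and only if the polarized arrangement (alt(V^⊥), η̆, ξ̆) of n hyperplanes in (n−k)-space is left cyclic, where V^⊥ is the orthogonal complement of V in ℝ^n, η̆ ∈ ℝ^n/alt(V^⊥) is the class represented by −alt(x), and ξ̆ is the linear functional v ↦ ⟨alt(w), v⟩ on alt(V^⊥). (The triple (alt(V^⊥), η̆, ξ̆) is the polarization reversal of the alt Gale dual of (V,η,ξ).) -/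
open scoped BigOperators

open Matrix

/-- An unordered form of the Cauchy–Binet formula: summing over all row selections counts every
minor once for each ordering of its rows. -/
theorem sum_det_submatrix_mul_det_submatrix {ι κ R : Type*} [Fintype ι] [DecidableEq ι]
    [Fintype κ] [DecidableEq κ] [CommRing R] (A B : Matrix κ ι R) :
    ∑ f : ι → κ, (A.submatrix f id).det * (B.submatrix f id).det =
      (Fintype.card ι).factorial * (Aᵀ * B).det := by
  have expand : (Aᵀ * B).det = ∑ f : ι → κ, (∏ i, A (f i) i) * (B.submatrix f id).det := by
    have hrows : Aᵀ * B = fun i => ∑ j, A j i • B j := by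
      ext i l
      simp [Matrix.mul_apply]
    rw [hrows]
    refine ((detRowAlternating : (ι → R) [⋀^ι]→ₗ[R] R).toMultilinearMap.map_sum _).trans ?_
    refine Finset.sum_congr rfl fun f _ => ?_
    exact MultilinearMap.map_smul_univ _ (fun i => A (f i) i) (fun i => B (f i))
  have perm (σ : Equiv.Perm ι) :
      ∑ f : ι → κ, (Equiv.Perm.sign σ : R) * (∏ i, A (f (σ i)) i) * (B.submatrix f id).det =
        (Aᵀ * B).det := by
    rw [expand]
    refine Fintype.sum_equiv (Equiv.arrowCongr σ.symm (Equiv.refl κ)) _ _ fun f => ?_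
    have : (B.submatrix (fun i => f (σ i)) id).det =
        Equiv.Perm.sign σ * (B.submatrix f id).det := by
      rw [← det_permute]
      rfl
    change _ = (∏ i, A (f (σ i)) i) * (B.submatrix (fun i => f (σ i)) id).det
    rw [this]
    ring
  calc
    _ = ∑ f : ι → κ, ∑ σ : Equiv.Perm ι,
        (Equiv.Perm.sign σ : R) * (∏ i, A (f (σ i)) i) * (B.submatrix f id).det := by
      refine Finset.sum_congr rfl fun f _ => ?_
      rw [det_apply', Finset.sum_mul]
      rfl
    _ = _ := by
      rw [Finset.sum_comm]
      simp [perm, Fintype.card_perm]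

/-- If all maximal minors of `A` are positive and those of `B` are nonnegative, at least one of
them positive, then `det (Aᵀ * B)` is positive. -/
theorem det_transpose_mul_pos {d m : ℕ} (A B : Matrix (Fin m) (Fin d) ℝ)
    (hA : ∀ s : Fin d → Fin m, StrictMono s → 0 < (A.submatrix s id).det)
    (hB : ∀ s : Fin d → Fin m, StrictMono s → 0 ≤ (B.submatrix s id).det)
    (hB' : ∃ s : Fin d → Fin m, StrictMono s ∧ 0 < (B.submatrix s id).det) :
    0 < (Aᵀ * B).det := by
  have hnonneg (f : Fin d → Fin m) : 0 ≤ (A.submatrix f id).det * (B.submatrix f id).det := by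
    by_cases hf : Function.Injective f
    · have hs : StrictMono (f ∘ Tuple.sort f) :=
        (Tuple.monotone_sort f).strictMono_of_injective (hf.comp (Tuple.sort f).injective)
      have key (C : Matrix (Fin m) (Fin d) ℝ) : (C.submatrix (f ∘ Tuple.sort f) id).det =
          Equiv.Perm.sign (Tuple.sort f) * (C.submatrix f id).det := by
        rw [← det_permute]
        rfl
      have := mul_nonneg (hA _ hs).le (hB _ hs)
      rw [key, key] at this
      rcases Int.units_eq_one_or (Equiv.Perm.sign (Tuple.sort f)) with h | h <;>
        simpa [h] using this
    · obtain ⟨i, j, hij, hne⟩ := Function.not_injective_iff.mp hf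
      rw [det_zero_of_row_eq (M := A.submatrix f id) hne (by ext; simp [hij]), zero_mul]
  obtain ⟨s, hs, hs'⟩ := hB'
  have : 0 < (Fintype.card (Fin d)).factorial * (Aᵀ * B).det := by
    rw [← sum_det_submatrix_mul_det_submatrix]
    exact Finset.sum_pos' (fun f _ => hnonneg f) ⟨s, Finset.mem_univ _, mul_pos (hA s hs) hs'⟩
  exact pos_of_mul_pos_right this (by positivity)

/-- Jacobi's complementary minor identity for matrices with orthogonal column spaces. -/
theorem det_mul_det_complementary {ι κ l R : Type*} [Fintype ι] [DecidableEq ι] [Fintype κ]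
    [DecidableEq κ] [Fintype l] [DecidableEq l] [CommRing R]
    (M : Matrix l ι R) (K : Matrix l κ R) (h : Mᵀ * K = 0) (e σ : ι ⊕ κ ≃ l) :
    (Mᵀ * M).det * (K.submatrix (σ ∘ Sum.inr) id).det =
      Equiv.Perm.sign (σ.trans e.symm) * ((fromCols M K).submatrix e id).det *
        (M.submatrix (σ ∘ Sum.inl) id).det := by
  have hperm : ((fromCols M K).submatrix σ id).det =
      Equiv.Perm.sign (σ.trans e.symm) * ((fromCols M K).submatrix e id).det := by
    rw [← det_permute]
    congr 1
    ext i j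
    simp
  let E : Matrix l κ R := (1 : Matrix l l R).submatrix id (σ ∘ Sum.inr)
  have hK : Kᵀ * M = 0 := by simpa using congrArg transpose h
  have hprod : ((fromCols M K).submatrix σ id)ᵀ * (fromCols M E).submatrix σ id =
      fromBlocks (Mᵀ * M) (Mᵀ * E) 0 (K.submatrix (σ ∘ Sum.inr) id)ᵀ := by
    rw [transpose_submatrix, submatrix_mul_equiv, transpose_fromCols, fromRows_mul_fromCols, hK,
      submatrix_id_id]
    congr 1
    ext i j
    simp [E, Matrix.mul_apply, Matrix.one_apply]
  have hE : (fromCols M E).submatrix σ id =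
      fromBlocks (M.submatrix (σ ∘ Sum.inl) id) 0 (M.submatrix (σ ∘ Sum.inr) id) 1 := by
    ext (i | i) (j | j) <;> simp [E, Matrix.one_apply]
  have := congrArg det hprod
  rw [det_mul, det_transpose, hperm, hE, det_fromBlocks_zero₁₂, det_fromBlocks_zero₂₁,
    det_transpose, det_one, mul_one] at this
  exact this.symm

theorem det_fromCols_sq {ι κ l R : Type*} [Fintype ι] [DecidableEq ι] [Fintype κ]
    [DecidableEq κ] [Fintype l] [DecidableEq l] [CommRing R]
    (M : Matrix l ι R) (K : Matrix l κ R) (h : Mᵀ * K = 0) (e : ι ⊕ κ ≃ l) :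
    ((fromCols M K).submatrix e id).det ^ 2 = (Mᵀ * M).det * (Kᵀ * K).det := by
  have hK : Kᵀ * M = 0 := by simpa using congrArg transpose h
  have hprod : ((fromCols M K).submatrix e id)ᵀ * (fromCols M K).submatrix e id =
      fromBlocks (Mᵀ * M) 0 0 (Kᵀ * K) := by
    rw [transpose_submatrix, submatrix_mul_equiv, transpose_fromCols, fromRows_mul_fromCols, hK, h,
      submatrix_id_id]
  rw [← det_fromBlocks_zero₂₁ (Mᵀ * M) 0 (Kᵀ * K), ← hprod, det_mul, det_transpose, sq]

theorem det_transpose_mul_self_ne_zero {ι l : Type*} [Fintype ι] [DecidableEq ι] [Fintype l]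
    {M : Matrix l ι ℝ} (hM : Function.Injective M.mulVec) : (Mᵀ * M).det ≠ 0 := by
  intro h
  obtain ⟨v, hv, hv'⟩ := exists_mulVec_eq_zero_iff.mpr h
  have : v ∈ LinearMap.ker M.mulVecLin := by
    rw [← ker_mulVecLin_transpose_mul_self]
    exact hv'
  exact hv (hM (by simpa using this))

theorem injective_mulVec_of_det_submatrix_ne_zero {ι l : Type*} [Fintype ι] [DecidableEq ι]
    {M : Matrix l ι ℝ} (s : ι → l) (hs : (M.submatrix s id).det ≠ 0) :
    Function.Injective M.mulVec := by
  intro v w hvw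
  have : Function.Injective (M.submatrix s id).mulVec :=
    mulVec_injective_iff_isUnit.mpr ((isUnit_iff_isUnit_det _).mpr (isUnit_iff_ne_zero.mpr hs))
  refine this (funext fun i => ?_)
  simpa [mulVec, dotProduct] using congrFun hvw (s i)

theorem sum_neg_one_pow_mul_choose_mul_pow_eq_zero {N j : ℕ} (hj : j < N) :
    ∑ i : Fin (N + 1), (-1 : ℝ) ^ (i : ℕ) * (N.choose i * (i : ℝ) ^ j) = 0 := by
  have h := congrFun (fwdDiff_iter_pow_eq_zero_of_lt (R := ℝ) hj) 0
  rw [fwdDiff_iter_eq_sum_shift] at h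
  rw [Fin.sum_univ_eq_sum_range (fun i => (-1 : ℝ) ^ i * (N.choose i * (i : ℝ) ^ j))]
  have h' := congrArg (fun z => (-1 : ℝ) ^ N * z) h
  simp only [Pi.zero_apply, mul_zero, Finset.mul_sum] at h'
  rw [← h']
  refine Finset.sum_congr rfl fun i hi => ?_
  have hi : i ≤ N := by simpa [Nat.lt_succ_iff] using hi
  have hsign : (-1 : ℝ) ^ N * (-1) ^ (N - i) = (-1) ^ i := by
    obtain ⟨c, rfl⟩ := Nat.exists_eq_add_of_le hi
    rw [Nat.add_sub_cancel_left, pow_add, mul_assoc, ← mul_pow]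
    simp
  simp [← hsign, mul_assoc]

theorem det_vandermonde_pos {d : ℕ} {v : Fin d → ℝ} (hv : StrictMono v) :
    0 < (vandermonde v).det := by
  rw [det_vandermonde]
  exact Finset.prod_pos fun i _ => Finset.prod_pos fun j hj =>
    sub_pos.mpr (hv (Finset.mem_Ioi.mp hj))

theorem det_alternating_rows {d m : ℕ} (K : Matrix (Fin m) (Fin d) ℝ) (t : Fin d → Fin m) :
    ((of fun (i : Fin m) j => (-1 : ℝ) ^ (i : ℕ) * K i j).submatrix t id).det =
      (∏ b, (-1 : ℝ) ^ (t b : ℕ)) * (K.submatrix t id).det :=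
  det_mul_column (fun b => (-1 : ℝ) ^ (t b : ℕ)) (K.submatrix t id)

/-- Up to a sign depending only on the sizes, a shuffle has the sign `(-1) ^ ∑ t`, where `t` is
its second block; the sign is read off from a Vandermonde matrix and its finite-difference dual. -/
theorem exists_shuffle_sign {d e m : ℕ} (hd : 0 < d) (he : 0 < e)
    (e₀ : Fin d ⊕ Fin e ≃ Fin m) :
    ∃ τ : ℝ, τ ≠ 0 ∧ ∀ σ : Fin d ⊕ Fin e ≃ Fin m, StrictMono (σ ∘ Sum.inl) →
      StrictMono (σ ∘ Sum.inr) →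
      (Equiv.Perm.sign (σ.trans e₀.symm) : ℝ) * ∏ b, (-1 : ℝ) ^ (σ (Sum.inr b) : ℕ) = τ := by
  obtain ⟨N, rfl⟩ : ∃ N, m = N + 1 := Nat.exists_eq_succ_of_ne_zero (by
    have := Fintype.card_congr e₀
    simp at this
    omega)
  have hcard : d + e = N + 1 := by simpa using Fintype.card_congr e₀
  let M : Matrix (Fin (N + 1)) (Fin d) ℝ := of fun i a => (i : ℝ) ^ (a : ℕ)
  let L : Matrix (Fin (N + 1)) (Fin e) ℝ := of fun i b => N.choose i * (i : ℝ) ^ (b : ℕ)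
  let K : Matrix (Fin (N + 1)) (Fin e) ℝ := of fun i b => (-1 : ℝ) ^ (i : ℕ) * L i b
  have hMK : Mᵀ * K = 0 := by
    ext a b
    rw [Matrix.mul_apply, Matrix.zero_apply,
      ← sum_neg_one_pow_mul_choose_mul_pow_eq_zero (N := N) (j := a + b) (by omega)]
    refine Finset.sum_congr rfl fun i _ => ?_
    simp only [M, K, L, transpose_apply, of_apply]
    ring
  have hmono {p : ℕ} {s : Fin p → Fin (N + 1)} (hs : StrictMono s) :
      StrictMono fun a => ((s a : ℕ) : ℝ) := fun a b hab =>
    Nat.cast_lt.mpr (Fin.lt_def.mp (hs hab))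
  have hM {s : Fin d → Fin (N + 1)} (hs : StrictMono s) : 0 < (M.submatrix s id).det :=
    det_vandermonde_pos (hmono hs)
  have hL {t : Fin e → Fin (N + 1)} (ht : StrictMono t) : 0 < (L.submatrix t id).det := by
    have : (L.submatrix t id).det =
        (∏ b, (N.choose (t b) : ℝ)) * (vandermonde fun a => ((t a : ℕ) : ℝ)).det :=
      det_mul_column (fun b => (N.choose (t b) : ℝ)) _
    rw [this]
    refine mul_pos (Finset.prod_pos fun b _ => ?_) (det_vandermonde_pos (hmono ht))
    exact_mod_cast Nat.choose_pos (Nat.lt_succ_iff.mp (t b).isLt)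
  have hP : (Mᵀ * M).det ≠ 0 := det_transpose_mul_self_ne_zero
    (injective_mulVec_of_det_submatrix_ne_zero (Fin.castLE (by omega))
      (hM (Fin.strictMono_castLE _)).ne')
  set P := (Mᵀ * M).det
  set c := ((fromCols M K).submatrix e₀ id).det with hc
  refine ⟨if 0 < c * P then 1 else -1, by split_ifs <;> norm_num, fun σ hs ht => ?_⟩
  have key := det_mul_det_complementary M K hMK e₀ σ
  rw [det_alternating_rows, ← hc] at key
  set p := ∏ b, (-1 : ℝ) ^ (σ (Sum.inr b) : ℕ) with hp
  set u : ℝ := (Equiv.Perm.sign (σ.trans e₀.symm) : ℝ) with hu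
  have hp1 : p = 1 ∨ p = -1 := by
    rw [hp, Finset.prod_pow_eq_pow_sum]
    exact neg_one_pow_eq_or ℝ _
  have hu1 : u = 1 ∨ u = -1 := by
    rcases Int.units_eq_one_or (Equiv.Perm.sign (σ.trans e₀.symm)) with h | h <;> simp [hu, h]
  have hup : u * p = 1 ∨ u * p = -1 := by
    rcases hp1 with h | h <;> rcases hu1 with h' | h' <;> simp [h, h']
  have hp2 : p ^ 2 = 1 := by rcases hp1 with h | h <;> simp [h]
  change P * (p * (L.submatrix (σ ∘ Sum.inr) id).det) =
    u * c * (M.submatrix (σ ∘ Sum.inl) id).det at key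
  have hpos : 0 < u * p * (c * P) * (M.submatrix (σ ∘ Sum.inl) id).det := by
    have : u * p * (c * P) * (M.submatrix (σ ∘ Sum.inl) id).det =
        P ^ 2 * (L.submatrix (σ ∘ Sum.inr) id).det := by
      linear_combination -p * P * key + P ^ 2 * (L.submatrix (σ ∘ Sum.inr) id).det * hp2
    rw [this]
    exact mul_pos (by positivity) (hL ht)
  have hpos' := pos_of_mul_pos_left hpos (hM hs).le
  rcases hup with h | h <;> rw [h] at hpos' ⊢
  · rw [if_pos (by linarith)]
  · rw [if_neg (by linarith)]

/-- Complementary maximal minors of two matrices whose column spaces are orthogonal for the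
alternating form are proportional. -/
theorem exists_complementary_minors_eq {d e m : ℕ} (hd : 0 < d) (he : 0 < e) (hm : d + e = m)
    {M : Matrix (Fin m) (Fin d) ℝ} {K : Matrix (Fin m) (Fin e) ℝ}
    (hM : Function.Injective M.mulVec) (hK : Function.Injective K.mulVec)
    (h : ∀ a b, ∑ i : Fin m, (-1 : ℝ) ^ (i : ℕ) * (K i b * M i a) = 0) :
    ∃ δ : ℝ, δ ≠ 0 ∧ ∀ σ : Fin d ⊕ Fin e ≃ Fin m, StrictMono (σ ∘ Sum.inl) →
      StrictMono (σ ∘ Sum.inr) →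
      (K.submatrix (σ ∘ Sum.inr) id).det = δ * (M.submatrix (σ ∘ Sum.inl) id).det := by
  let e₀ : Fin d ⊕ Fin e ≃ Fin m := finSumFinEquiv.trans (finCongr hm)
  obtain ⟨τ, hτ, hσ⟩ := exists_shuffle_sign hd he e₀
  let L : Matrix (Fin m) (Fin e) ℝ := of fun i b => (-1 : ℝ) ^ (i : ℕ) * K i b
  have hML : Mᵀ * L = 0 := by
    ext a b
    rw [Matrix.mul_apply, Matrix.zero_apply, ← h a b]
    refine Finset.sum_congr rfl fun i _ => ?_
    simp only [L, transpose_apply, of_apply]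
    ring
  have hL : Function.Injective L.mulVec := fun v w hvw => hK (funext fun i => by
    have : (-1 : ℝ) ^ (i : ℕ) * (K *ᵥ v) i = (-1 : ℝ) ^ (i : ℕ) * (K *ᵥ w) i := by
      simpa [L, mulVec, dotProduct, Finset.mul_sum, mul_assoc] using congrFun hvw i
    exact mul_left_cancel₀ (by simp) this)
  have hP := det_transpose_mul_self_ne_zero hM
  have hc : ((fromCols M L).submatrix e₀ id).det ≠ 0 := by
    rw [← pow_ne_zero_iff two_ne_zero, det_fromCols_sq M L hML]
    exact mul_ne_zero hP (det_transpose_mul_self_ne_zero hL)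
  refine ⟨τ * ((fromCols M L).submatrix e₀ id).det / (Mᵀ * M).det,
    div_ne_zero (mul_ne_zero hτ hc) hP, fun σ hs ht => ?_⟩
  have key := det_mul_det_complementary M L hML e₀ σ
  rw [det_alternating_rows] at key
  have hp2 : (∏ b, (-1 : ℝ) ^ ((σ ∘ Sum.inr) b : ℕ)) ^ 2 = 1 := by
    rw [← Finset.prod_pow]
    simp [← pow_mul, mul_comm _ 2]
  rw [← hσ σ hs ht, div_mul_eq_mul_div, eq_div_iff hP]
  simp only [Function.comp_apply] at hp2 key ⊢
  linear_combination (∏ b, (-1 : ℝ) ^ (σ (Sum.inr b) : ℕ)) * key -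
    (K.submatrix (σ ∘ Sum.inr) id).det * (Mᵀ * M).det * hp2

/-- All maximal minors are nonzero and share the same sign. -/
def HasUniformMinors {d m : ℕ} (M : Matrix (Fin m) (Fin d) ℝ) : Prop :=
  ∃ ε : ℝ, ∀ s : Fin d → Fin m, StrictMono s → 0 < ε * (M.submatrix s id).det

theorem mem_span_cols_iff {d m : ℕ} (M : Matrix (Fin m) (Fin d) ℝ) (y : Fin m → ℝ) :
    y ∈ Submodule.span ℝ (Set.range fun j i => M i j) ↔ ∃ c, M *ᵥ c = y := by
  change y ∈ Submodule.span ℝ (Set.range M.col) ↔ _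
  rw [← range_mulVecLin]
  rfl

theorem span_cols_eq {d m : ℕ} (M : Matrix (Fin m) (Fin d) ℝ) :
    (Submodule.span ℝ (Set.range fun j i => M i j) : Set (Fin m → ℝ)) =
      {y | ∃ c, M *ᵥ c = y} :=
  Set.ext (mem_span_cols_iff M)

theorem isTotallyPositive_iff_hasUniformMinors {d m : ℕ} (hd : 0 < d)
    (M : Matrix (Fin m) (Fin d) ℝ) :
    IsTotallyPositive d m {y | ∃ c, M *ᵥ c = y} ↔ HasUniformMinors M := by
  constructor
  · rintro ⟨N, hN, hpos⟩
    have hcol (j : Fin d) : ∃ c, M *ᵥ c = fun i => N i j := by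
      have : (fun i => N i j) ∈ {y | ∃ c, M *ᵥ c = y} := by
        rw [← hN]
        exact Submodule.subset_span ⟨j, rfl⟩
      exact this
    choose c hc using hcol
    have hNM : N = M * of fun a j => c j a := by
      ext i j
      exact (congrFun (hc j) i).symm
    refine ⟨(of fun a j => c j a : Matrix (Fin d) (Fin d) ℝ).det, fun s hs => ?_⟩
    have := hpos s hs
    rw [hNM, submatrix_mul M _ s id id Function.bijective_id, det_mul, submatrix_id_id] at this
    rwa [mul_comm]
  · rintro ⟨ε, hε⟩
    by_cases h0 : ε = 0
    · exact ⟨M, span_cols_eq M, fun s hs => by simpa [h0] using hε s hs⟩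
    let v : Fin d → ℝ := Function.update 1 ⟨0, hd⟩ ε
    have hv (j : Fin d) : v j ≠ 0 := by
      by_cases h : j = ⟨0, hd⟩
      · subst h
        simpa [v] using h0
      · simp [v, h]
    have hprod : ∏ j, v j = ε := by
      simp [v, Finset.prod_update_of_mem]
    refine ⟨of fun i j => v j * M i j, ?_, fun s hs => ?_⟩
    · rw [span_cols_eq]
      ext y
      constructor
      · rintro ⟨c, rfl⟩
        refine ⟨fun j => v j * c j, ?_⟩
        ext i
        simp only [mulVec, dotProduct, of_apply]
        exact Finset.sum_congr rfl fun j _ => by ring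
      · rintro ⟨c, rfl⟩
        refine ⟨fun j => (v j)⁻¹ * c j, ?_⟩
        ext i
        simp only [mulVec, dotProduct, of_apply]
        exact Finset.sum_congr rfl fun j _ => by field_simp [hv j]
    · have : ((of fun i j => v j * M i j).submatrix s id).det =
          (∏ j, v j) * (M.submatrix s id).det := det_mul_row v (M.submatrix s id)
      rw [this, hprod]
      exact hε s hs

theorem exists_complementary_strictMono {d e m : ℕ} (hm : d + e = m) {s : Fin d → Fin m}
    (hs : StrictMono s) :
    ∃ σ : Fin d ⊕ Fin e ≃ Fin m, σ ∘ Sum.inl = s ∧ StrictMono (σ ∘ Sum.inr) := by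
  have hcard : (Finset.univ.image s).card = d := by
    simp [Finset.card_image_of_injective _ hs.injective]
  have hcard' : (Finset.univ.image s)ᶜ.card = e := by
    rw [Finset.card_compl, hcard, Fintype.card_fin]
    omega
  refine ⟨finSumEquivOfFinset hcard hcard', ?_, ?_⟩
  · have hcomp : finSumEquivOfFinset hcard hcard' ∘ Sum.inl =
        (Finset.univ.image s).orderEmbOfFin hcard :=
      funext fun i => finSumEquivOfFinset_inl hcard hcard' i
    rw [hcomp]
    exact (Finset.orderEmbOfFin_unique hcard (by simp) hs).symm
  · have hcomp : finSumEquivOfFinset hcard hcard' ∘ Sum.inr =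
        (Finset.univ.image s)ᶜ.orderEmbOfFin hcard' :=
      funext fun i => finSumEquivOfFinset_inr hcard hcard' i
    rw [hcomp]
    exact OrderEmbedding.strictMono _

/-- Alternating duality of uniform minors. -/
theorem hasUniformMinors_iff_of_alternating_orthogonal {d e m : ℕ} (hd : 0 < d) (he : 0 < e)
    (hm : d + e = m) {M : Matrix (Fin m) (Fin d) ℝ} {K : Matrix (Fin m) (Fin e) ℝ}
    (hM : Function.Injective M.mulVec) (hK : Function.Injective K.mulVec)
    (h : ∀ a b, ∑ i : Fin m, (-1 : ℝ) ^ (i : ℕ) * (K i b * M i a) = 0) :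
    HasUniformMinors M ↔ HasUniformMinors K := by
  obtain ⟨δ, hδ, hmin⟩ := exists_complementary_minors_eq hd he hm hM hK h
  constructor
  · rintro ⟨ε, hε⟩
    refine ⟨ε / δ, fun t ht => ?_⟩
    obtain ⟨σ, rfl, hs⟩ := exists_complementary_strictMono (by omega : e + d = m) ht
    have := hmin ((Equiv.sumComm _ _).trans σ) hs ht
    have hpos := hε _ hs
    simp only [Equiv.coe_trans, Function.comp_assoc] at this
    change (K.submatrix (σ ∘ Sum.inl) id).det = δ * (M.submatrix (σ ∘ Sum.inr) id).det at this
    rw [this]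
    field_simp
    exact hpos
  · rintro ⟨ε, hε⟩
    refine ⟨ε * δ, fun s hs => ?_⟩
    obtain ⟨σ, rfl, ht⟩ := exists_complementary_strictMono hm hs
    rw [mul_assoc, ← hmin σ hs ht]
    exact hε _ ht

/-- Prepend the column `w` to `B`. -/
def consCol {n k : ℕ} (w : Fin n → ℝ) (B : Matrix (Fin n) (Fin k) ℝ) :
    Matrix (Fin n) (Fin (k + 1)) ℝ :=
  of fun i => Fin.cons (w i) (B i)

/-- Prepend the row `r` to `B`. -/
def consRow {n k : ℕ} (r : Fin k → ℝ) (B : Matrix (Fin n) (Fin k) ℝ) :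
    Matrix (Fin (n + 1)) (Fin k) ℝ :=
  of (Fin.cons (α := fun _ => Fin k → ℝ) r B)

/-- Append the row `r` to `B`. -/
def snocRow {n k : ℕ} (B : Matrix (Fin n) (Fin k) ℝ) (r : Fin k → ℝ) :
    Matrix (Fin (n + 1)) (Fin k) ℝ :=
  of (Fin.snoc (α := fun _ => Fin k → ℝ) B r)

/-- The matrix with block form `[1, 0; w, B]`. -/
def coneMatrix {n k : ℕ} (w : Fin n → ℝ) (B : Matrix (Fin n) (Fin k) ℝ) :
    Matrix (Fin (n + 1)) (Fin (k + 1)) ℝ :=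
  consRow (Pi.single 0 1) (consCol w B)

@[simp]
theorem consCol_zero {n k : ℕ} (w : Fin n → ℝ) (B : Matrix (Fin n) (Fin k) ℝ) (i : Fin n) :
    consCol w B i 0 = w i := rfl

@[simp]
theorem consCol_succ {n k : ℕ} (w : Fin n → ℝ) (B : Matrix (Fin n) (Fin k) ℝ) (i : Fin n)
    (j : Fin k) : consCol w B i j.succ = B i j := rfl

@[simp]
theorem consRow_zero {n k : ℕ} (r : Fin k → ℝ) (B : Matrix (Fin n) (Fin k) ℝ) :
    consRow r B 0 = r := rfl

@[simp]
theorem consRow_succ {n k : ℕ} (r : Fin k → ℝ) (B : Matrix (Fin n) (Fin k) ℝ) (i : Fin n) :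
    consRow r B i.succ = B i := rfl

@[simp]
theorem snocRow_last {n k : ℕ} (B : Matrix (Fin n) (Fin k) ℝ) (r : Fin k → ℝ) :
    snocRow B r (Fin.last n) = r := Fin.snoc_last (α := fun _ => Fin k → ℝ) _ _

@[simp]
theorem snocRow_castSucc {n k : ℕ} (B : Matrix (Fin n) (Fin k) ℝ) (r : Fin k → ℝ) (i : Fin n) :
    snocRow B r i.castSucc = B i := Fin.snoc_castSucc (α := fun _ => Fin k → ℝ) _ _ _

theorem consCol_mulVec {n k : ℕ} (w : Fin n → ℝ) (B : Matrix (Fin n) (Fin k) ℝ)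
    (c : Fin (k + 1) → ℝ) :
    consCol w B *ᵥ c = B *ᵥ Fin.tail c + c 0 • w := by
  ext i
  simp [mulVec, dotProduct, Fin.sum_univ_succ, Fin.tail]
  ring

theorem consRow_mulVec {n k : ℕ} (r : Fin k → ℝ) (B : Matrix (Fin n) (Fin k) ℝ)
    (c : Fin k → ℝ) : consRow r B *ᵥ c = Fin.cons (r ⬝ᵥ c) (B *ᵥ c) := by
  ext i
  refine Fin.cases ?_ (fun i => ?_) i <;> simp [mulVec]

theorem snocRow_mulVec {n k : ℕ} (r : Fin k → ℝ) (B : Matrix (Fin n) (Fin k) ℝ)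
    (c : Fin k → ℝ) :
    snocRow B r *ᵥ c = (Fin.snoc (B *ᵥ c) (r ⬝ᵥ c) : Fin (n + 1) → ℝ) := by
  ext i
  refine Fin.lastCases ?_ (fun i => ?_) i <;> simp [mulVec]

theorem injective_mulVec_consRow {n k : ℕ} (r : Fin k → ℝ) {B : Matrix (Fin n) (Fin k) ℝ}
    (hB : Function.Injective B.mulVec) : Function.Injective (consRow r B).mulVec := by
  intro v w h
  simp only [consRow_mulVec, Fin.cons_inj] at h
  exact hB h.2

theorem injective_mulVec_coneMatrix {n k : ℕ} (w : Fin n → ℝ) {B : Matrix (Fin n) (Fin k) ℝ}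
    (hB : Function.Injective B.mulVec) : Function.Injective (coneMatrix w B).mulVec := by
  intro c c' h
  simp only [coneMatrix, consRow_mulVec, consCol_mulVec, single_one_dotProduct,
    Fin.cons_inj] at h
  obtain ⟨h0, h1⟩ := h
  rw [h0, add_left_inj] at h1
  rw [← Fin.cons_self_tail c, ← Fin.cons_self_tail c', h0, hB h1]

theorem StrictMono.exists_eq_succ_comp {d m : ℕ} {s : Fin d → Fin (m + 1)} (hs : StrictMono s)
    (h : ∀ i, s i ≠ 0) : ∃ s' : Fin d → Fin m, StrictMono s' ∧ s = Fin.succ ∘ s' :=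
  ⟨fun i => (s i).pred (h i), fun i j hij => by simpa using hs hij, by ext; simp⟩

theorem StrictMono.exists_eq_cons_zero {d m : ℕ} {s : Fin (d + 1) → Fin (m + 1)}
    (hs : StrictMono s) (h : s 0 = 0) :
    ∃ s' : Fin d → Fin m, StrictMono s' ∧ s = Fin.cons 0 (Fin.succ ∘ s') := by
  obtain ⟨s', hs', he⟩ := (hs.comp Fin.strictMono_succ).exists_eq_succ_comp fun i => by
    simpa [h] using (hs (Fin.succ_pos i)).ne'
  refine ⟨s', hs', ?_⟩
  rw [← he]
  ext i
  refine Fin.cases ?_ (fun i => ?_) i <;> simp [h]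

theorem strictMono_cons_zero {d m : ℕ} {s : Fin d → Fin m} (hs : StrictMono s) :
    StrictMono (Fin.cons 0 (Fin.succ ∘ s) : Fin (d + 1) → Fin (m + 1)) := by
  intro i j
  refine Fin.cases ?_ (fun i => ?_) i <;> refine Fin.cases ?_ (fun j => ?_) j
  · simp
  · simp
  · simp
  · simpa using fun h => hs h

theorem hasUniformMinors_coneMatrix_iff {n k : ℕ} (w : Fin n → ℝ)
    (B : Matrix (Fin n) (Fin k) ℝ) :
    HasUniformMinors (coneMatrix w B) ↔ ∃ ε : ℝ,
      (∀ s : Fin k → Fin n, StrictMono s → 0 < ε * (B.submatrix s id).det) ∧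
      ∀ s : Fin (k + 1) → Fin n, StrictMono s → 0 < ε * ((consCol w B).submatrix s id).det := by
  have h0 (s : Fin k → Fin n) :
      ((coneMatrix w B).submatrix (Fin.cons 0 (Fin.succ ∘ s)) id).det =
        (B.submatrix s id).det := by
    rw [det_succ_row_zero, Fin.sum_univ_succ]
    simp [coneMatrix, submatrix_submatrix]
    rfl
  have h1 (s : Fin (k + 1) → Fin n) : (coneMatrix w B).submatrix (Fin.succ ∘ s) id =
      (consCol w B).submatrix s id := by
    ext i j
    simp [coneMatrix]
  refine exists_congr fun ε => ⟨fun h => ⟨fun s hs => ?_, fun s hs => ?_⟩, fun h s hs => ?_⟩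
  · simpa only [h0] using h _ (strictMono_cons_zero hs)
  · simpa only [h1] using h _ (Fin.strictMono_succ.comp hs)
  · by_cases hz : s 0 = 0
    · obtain ⟨s', hs', rfl⟩ := hs.exists_eq_cons_zero hz
      simpa only [h0] using h.1 s' hs'
    · obtain ⟨s', hs', rfl⟩ := hs.exists_eq_succ_comp fun i hi => hz
        (Fin.le_zero_iff.mp (hi ▸ hs.monotone (Fin.zero_le i)))
      simpa only [h1] using h.2 s' hs'

theorem det_consCol_smul {n k : ℕ} (a : ℝ) (w : Fin n → ℝ) (B : Matrix (Fin n) (Fin k) ℝ)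
    (s : Fin (k + 1) → Fin n) :
    ((consCol (a • w) B).submatrix s id).det = a * ((consCol w B).submatrix s id).det := by
  rw [det_succ_column_zero, det_succ_column_zero, Finset.mul_sum]
  refine Finset.sum_congr rfl fun i _ => ?_
  have : ((consCol (a • w) B).submatrix s id).submatrix i.succAbove Fin.succ =
      ((consCol w B).submatrix s id).submatrix i.succAbove Fin.succ := rfl
  rw [this]
  simp only [submatrix_apply, id, consCol_zero, Pi.smul_apply, smul_eq_mul]
  ring

theorem det_consCol_add_mulVec {n k : ℕ} (u : Fin n → ℝ) (B : Matrix (Fin n) (Fin k) ℝ)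
    (c : Fin k → ℝ) (s : Fin (k + 1) → Fin n) :
    ((consCol (u + B *ᵥ c) B).submatrix s id).det = ((consCol u B).submatrix s id).det := by
  have hmul : consCol (u + B *ᵥ c) B = consCol u B * coneMatrix c 1 := by
    ext i j
    refine Fin.cases ?_ (fun j => ?_) j <;>
      simp [Matrix.mul_apply, Fin.sum_univ_succ, coneMatrix, mulVec, dotProduct, one_apply]
  have hdet : (coneMatrix c (1 : Matrix (Fin k) (Fin k) ℝ)).det = 1 := by
    rw [det_succ_row_zero, Fin.sum_univ_succ]
    have : (coneMatrix c (1 : Matrix (Fin k) (Fin k) ℝ)).submatrix Fin.succ Fin.succ = 1 := by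
      ext i j
      simp [coneMatrix]
    simp [this]
    simp [coneMatrix]
  rw [hmul, submatrix_mul _ _ s id id Function.bijective_id, det_mul, submatrix_id_id, hdet,
    mul_one]

theorem det_transpose_mul_self_nonneg {ι κ : Type*} [Fintype ι] [DecidableEq ι] [Fintype κ]
    [DecidableEq κ] (B : Matrix κ ι ℝ) : 0 ≤ (Bᵀ * B).det := by
  have h := sum_det_submatrix_mul_det_submatrix B B
  refine nonneg_of_mul_nonneg_right (a := ((Fintype.card ι).factorial : ℝ)) ?_ (by positivity)
  rw [← h]
  exact Finset.sum_nonneg fun f _ => mul_self_nonneg _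

/-- If `u` is orthogonal to the columns of `B`, the sign of its first coordinate is determined by
the signs of the maximal minors of `B` and of `[u, B]`. -/
theorem first_coord_sign {n k : ℕ} (hk : k ≤ n) {B : Matrix (Fin (n + 1)) (Fin k) ℝ}
    {u : Fin (n + 1) → ℝ} (hu : u ᵥ* B = 0) {ε₁ ε₂ : ℝ}
    (h₁ : ∀ s : Fin k → Fin (n + 1), StrictMono s → 0 < ε₁ * (B.submatrix s id).det)
    (h₂ : ∀ s : Fin (k + 1) → Fin (n + 1), StrictMono s →
      0 < ε₂ * ((consCol u B).submatrix s id).det) :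
    0 < ε₁ * ε₂ * u 0 := by
  let e : Fin (n + 1) → ℝ := Pi.single 0 1
  have hzero (s : Fin k → Fin n) :
      ((consCol e B).submatrix (Fin.cons 0 (Fin.succ ∘ s)) id).det =
        (B.submatrix (Fin.succ ∘ s) id).det := by
    rw [det_succ_column_zero, Fin.sum_univ_succ]
    simp [e, submatrix_submatrix]
    rfl
  have hpos {s : Fin k → Fin n} (hs : StrictMono s) :
      0 < ((consCol (ε₁ • e) B).submatrix (Fin.cons 0 (Fin.succ ∘ s)) id).det := by
    rw [det_consCol_smul, hzero]
    exact h₁ _ (Fin.strictMono_succ.comp hs)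
  have hdet : 0 < ((consCol (ε₂ • u) B)ᵀ * consCol (ε₁ • e) B).det := by
    refine det_transpose_mul_pos _ _ (fun s hs => ?_) (fun s hs => ?_) ?_
    · rw [det_consCol_smul]
      exact h₂ s hs
    · by_cases hz : s 0 = 0
      · obtain ⟨s', hs', rfl⟩ := hs.exists_eq_cons_zero hz
        exact (hpos hs').le
      · refine (det_eq_zero_of_column_eq_zero 0 fun i => ?_).ge
        have : s i ≠ 0 := fun hi => hz
          (Fin.le_zero_iff.mp (hi ▸ hs.monotone (Fin.zero_le i)))
        simp [e, this]
    · exact ⟨_, strictMono_cons_zero (Fin.strictMono_castLE hk), hpos (Fin.strictMono_castLE hk)⟩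
  have hblock : ((consCol (ε₂ • u) B)ᵀ * consCol (ε₁ • e) B).det =
      ε₁ * ε₂ * u 0 * (Bᵀ * B).det := by
    have hrow (j : Fin k) : ((consCol (ε₂ • u) B)ᵀ * consCol (ε₁ • e) B) 0 j.succ = 0 := by
      have := congrFun hu j
      simp only [vecMul, dotProduct, Pi.zero_apply] at this
      simp [Matrix.mul_apply, mul_assoc, ← Finset.mul_sum, this]
    have hsub : ((consCol (ε₂ • u) B)ᵀ * consCol (ε₁ • e) B).submatrix Fin.succ Fin.succ =
        Bᵀ * B := rfl
    rw [det_succ_row_zero, Fin.sum_univ_succ]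
    simp only [hrow, Fin.succAbove_zero, hsub]
    simp [Matrix.mul_apply, e, Pi.single_apply]
    exact Or.inl (by ring)
  rw [hblock] at hdet
  exact pos_of_mul_pos_left hdet (det_transpose_mul_self_nonneg B)

theorem posOriented_iff {n k : ℕ} {B : Matrix (Fin (n + 1)) (Fin k) ℝ}
    (w : Fin (n + 1) → ℝ) :
    PosOriented {y | ∃ c, B *ᵥ c = y} w ↔ ∃ u c, w = u + B *ᵥ c ∧ u ᵥ* B = 0 ∧ 0 < u 0 := by
  refine exists_congr fun u => ?_
  have horth : (∀ v ∈ {y | ∃ c, B *ᵥ c = y}, ∑ i, u i * v i = 0) ↔ u ᵥ* B = 0 := by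
    refine ⟨fun h => ?_, ?_⟩
    · refine dotProduct_eq_zero _ fun c => ?_
      rw [← dotProduct_mulVec]
      exact h _ ⟨c, rfl⟩
    · rintro h _ ⟨c, rfl⟩
      change u ⬝ᵥ B *ᵥ c = 0
      rw [dotProduct_mulVec, h, zero_dotProduct]
  rw [horth]
  constructor
  · rintro ⟨⟨c, hc⟩, hu, hpos⟩
    exact ⟨c, by rw [hc]; abel, hu, hpos 0 rfl⟩
  · rintro ⟨c, hc, hu, hpos⟩
    refine ⟨⟨c, by rw [hc]; abel⟩, hu, fun i hi => ?_⟩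
    rwa [show i = 0 from Fin.ext hi]

theorem exists_orthogonal_decomposition {n k : ℕ} {B : Matrix (Fin n) (Fin k) ℝ}
    (hB : Function.Injective B.mulVec) (w : Fin n → ℝ) :
    ∃ u c, w = u + B *ᵥ c ∧ u ᵥ* B = 0 := by
  have hunit : IsUnit (Bᵀ * B).det := isUnit_iff_ne_zero.mpr (det_transpose_mul_self_ne_zero hB)
  let c := (Bᵀ * B)⁻¹ *ᵥ (Bᵀ *ᵥ w)
  refine ⟨w - B *ᵥ c, c, by abel, ?_⟩
  rw [← mulVec_transpose, mulVec_sub, mulVec_mulVec, mulVec_mulVec, mul_nonsing_inv _ hunit,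
    one_mulVec, sub_self]

/-- Uniform minors of `[1, 0; w, B]` encode that the arrangement given by `B` and `w` is
cyclic. -/
theorem hasUniformMinors_coneMatrix_iff_posOriented {n k : ℕ} (hkn : k < n) (w : Fin n → ℝ)
    {B : Matrix (Fin n) (Fin k) ℝ} (hB : Function.Injective B.mulVec) :
    HasUniformMinors (coneMatrix w B) ↔ HasUniformMinors B ∧ HasUniformMinors (consCol w B) ∧
      PosOriented {y | ∃ c, B *ᵥ c = y} w := by
  obtain ⟨n, rfl⟩ : ∃ N, n = N + 1 := Nat.exists_eq_succ_of_ne_zero (by omega)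
  rw [hasUniformMinors_coneMatrix_iff, posOriented_iff]
  constructor
  · rintro ⟨ε, h₁, h₂⟩
    refine ⟨⟨ε, h₁⟩, ⟨ε, h₂⟩, ?_⟩
    obtain ⟨u, c, rfl, hu⟩ := exists_orthogonal_decomposition hB w
    simp only [det_consCol_add_mulVec] at h₂
    exact ⟨u, c, rfl, hu, pos_of_mul_pos_right (first_coord_sign (by omega) hu h₁ h₂)
      (mul_self_nonneg ε)⟩
  · rintro ⟨⟨ε₁, h₁⟩, ⟨ε₂, h₂⟩, u, c, rfl, hu, hpos⟩
    simp only [det_consCol_add_mulVec] at h₂ ⊢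
    have hε := pos_of_mul_pos_left (first_coord_sign (by omega) hu h₁ h₂) hpos.le
    refine ⟨ε₁, h₁, fun s hs => ?_⟩
    have := mul_pos hε (h₂ s hs)
    have h : ε₁ * ε₂ * (ε₂ * ((consCol u B).submatrix s id).det) =
      ε₁ * ((consCol u B).submatrix s id).det * ε₂ ^ 2 := by ring
    rw [h] at this
    exact pos_of_mul_pos_left this (sq_nonneg _)

theorem HasUniformMinors.of_consRow {n k : ℕ} {r : Fin k → ℝ} {B : Matrix (Fin n) (Fin k) ℝ}
    (h : HasUniformMinors (consRow r B)) : HasUniformMinors B := by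
  obtain ⟨ε, hε⟩ := h
  exact ⟨ε, fun s hs => hε _ (Fin.strictMono_succ.comp hs)⟩

theorem StrictMono.exists_eq_castSucc_comp {d m : ℕ} {s : Fin d → Fin (m + 1)}
    (hs : StrictMono s) (h : ∀ i, s i ≠ Fin.last m) :
    ∃ s' : Fin d → Fin m, StrictMono s' ∧ s = Fin.castSucc ∘ s' :=
  ⟨fun i => (s i).castPred (h i), fun i j hij => by simpa using hs hij, by ext; simp⟩

theorem StrictMono.exists_eq_snoc_last {d m : ℕ} {s : Fin (d + 1) → Fin (m + 1)}
    (hs : StrictMono s) (h : s (Fin.last d) = Fin.last m) :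
    ∃ s' : Fin d → Fin m, StrictMono s' ∧
      s = Fin.snoc (α := fun _ => Fin (m + 1)) (Fin.castSucc ∘ s') (Fin.last m) := by
  obtain ⟨s', hs', he⟩ := (hs.comp Fin.strictMono_castSucc).exists_eq_castSucc_comp fun i => by
    simpa [h] using (hs (Fin.castSucc_lt_last i)).ne
  refine ⟨s', hs', ?_⟩
  rw [← he]
  ext i
  refine Fin.lastCases ?_ (fun i => ?_) i <;> simp [h]

theorem strictMono_snoc_last {d m : ℕ} {s : Fin d → Fin m} (hs : StrictMono s) :
    StrictMono (Fin.snoc (α := fun _ => Fin (m + 1)) (Fin.castSucc ∘ s) (Fin.last m)) := by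
  intro i j
  refine Fin.lastCases ?_ (fun i => ?_) i <;> refine Fin.lastCases ?_ (fun j => ?_) j
  · simp
  · simp [(Fin.castSucc_lt_last j).le]
  · simp [Fin.castSucc_lt_last]
  · simpa using fun h => hs h

/-- Cyclic rotation of the rows. -/
theorem hasUniformMinors_snocRow_iff {n k : ℕ} (hk : 0 < k) (r : Fin k → ℝ)
    (B : Matrix (Fin n) (Fin k) ℝ) :
    HasUniformMinors (snocRow B ((-1 : ℝ) ^ k • r)) ↔ HasUniformMinors (consRow (-r) B) := by
  obtain ⟨k, rfl⟩ := Nat.exists_eq_succ_of_ne_zero hk.ne'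
  have hrot (s : Fin k → Fin n) :
      ((snocRow B ((-1 : ℝ) ^ (k + 1) • r)).submatrix
        (Fin.snoc (α := fun _ => Fin (n + 1)) (Fin.castSucc ∘ s) (Fin.last n)) id).det =
      ((consRow (-r) B).submatrix (Fin.cons 0 (Fin.succ ∘ s)) id).det := by
    rw [det_succ_row _ (Fin.last k), det_succ_row_zero]
    refine Finset.sum_congr rfl fun j _ => ?_
    have h₁ : ((snocRow B ((-1 : ℝ) ^ (k + 1) • r)).submatrix
        (Fin.snoc (α := fun _ => Fin (n + 1)) (Fin.castSucc ∘ s) (Fin.last n)) id).submatrix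
          (Fin.last k).succAbove j.succAbove = B.submatrix s j.succAbove := by
      ext a b
      simp
    have h₂ : ((consRow (-r) B).submatrix (Fin.cons 0 (Fin.succ ∘ s)) id).submatrix
        Fin.succ j.succAbove = B.submatrix s j.succAbove := rfl
    have hsign : (-1 : ℝ) ^ k * (-1) ^ k = 1 := by rw [← mul_pow]; simp
    rw [h₁, h₂]
    simp only [submatrix_apply, Fin.snoc_last, snocRow_last, Fin.cons_zero, consRow_zero, id,
      Pi.smul_apply, Pi.neg_apply, smul_eq_mul, Fin.val_last, pow_add, pow_one]
    linear_combination -(-1 : ℝ) ^ (j : ℕ) * r j * (B.submatrix s j.succAbove).det * hsign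
  have hcast (s : Fin (k + 1) → Fin n) :
      (snocRow B ((-1 : ℝ) ^ (k + 1) • r)).submatrix (Fin.castSucc ∘ s) id =
        (consRow (-r) B).submatrix (Fin.succ ∘ s) id := by
    ext a b
    simp
  refine exists_congr fun ε => ⟨fun h s hs => ?_, fun h s hs => ?_⟩
  · by_cases hz : s 0 = 0
    · obtain ⟨s', hs', rfl⟩ := hs.exists_eq_cons_zero hz
      rw [← hrot]
      exact h _ (strictMono_snoc_last hs')
    · obtain ⟨s', hs', rfl⟩ := hs.exists_eq_succ_comp fun i hi => hz
        (Fin.le_zero_iff.mp (hi ▸ hs.monotone (Fin.zero_le i)))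
      rw [← hcast]
      exact h _ (Fin.strictMono_castSucc.comp hs')
  · by_cases hz : s (Fin.last k) = Fin.last n
    · obtain ⟨s', hs', rfl⟩ := hs.exists_eq_snoc_last hz
      exact (hrot s').symm ▸ h _ (strictMono_cons_zero hs')
    · obtain ⟨s', hs', rfl⟩ := hs.exists_eq_castSucc_comp fun i hi => hz
        (Fin.last_le_iff.mp (hi ▸ hs.monotone (Fin.le_last i)))
      rw [hcast]
      exact h _ (Fin.strictMono_succ.comp hs')

theorem setOf_add_smul_eq {n k : ℕ} (w : Fin n → ℝ) (B : Matrix (Fin n) (Fin k) ℝ) :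
    {y | ∃ v ∈ {y | ∃ c, B *ᵥ c = y}, ∃ t : ℝ, y = v + t • w} =
      {y | ∃ c, consCol w B *ᵥ c = y} := by
  ext y
  constructor
  · rintro ⟨_, ⟨c, rfl⟩, t, rfl⟩
    exact ⟨Fin.cons t c, by simp [consCol_mulVec]⟩
  · rintro ⟨c, rfl⟩
    exact ⟨_, ⟨Fin.tail c, rfl⟩, c 0, consCol_mulVec w B c⟩

theorem isRightCyclic_iff {n k : ℕ} (hk : 0 < k) (hkn : k < n) (w x : Fin n → ℝ)
    {B : Matrix (Fin n) (Fin k) ℝ} (hB : Function.Injective B.mulVec) :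
    IsRightCyclic n k {y | ∃ c, B *ᵥ c = y} w (fun v => ∑ i, x i * v i) ↔
      HasUniformMinors (consRow (-(x ᵥ* B)) B) ∧ HasUniformMinors (coneMatrix w B) := by
  have hset : {y : Fin (n + 1) → ℝ | ∃ v ∈ {y | ∃ c, B *ᵥ c = y},
      y = Fin.snoc v ((-1) ^ k * ∑ i, x i * v i)} =
      {y | ∃ c, snocRow B ((-1 : ℝ) ^ k • (x ᵥ* B)) *ᵥ c = y} := by
    ext y
    simp only [snocRow_mulVec, smul_dotProduct, ← dotProduct_mulVec, smul_eq_mul]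
    constructor
    · rintro ⟨_, ⟨c, rfl⟩, rfl⟩
      exact ⟨c, rfl⟩
    · rintro ⟨c, rfl⟩
      exact ⟨_, ⟨c, rfl⟩, rfl⟩
  rw [IsRightCyclic, hset, setOf_add_smul_eq, isTotallyPositive_iff_hasUniformMinors (by omega),
    isTotallyPositive_iff_hasUniformMinors hk, hasUniformMinors_snocRow_iff hk,
    hasUniformMinors_coneMatrix_iff_posOriented hkn w hB]
  have := HasUniformMinors.of_consRow (r := -(x ᵥ* B)) (B := B)
  tauto

theorem isLeftCyclic_iff {n k : ℕ} (hk : 0 < k) (hkn : k < n) (w x : Fin n → ℝ)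
    {B : Matrix (Fin n) (Fin k) ℝ} (hB : Function.Injective B.mulVec) :
    IsLeftCyclic n k {y | ∃ c, B *ᵥ c = y} w (fun v => ∑ i, x i * v i) ↔
      HasUniformMinors (consRow (x ᵥ* B) B) ∧ HasUniformMinors (coneMatrix w B) := by
  have hset : {y : Fin (n + 1) → ℝ | ∃ v ∈ {y | ∃ c, B *ᵥ c = y},
      y = Fin.cons (∑ i, x i * v i) v} = {y | ∃ c, consRow (x ᵥ* B) B *ᵥ c = y} := by
    ext y
    simp only [consRow_mulVec, ← dotProduct_mulVec]
    constructor
    · rintro ⟨_, ⟨c, rfl⟩, rfl⟩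
      exact ⟨c, rfl⟩
    · rintro ⟨c, rfl⟩
      exact ⟨_, ⟨c, rfl⟩, rfl⟩
  rw [IsLeftCyclic, hset, setOf_add_smul_eq, isTotallyPositive_iff_hasUniformMinors (by omega),
    isTotallyPositive_iff_hasUniformMinors hk, hasUniformMinors_coneMatrix_iff_posOriented hkn w hB]
  have := HasUniformMinors.of_consRow (r := x ᵥ* B) (B := B)
  tauto

theorem hasUniformMinors_consRow_iff_coneMatrix {n k l : ℕ} (hk : 0 < k) (hkl : k + l = n)
    (x : Fin n → ℝ) {B : Matrix (Fin n) (Fin k) ℝ} {B' : Matrix (Fin n) (Fin l) ℝ}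
    (hB : Function.Injective B.mulVec) (hB' : Function.Injective B'.mulVec)
    (h : ∀ a b, ∑ i : Fin n, (-1 : ℝ) ^ (i : ℕ) * (B' i b * B i a) = 0) :
    HasUniformMinors (consRow (-(x ᵥ* B)) B) ↔
      HasUniformMinors (coneMatrix (fun i : Fin n => -((-1 : ℝ) ^ (i : ℕ) * x i)) B') := by
  refine hasUniformMinors_iff_of_alternating_orthogonal hk (by omega) (by omega)
    (injective_mulVec_consRow _ hB) (injective_mulVec_coneMatrix _ hB') fun a b => ?_
  rw [Fin.sum_univ_succ]
  refine Fin.cases ?_ (fun b => ?_) b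
  · have hterm (i : Fin n) : (-1 : ℝ) ^ ((i : ℕ) + 1) * (-((-1) ^ (i : ℕ) * x i) * B i a) =
        x i * B i a := by
      have : (-1 : ℝ) ^ (i : ℕ) * (-1) ^ (i : ℕ) = 1 := by rw [← mul_pow]; simp
      rw [pow_succ]
      linear_combination x i * B i a * this
    simp only [coneMatrix, consRow_zero, consRow_succ, consCol_zero, Fin.val_succ, hterm]
    simp [vecMul, dotProduct]
  · simpa [coneMatrix, pow_succ] using h a b

theorem Submodule.exists_mulVec_range_eq {n d : ℕ} (W : Submodule ℝ (Fin n → ℝ))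
    (hW : Module.finrank ℝ W = d) :
    ∃ B : Matrix (Fin n) (Fin d) ℝ, Function.Injective B.mulVec ∧
      (W : Set (Fin n → ℝ)) = {y | ∃ c, B *ᵥ c = y} := by
  let e := (Module.finBasisOfFinrankEq ℝ W hW).equivFun
  have hmul (c : Fin d → ℝ) :
      LinearMap.toMatrix' (W.subtype ∘ₗ e.symm.toLinearMap) *ᵥ c = e.symm c := by
    rw [LinearMap.toMatrix'_mulVec]
    rfl
  refine ⟨LinearMap.toMatrix' (W.subtype ∘ₗ e.symm.toLinearMap), fun c c' h => ?_, ?_⟩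
  · simpa [hmul] using h
  · ext y
    simp only [hmul, Set.mem_ofPred_eq, SetLike.mem_coe]
    exact ⟨fun hy => ⟨e ⟨y, hy⟩, by simp⟩, by rintro ⟨c, rfl⟩; exact (e.symm c).2⟩

/-- The alternating symmetric bilinear form `∑ (-1) ^ i * x i * y i`. -/
noncomputable def alternatingForm (n : ℕ) : LinearMap.BilinForm ℝ (Fin n → ℝ) :=
  toBilin' (diagonal fun i : Fin n => (-1 : ℝ) ^ (i : ℕ))

theorem alternatingForm_apply {n : ℕ} (x y : Fin n → ℝ) :
    alternatingForm n x y = ∑ i : Fin n, (-1 : ℝ) ^ (i : ℕ) * (y i * x i) := by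
  rw [alternatingForm, toBilin'_apply']
  simp only [dotProduct, mulVec_diagonal]
  exact Finset.sum_congr rfl fun i _ => by ring

theorem alternatingForm_nondegenerate (n : ℕ) : (alternatingForm n).Nondegenerate := by
  refine LinearMap.BilinForm.nondegenerate_toBilin'_of_det_ne_zero' _ ?_
  rw [det_diagonal]
  exact Finset.prod_ne_zero_iff.mpr fun i _ => by simp

theorem alternatingForm_orthogonal_eq {n : ℕ} (V : Submodule ℝ (Fin n → ℝ)) :
    ((alternatingForm n).orthogonal V : Set (Fin n → ℝ)) =
      (fun (u : Fin n → ℝ) (i : Fin n) => (-1 : ℝ) ^ (i : ℕ) * u i) ''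
        {u : Fin n → ℝ | ∀ v ∈ V, ∑ i, u i * v i = 0} := by
  have hsq (i : ℕ) : (-1 : ℝ) ^ i * (-1) ^ i = 1 := by rw [← mul_pow]; simp
  ext y
  simp only [SetLike.mem_coe, LinearMap.BilinForm.mem_orthogonal_iff, alternatingForm_apply]
  constructor
  · intro h
    refine ⟨fun i => (-1 : ℝ) ^ (i : ℕ) * y i, fun v hv => ?_, funext fun i => ?_⟩
    · simpa only [mul_assoc] using h v hv
    · simp only [← mul_assoc, hsq, one_mul]
  · rintro ⟨u, hu, rfl⟩ v hv
    simpa only [← mul_assoc, hsq, one_mul] using hu v hv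

/-- Theorem 3.14, positive Gale duality: `(V, η, ξ)` (with `η`
represented by `w` and `ξ = ⟨x, ·⟩`) is right cyclic if and only if the polarization
reversal of its alt Gale dual — the polarized arrangement `(alt(V^⊥), η̆, ξ̆)` of `n`
hyperplanes in `(n−k)`-space, where `η̆` is represented by `−alt(x)` and
`ξ̆ = ⟨alt(w), ·⟩` — is left cyclic. -/
theorem rightCyclic_iff_altGaleDual_polarizationReversal_leftCyclic
    (n k : ℕ) (hk1 : 1 ≤ k) (hkn : k ≤ n - 1)
    (V : Submodule ℝ (Fin n → ℝ)) (hV : Module.finrank ℝ V = k)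
    (w : Fin n → ℝ) (hw : w ∉ V)
    (x : Fin n → ℝ) (hx : ¬ ∀ v ∈ V, ∑ i, x i * v i = 0) :
    IsRightCyclic n k (V : Set (Fin n → ℝ)) w (fun v => ∑ i, x i * v i) ↔
      IsLeftCyclic n (n - k)
        ((fun (u : Fin n → ℝ) (i : Fin n) => (-1 : ℝ) ^ (i : ℕ) * u i) ''
          {u : Fin n → ℝ | ∀ v ∈ V, ∑ i, u i * v i = 0})
        (fun i : Fin n => -((-1 : ℝ) ^ (i : ℕ) * x i))
        (fun v => ∑ i : Fin n, ((-1 : ℝ) ^ (i : ℕ) * w i) * v i) := by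

  have hn : k < n := by omega
  obtain ⟨B, hB, hVB⟩ := V.exists_mulVec_range_eq hV
  have hdim : Module.finrank ℝ ((alternatingForm n).orthogonal V) = n - k := by
    rw [LinearMap.BilinForm.finrank_orthogonal (alternatingForm_nondegenerate n), hV]
    simp
  obtain ⟨B', hB', hVB'⟩ := Submodule.exists_mulVec_range_eq _ hdim
  have hcol {m : ℕ} (M : Matrix (Fin n) (Fin m) ℝ) (a : Fin m) :
      (fun i => M i a) ∈ {y | ∃ c, M *ᵥ c = y} := ⟨Pi.single a 1, by simp; rfl⟩
  have horth (a b) : ∑ i : Fin n, (-1 : ℝ) ^ (i : ℕ) * (B' i b * B i a) = 0 := by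
    have hb : (fun i => B' i b) ∈ (alternatingForm n).orthogonal V := by
      rw [← SetLike.mem_coe, hVB']
      exact hcol B' b
    have ha : (fun i => B i a) ∈ V := by
      rw [← SetLike.mem_coe, hVB]
      exact hcol B a
    simpa only [alternatingForm_apply] using
      LinearMap.BilinForm.mem_orthogonal_iff.mp hb _ ha
  have h₁ := hasUniformMinors_consRow_iff_coneMatrix hk1 (by omega) x hB hB' horth
  have h₂ := hasUniformMinors_consRow_iff_coneMatrix (by omega) (by omega)
    (fun i : Fin n => -((-1 : ℝ) ^ (i : ℕ) * w i)) hB' hB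
    fun a b => by simpa only [mul_comm (B _ _)] using horth b a
  have hww : (fun i : Fin n => -((-1 : ℝ) ^ (i : ℕ) * -((-1 : ℝ) ^ (i : ℕ) * w i))) = w := by
    ext i
    have : (-1 : ℝ) ^ (i : ℕ) * (-1) ^ (i : ℕ) = 1 := by rw [← mul_pow]; simp
    linear_combination w i * this
  have hneg : -((fun i : Fin n => -((-1 : ℝ) ^ (i : ℕ) * w i)) ᵥ* B') =
      (fun i : Fin n => (-1 : ℝ) ^ (i : ℕ) * w i) ᵥ* B' := by
    rw [← neg_vecMul]
    congr 1
    ext i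
    simp
  rw [hww, hneg] at h₂
  rw [← alternatingForm_orthogonal_eq, hVB, hVB', isRightCyclic_iff hk1 hn w x hB,
    isLeftCyclic_iff (by omega) (by omega) _ (fun i : Fin n => (-1 : ℝ) ^ (i : ℕ) * w i) hB',
    h₁, h₂]
  exact and_comm
end

section
/- Let 2 ≤ n, 1 ≤ k ≤ n−1, let (V,η,ξ) be a left cyclic (respectively right cyclic) polarized arrangement of n hyperplanes in k-space with representative w of η, and let 1 ≤ i ≤ n. Let ι_i : ℝ^{n−1} → ℝ^n be the linear inclusion inserting a 0 in the i-th coordinate, and let D_i : ℝ^{n−1} → ℝ^{n−1} be the diagonal map that fixes coordinates j < i and multiplies coordinates j ≥ i by −1. Then V is not contained in the i-th coordinate hyperplane of ℝ^n, the preimage V^i := ι_i^{−1}(V) is a (k−1)-dimensional subspace of ℝ^{n−1}, and there exists w' ∈ ℝ^{n−1} with ι_i(w') − w ∈ V. For any such w', the signed restriction (D_i(V^i), η'', ξ'') — where η'' ∈ ℝ^{n−1}/D_i(V^i) is represented by D_i(w') and ξ'' is the linear functional u ↦ ξ(ι_i(D_i(u))) on D_i(V^i) — is a left cyclic (respectively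 right cyclic) polarized arrangement of n−1 hyperplanes in (k−1)-space. -/
open scoped BigOperators

/-- The linear inclusion `ι_i : ℝ^m → ℝ^{m+1}` inserting a `0` in the `i`-th coordinate. -/
def insertZeroMap (m : ℕ) (i : Fin (m + 1)) : (Fin m → ℝ) →ₗ[ℝ] (Fin (m + 1) → ℝ) where
  toFun u := i.insertNth 0 u
  map_add' u v := by
    funext j
    refine Fin.succAboveCases i ?_ (fun j' => ?_) j <;>
      simp [Fin.insertNth_apply_same, Fin.insertNth_apply_succAbove]
  map_smul' c u := by
    funext j
    refine Fin.succAboveCases i ?_ (fun j' => ?_) j <;>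
      simp [Fin.insertNth_apply_same, Fin.insertNth_apply_succAbove]

/-- The sign-change map `D_i : ℝ^m → ℝ^m` fixing coordinates `j < i` and negating
coordinates `j ≥ i` (indices of `ℝ^m` are taken `1`-based relative to `i ∈ Fin (m+1)`). -/
def signChange (m : ℕ) (i : Fin (m + 1)) (u : Fin m → ℝ) : Fin m → ℝ :=
  fun j => (if (j : ℕ) < (i : ℕ) then (1 : ℝ) else -1) * u j

/-- The minors of the matrix with columns `F`, multiplied by `c`, are all positive. -/
def MinorsHaveSign {d m : ℕ} (F : Fin d → Fin m → ℝ) (c : ℝ) : Prop :=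
  ∀ s : Fin d → Fin m, StrictMono s → 0 < c * (Matrix.of fun a b => F b (s a)).det

theorem MinorsHaveSign.isTotallyPositive {d m : ℕ} {F : Fin d → Fin m → ℝ} {c : ℝ}
    (h : MinorsHaveSign F c) :
    IsTotallyPositive d m (Submodule.span ℝ (Set.range F) : Set (Fin m → ℝ)) := by
  rcases d with _ | d
  · refine ⟨Matrix.of fun r b => F b r, rfl, fun s _ => ?_⟩
    simp
  · by_cases hc : c = 0
    · refine ⟨Matrix.of fun r b => F b r, rfl, fun s hs => ?_⟩
      have := h s hs
      simp [hc] at this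
    refine ⟨Matrix.of fun r b => (if b = 0 then c else 1) * F b r, ?_, fun s hs => ?_⟩
    · refine congrArg _ (le_antisymm ?_ ?_) <;> rw [Submodule.span_le] <;> rintro _ ⟨b, rfl⟩
      · exact Submodule.smul_mem _ (if b = 0 then c else 1)
          (Submodule.subset_span (Set.mem_range_self b))
      · have hb : (if b = 0 then c else 1) ≠ 0 := by split_ifs <;> simp [hc]
        have hFb : F b = (if b = 0 then c else 1)⁻¹ •
            fun r => (if b = 0 then c else 1) * F b r := by
          ext r
          exact (inv_mul_cancel_left₀ hb _).symm
        rw [SetLike.mem_coe, hFb]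
        exact Submodule.smul_mem _ _ (Submodule.subset_span ⟨b, rfl⟩)
    · have h1 := h s hs
      have h2 : (Matrix.of fun r b => (if b = 0 then c else 1) * F b r).submatrix s id =
          Matrix.of fun a b => (if b = 0 then c else 1) *
            (Matrix.of fun a b => F b (s a) : Matrix (Fin (d + 1)) (Fin (d + 1)) ℝ) a b := by
        ext; rfl
      rw [h2, Matrix.det_mul_row]
      simpa [Finset.prod_ite_eq'] using h1

theorem det_of_sum_columns {d m : ℕ} {E F : Fin d → Fin m → ℝ} {g : Matrix (Fin d) (Fin d) ℝ}
    (h : ∀ b, ∑ a, g a b • E a = F b) (s : Fin d → Fin m) :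
    (Matrix.of fun a b => F b (s a)).det = (Matrix.of fun a b => E b (s a)).det * g.det := by
  rw [← Matrix.det_mul]
  congr 1
  ext a b
  simp [Matrix.mul_apply, ← h b, mul_comm]

theorem exists_coeff_matrix {d m : ℕ} {E F : Fin d → Fin m → ℝ}
    (h : ∀ b, F b ∈ Submodule.span ℝ (Set.range E)) :
    ∃ g : Matrix (Fin d) (Fin d) ℝ, ∀ b, ∑ a, g a b • E a = F b := by
  choose g hg using fun b => (Submodule.mem_span_range_iff_exists_fun ℝ).1 (h b)
  exact ⟨Matrix.of fun a b => g b a, hg⟩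

theorem IsTotallyPositive.exists_minorsHaveSign {d m : ℕ} {W : Set (Fin m → ℝ)}
    (h : IsTotallyPositive d m W) {F : Fin d → Fin m → ℝ}
    (hF : (Submodule.span ℝ (Set.range F) : Set (Fin m → ℝ)) = W) :
    ∃ c, MinorsHaveSign F c := by
  obtain ⟨M, hM, hpos⟩ := h
  have hspan := SetLike.coe_injective (hF.trans hM.symm)
  obtain ⟨g, hg⟩ := exists_coeff_matrix (E := fun b r => M r b) (F := F) fun b =>
    hspan ▸ Submodule.subset_span (Set.mem_range_self b)
  obtain ⟨g', hg'⟩ := exists_coeff_matrix (E := F) (F := fun b r => M r b) fun b =>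
    hspan ▸ Submodule.subset_span (Set.mem_range_self b)
  refine ⟨g.det, fun s hs => ?_⟩
  have h1 := det_of_sum_columns hg s
  have h2 := det_of_sum_columns hg' s
  have h3 : 0 < (Matrix.of fun a b => M (s a) b).det := hpos s hs
  rw [h1] at h2 ⊢
  have h4 : g.det ≠ 0 := by
    intro h0
    rw [h0] at h2
    simp only [mul_zero, zero_mul] at h2
    exact h3.ne' h2
  have := mul_pos h3 (mul_self_pos.2 h4)
  linarith [this]

/-- A symmetrized form of the Cauchy–Binet formula. -/
theorem factorial_mul_det_gram {d n : ℕ} (F G : Fin d → Fin n → ℝ) :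
    (d.factorial : ℝ) * (Matrix.of fun a b => ∑ r, F a r * G b r).det =
      ∑ f : Fin d → Fin n, (Matrix.of fun a b => F b (f a)).det *
        (Matrix.of fun a b => G b (f a)).det := by
  have key : ∀ σ : Equiv.Perm (Fin d),
      (Matrix.of fun a b => ∑ r, F a r * G b r).det = ∑ f : Fin d → Fin n,
        ((Equiv.Perm.sign σ : ℤ) : ℝ) * (∏ a, F (σ a) (f a)) *
          (Matrix.of fun a b => G b (f a)).det := by
    intro σ
    have h1 : (Matrix.of fun a b => ∑ r, F a r * G b r).det =
        ((Equiv.Perm.sign σ : ℤ) : ℝ) *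
          ((Matrix.of fun a b => ∑ r, F a r * G b r).submatrix σ id).det := by
      rw [Matrix.det_permute, ← mul_assoc, ← Int.cast_mul, Int.units_coe_mul_self]
      simp
    rw [h1]
    simp_rw [mul_assoc, ← Finset.mul_sum]
    congr 1
    have h2 : ((Matrix.of fun a b => ∑ r, F a r * G b r).submatrix σ id) =
        fun a => ∑ r, F (σ a) r • fun b => G b r := by
      ext a b
      simp
    have h3 := (Matrix.detRowAlternating (R := ℝ) (n := Fin d)).toMultilinearMap.map_sum
      (fun a r => F (σ a) r • fun b => G b r)
    rw [h2]
    refine h3.trans (Finset.sum_congr rfl fun f _ => ?_)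
    exact (Matrix.detRowAlternating (R := ℝ) (n := Fin d)).toMultilinearMap.map_smul_univ
      (fun a => F (σ a) (f a)) (fun a b => G b (f a))
  have h4 : ∑ _σ : Equiv.Perm (Fin d), (Matrix.of fun a b => ∑ r, F a r * G b r).det =
      (d.factorial : ℝ) * (Matrix.of fun a b => ∑ r, F a r * G b r).det := by
    simp [Fintype.card_perm]
  rw [← h4, Finset.sum_congr rfl fun σ _ => key σ, Finset.sum_comm]
  refine Finset.sum_congr rfl fun f _ => ?_
  rw [← Finset.sum_mul]
  congr 1
  rw [← Matrix.det_transpose, Matrix.det_apply']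
  rfl

theorem det_gram_pos {d n : ℕ} (F G : Fin d → Fin n → ℝ) (c : ℝ)
    (h0 : ∀ s : Fin d → Fin n, StrictMono s → 0 ≤ c *
      ((Matrix.of fun a b => F b (s a)).det * (Matrix.of fun a b => G b (s a)).det))
    (h1 : ∃ s : Fin d → Fin n, StrictMono s ∧ 0 < c *
      ((Matrix.of fun a b => F b (s a)).det * (Matrix.of fun a b => G b (s a)).det)) :
    0 < c * (Matrix.of fun a b => ∑ r, F a r * G b r).det := by
  have hd : (0 : ℝ) < d.factorial := by exact_mod_cast d.factorial_pos
  rw [← mul_pos_iff_of_pos_left hd, mul_left_comm, factorial_mul_det_gram, Finset.mul_sum]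
  obtain ⟨s, -, hs⟩ := h1
  refine Finset.sum_pos' (fun f _ => ?_) ⟨s, Finset.mem_univ _, hs⟩
  by_cases hf : Function.Injective f
  · have hmono : StrictMono (f ∘ Tuple.sort f) :=
      (Tuple.monotone_sort f).strictMono_of_injective (hf.comp (Tuple.sort f).injective)
    have hperm : ∀ H : Fin d → Fin n → ℝ,
        (Matrix.of fun a b => H b ((f ∘ Tuple.sort f) a)).det =
          ((Equiv.Perm.sign (Tuple.sort f) : ℤ) : ℝ) * (Matrix.of fun a b => H b (f a)).det :=
      fun H => Matrix.det_permute (Tuple.sort f) (Matrix.of fun a b => H b (f a))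
    have := h0 _ hmono
    rw [hperm F, hperm G, mul_mul_mul_comm, ← Int.cast_mul, Int.units_coe_mul_self] at this
    simpa using this
  · obtain ⟨a, b, hab, hne⟩ := Function.not_injective_iff.1 hf
    rw [Matrix.det_zero_of_row_eq (M := Matrix.of fun a b => F b (f a)) hne
      (by ext; simp [hab])]
    simp

theorem det_cons_column_add_mem_span {d m : ℕ} {F : Fin d → Fin m → ℝ} {w u : Fin m → ℝ}
    (h : w - u ∈ Submodule.span ℝ (Set.range F)) (s : Fin (d + 1) → Fin m) :
    (Matrix.of fun a b => (Fin.cons u F : Fin (d + 1) → Fin m → ℝ) b (s a)).det =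
      (Matrix.of fun a b => (Fin.cons w F : Fin (d + 1) → Fin m → ℝ) b (s a)).det := by
  obtain ⟨c, hc⟩ := (Submodule.mem_span_range_iff_exists_fun ℝ).1 h
  set g : Matrix (Fin (d + 1)) (Fin (d + 1)) ℝ := Matrix.of fun a b =>
    (Fin.cons (Fin.cons 1 fun a => -c a) fun b => Fin.cons 0 fun a => if a = b then 1 else 0 :
      Fin (d + 1) → Fin (d + 1) → ℝ) b a with hg
  have hdet : g.det = 1 := by
    rw [Matrix.det_succ_row_zero, Fin.sum_univ_succ]
    have : g.submatrix Fin.succ (Fin.succAbove 0) = 1 := by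
      ext a b
      simp [hg, Matrix.one_apply]
    rw [this, Finset.sum_eq_zero]
    · simp [hg]
    · intro b _
      simp [hg]
  rw [det_of_sum_columns (E := Fin.cons w F) (F := Fin.cons u F) (g := g) _ s, hdet, mul_one]
  intro b
  refine Fin.cases ?_ (fun b => ?_) b
  · rw [Fin.sum_univ_succ]
    simp [hg, hc]
  · rw [Fin.sum_univ_succ]
    simp [hg]

theorem det_gram_self_pos {d n : ℕ} (hd : d ≤ n) {F : Fin d → Fin n → ℝ} {δ : ℝ}
    (h : MinorsHaveSign F δ) : 0 < (Matrix.of fun a b => ∑ r, F a r * F b r).det := by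
  have h1 : ∀ s : Fin d → Fin n, StrictMono s → 0 < 1 *
      ((Matrix.of fun a b => F b (s a)).det * (Matrix.of fun a b => F b (s a)).det) := by
    intro s hs
    rw [one_mul]
    exact mul_self_pos.2 (right_ne_zero_of_mul (h s hs).ne')
  simpa using det_gram_pos F F 1 (fun s hs => (h1 s hs).le)
    ⟨Fin.castLE hd, Fin.strictMono_castLE hd, h1 _ (Fin.strictMono_castLE hd)⟩

theorem exists_orthogonal_representative {d n : ℕ} {F : Fin d → Fin n → ℝ}
    (h : (Matrix.of fun a b => ∑ r, F a r * F b r).det ≠ 0) (w : Fin n → ℝ) :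
    ∃ u, w - u ∈ Submodule.span ℝ (Set.range F) ∧ ∀ b, ∑ r, u r * F b r = 0 := by
  set G : Matrix (Fin d) (Fin d) ℝ := Matrix.of fun a b => ∑ r, F a r * F b r with hG
  set c := G⁻¹.mulVec fun b => ∑ r, w r * F b r with hc
  have h1 : G.mulVec c = fun b => ∑ r, w r * F b r := by
    rw [hc, Matrix.mulVec_mulVec, Matrix.mul_nonsing_inv _ (isUnit_iff_ne_zero.2 h),
      Matrix.one_mulVec]
  refine ⟨w - ∑ a, c a • F a, ?_, fun b => ?_⟩
  · rw [sub_sub_cancel]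
    exact (Submodule.mem_span_range_iff_exists_fun ℝ).2 ⟨c, rfl⟩
  · have h2 := congrFun h1 b
    simp only [Matrix.mulVec, dotProduct, hG, Matrix.of_apply] at h2
    simp only [Pi.sub_apply, sub_mul, Finset.sum_sub_distrib, ← h2, Finset.sum_apply,
      Pi.smul_apply, smul_eq_mul, Finset.sum_mul]
    rw [Finset.sum_comm, sub_eq_zero]
    refine Finset.sum_congr rfl fun a _ => Finset.sum_congr rfl fun r _ => ?_
    ring

theorem sign_mul_coord_zero_pos {d m : ℕ} (hd : d ≤ m) {F : Fin d → Fin (m + 1) → ℝ}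
    {w u : Fin (m + 1) → ℝ} {δ ε : ℝ} (hF : MinorsHaveSign F δ)
    (hwF : MinorsHaveSign (Fin.cons w F : Fin (d + 1) → Fin (m + 1) → ℝ) ε)
    (hwu : w - u ∈ Submodule.span ℝ (Set.range F)) (hu : ∀ b, ∑ r, u r * F b r = 0) :
    0 < δ * ε * u 0 := by
  set e : Fin (m + 1) → ℝ := Pi.single 0 1 with he
  have hgram := det_gram_self_pos (hd.trans (Nat.le_succ m)) hF
  have hgram' : (Matrix.of fun a b => ∑ r, (Fin.cons e F : Fin (d + 1) → Fin (m + 1) → ℝ) a r *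
      (Fin.cons u F : Fin (d + 1) → Fin (m + 1) → ℝ) b r).det =
      u 0 * (Matrix.of fun a b => ∑ r, F a r * F b r).det := by
    rw [Matrix.det_succ_column_zero, Fin.sum_univ_succ, Finset.sum_eq_zero, add_zero]
    · have : ((Matrix.of fun a b => ∑ r, (Fin.cons e F : Fin (d + 1) → Fin (m + 1) → ℝ) a r *
          (Fin.cons u F : Fin (d + 1) → Fin (m + 1) → ℝ) b r).submatrix (Fin.succAbove 0)
            Fin.succ) = Matrix.of fun a b => ∑ r, F a r * F b r := by
        ext a b
        simp
      rw [this]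
      simp [he, Pi.single_apply]
    · intro a _
      have : ∑ r, F a r * u r = 0 := by simpa only [mul_comm] using hu a
      simp [this]
  have hcol : ∀ s : Fin (d + 1) → Fin (m + 1), StrictMono s →
      (s 0 = 0 → (Matrix.of fun a b => (Fin.cons e F : Fin (d + 1) → _ → ℝ) b (s a)).det =
        (Matrix.of fun a b => F b (s (Fin.succ a))).det) ∧
      (s 0 ≠ 0 → (Matrix.of fun a b => (Fin.cons e F : Fin (d + 1) → _ → ℝ) b (s a)).det = 0) := by
    intro s hs
    have hne : ∀ a : Fin d, s a.succ ≠ 0 := fun a =>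
      ((Fin.zero_le _).trans_lt (hs a.succ_pos)).ne'
    constructor
    · intro h0
      rw [Matrix.det_succ_column_zero, Fin.sum_univ_succ, Finset.sum_eq_zero, add_zero]
      · have : ((Matrix.of fun a b => (Fin.cons e F : Fin (d + 1) → _ → ℝ) b (s a)).submatrix
            (Fin.succAbove 0) Fin.succ) = Matrix.of fun a b => F b (s (Fin.succ a)) := by
          ext a b
          simp
        rw [this]
        simp [he, h0]
      · intro a _
        simp [he, hne]
    · intro h0
      refine Matrix.det_eq_zero_of_column_eq_zero 0 fun a => ?_
      refine Fin.cases ?_ (fun a => ?_) a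
      · simp [he, h0]
      · simp [he, hne]
  have hpos : ∀ s : Fin (d + 1) → Fin (m + 1), StrictMono s → s 0 = 0 → 0 < δ * ε *
      ((Matrix.of fun a b => (Fin.cons e F : Fin (d + 1) → _ → ℝ) b (s a)).det *
        (Matrix.of fun a b => (Fin.cons u F : Fin (d + 1) → _ → ℝ) b (s a)).det) := by
    intro s hs h0
    rw [(hcol s hs).1 h0, det_cons_column_add_mem_span hwu, mul_mul_mul_comm]
    exact mul_pos (hF _ (hs.comp (Fin.strictMono_succ))) (hwF s hs)
  have hle : d + 1 ≤ m + 1 := Nat.succ_le_succ hd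
  have h := det_gram_pos (Fin.cons e F : Fin (d + 1) → _ → ℝ) (Fin.cons u F) (δ * ε)
    (fun s hs => by
      by_cases h0 : s 0 = 0
      · exact (hpos s hs h0).le
      · rw [(hcol s hs).2 h0]
        simp)
    ⟨Fin.castLE hle, Fin.strictMono_castLE hle, hpos _ (Fin.strictMono_castLE hle) rfl⟩
  rw [hgram', ← mul_assoc] at h
  exact (pos_iff_pos_of_mul_pos h).2 hgram

theorem posOriented_span_iff {d m : ℕ} (hd : d ≤ m) {F : Fin d → Fin (m + 1) → ℝ}
    {w : Fin (m + 1) → ℝ} {δ ε : ℝ} (hF : MinorsHaveSign F δ)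
    (hwF : MinorsHaveSign (Fin.cons w F : Fin (d + 1) → Fin (m + 1) → ℝ) ε) :
    PosOriented (Submodule.span ℝ (Set.range F) : Set (Fin (m + 1) → ℝ)) w ↔ 0 < δ * ε := by
  constructor
  · rintro ⟨u, hwu, hu, hu0⟩
    have := sign_mul_coord_zero_pos hd hF hwF hwu fun b =>
      hu _ (Submodule.subset_span (Set.mem_range_self b))
    exact (pos_iff_pos_of_mul_pos this).2 (hu0 0 rfl)
  · intro h
    obtain ⟨u, hwu, hu⟩ := exists_orthogonal_representative
      (det_gram_self_pos (hd.trans (Nat.le_succ m)) hF).ne' w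
    refine ⟨u, hwu, fun v hv => ?_, fun j hj => ?_⟩
    · obtain ⟨c, rfl⟩ := (Submodule.mem_span_range_iff_exists_fun ℝ).1 hv
      simp only [Finset.sum_apply, Pi.smul_apply, smul_eq_mul, Finset.mul_sum]
      rw [Finset.sum_comm]
      refine Finset.sum_eq_zero fun b _ => ?_
      rw [← mul_zero (c b), ← hu b, Finset.mul_sum]
      exact Finset.sum_congr rfl fun r _ => by ring
    · obtain rfl : j = 0 := Fin.ext hj
      exact (pos_iff_pos_of_mul_pos (sign_mul_coord_zero_pos hd hF hwF hwu hu)).1 h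

theorem exists_threshold {d : ℕ} {P : Fin d → Prop} (hP : Antitone P) :
    ∃ p : Fin (d + 1), ∀ j, P j ↔ j.castSucc < p := by
  classical
  have hex : ∃ p, ∀ j : Fin d, p ≤ (j : ℕ) → ¬ P j := ⟨d, fun j hj => absurd j.2 hj.not_gt⟩
  have hle : Nat.find hex ≤ d := Nat.find_min' hex fun j hj => absurd j.2 hj.not_gt
  refine ⟨⟨Nat.find hex, Nat.lt_succ_of_le hle⟩, fun j => ⟨fun hj => ?_, fun hj => ?_⟩⟩
  · by_contra hlt
    exact Nat.find_spec hex j (not_lt.1 hlt) hj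
  · have := Nat.find_min hex (m := j) hj
    push Not at this
    obtain ⟨j', hj', hP'⟩ := this
    exact hP (Fin.le_def.2 hj') hP'

theorem exists_strictMono_insertNth {d m : ℕ} (i : Fin (m + 1)) {s : Fin d → Fin m}
    (hs : StrictMono s) : ∃ p : Fin (d + 1),
      (∀ j, (s j : ℕ) < i ↔ (j : ℕ) < p) ∧
      StrictMono (p.insertNth i fun j => i.succAbove (s j) : Fin (d + 1) → Fin (m + 1)) := by
  obtain ⟨p, hp⟩ := exists_threshold (P := fun j => (s j).castSucc < i) fun a b hab h =>
    (Fin.castSucc_le_castSucc_iff.2 (hs.monotone hab)).trans_lt h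
  refine ⟨p, hp, fun a b hab => ?_⟩
  rcases Fin.eq_self_or_eq_succAbove p a with ha | ⟨a, rfl⟩ <;>
    rcases Fin.eq_self_or_eq_succAbove p b with hb | ⟨b, rfl⟩
  · exact absurd hab (ha ▸ hb ▸ lt_irrefl _)
  · subst ha
    rw [Fin.lt_succAbove_iff_le_castSucc] at hab
    simp only [Fin.insertNth_apply_same, Fin.insertNth_apply_succAbove]
    rw [Fin.lt_succAbove_iff_le_castSucc, ← not_lt, hp, not_lt]
    exact hab
  · subst hb
    rw [Fin.succAbove_lt_iff_castSucc_lt] at hab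
    simp only [Fin.insertNth_apply_same, Fin.insertNth_apply_succAbove]
    rwa [Fin.succAbove_lt_iff_castSucc_lt, hp]
  · simp only [Fin.insertNth_apply_succAbove, Fin.succAbove_lt_succAbove_iff] at hab ⊢
    exact hs hab

theorem MinorsHaveSign.signedRestriction {d m : ℕ} {i : Fin (m + 1)} {F : Fin d → Fin m → ℝ}
    {v : Fin (m + 1) → ℝ} {c : ℝ} (hv : v i = 1)
    (h : MinorsHaveSign
      (Fin.snoc (fun b => insertZeroMap m i (F b)) v : Fin (d + 1) → Fin (m + 1) → ℝ) c) :
    MinorsHaveSign (fun b => signChange m i (F b)) c := by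
  intro s hs
  obtain ⟨p, hp, hmono⟩ := exists_strictMono_insertNth i hs
  have h1 := h _ hmono
  have hsigns : (Matrix.of fun a b => signChange m i (F b) (s a)).det =
      (-1) ^ (d - p : ℕ) * (Matrix.of fun a b => F b (s a)).det := by
    have h2 : (Matrix.of fun a b => signChange m i (F b) (s a)) = Matrix.of fun (a b : Fin d) =>
        (if (a : ℕ) < p then (1 : ℝ) else -1) *
          (Matrix.of fun a b => F b (s a) : Matrix (Fin d) (Fin d) ℝ) a b := by
      ext a b
      simp [signChange, hp]
    rw [h2, Matrix.det_mul_column, Finset.prod_ite]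
    have hcard : (Finset.univ.filter fun a : Fin d => ¬ (a : ℕ) < p).card = d - p := by
      have h3 := Finset.card_filter_add_card_filter_not (s := (Finset.univ : Finset (Fin d)))
        (fun a => (a : ℕ) < p)
      rw [Fin.card_filter_val_lt, Finset.card_univ, Fintype.card_fin,
        min_eq_right (Nat.le_of_lt_succ p.2)] at h3
      omega
    rw [Finset.prod_const_one, one_mul, Finset.prod_const, hcard]
  have hlaplace : (Matrix.of fun a b => (Fin.snoc (fun b => insertZeroMap m i (F b)) v :
      Fin (d + 1) → Fin (m + 1) → ℝ) b
        ((p.insertNth i fun j => i.succAbove (s j) : Fin (d + 1) → Fin (m + 1)) a)).det =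
      (-1) ^ (p + d : ℕ) * (Matrix.of fun a b => F b (s a)).det := by
    rw [Matrix.det_succ_row _ p, Fin.sum_univ_castSucc, Finset.sum_eq_zero, zero_add]
    · have : (Matrix.of fun a b => (Fin.snoc (fun b => insertZeroMap m i (F b)) v :
          Fin (d + 1) → Fin (m + 1) → ℝ) b
          ((p.insertNth i fun j => i.succAbove (s j) : Fin (d + 1) → Fin (m + 1)) a)).submatrix
          p.succAbove (Fin.last d).succAbove = Matrix.of fun a b => F b (s a) := by
        ext a b
        simp [insertZeroMap]
      rw [this]
      simp [hv]
    · intro b _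
      simp [insertZeroMap]
  rw [hlaplace] at h1
  rw [hsigns]
  convert h1 using 3
  have : (p + d : ℕ) = (d - p) + 2 * p := by omega
  rw [this, pow_add, pow_mul]
  simp

/-- The map `signChange`, bundled as a linear map. -/
def signChangeLinear (m : ℕ) (i : Fin (m + 1)) : (Fin m → ℝ) →ₗ[ℝ] (Fin m → ℝ) where
  toFun := signChange m i
  map_add' u v := by
    ext j
    simp [signChange, mul_add]
  map_smul' c u := by
    ext j
    simp [signChange]

theorem signChange_signChange (m : ℕ) (i : Fin (m + 1)) (u : Fin m → ℝ) :
    signChange m i (signChange m i u) = u := by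
  ext j
  simp only [signChange]
  split_ifs <;> simp

theorem insertZeroMap_apply_same (m : ℕ) (i : Fin (m + 1)) (u : Fin m → ℝ) :
    insertZeroMap m i u i = 0 := by
  simp [insertZeroMap]

theorem insertZeroMap_apply_succAbove (m : ℕ) (i : Fin (m + 1)) (u : Fin m → ℝ) (j : Fin m) :
    insertZeroMap m i u (i.succAbove j) = u j := by
  simp [insertZeroMap]

theorem insertZeroMap_injective (m : ℕ) (i : Fin (m + 1)) :
    Function.Injective (insertZeroMap m i) := fun u v h => by
  ext j
  rw [← insertZeroMap_apply_succAbove m i u, h, insertZeroMap_apply_succAbove]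

theorem exists_insertZeroMap_eq {m : ℕ} {i : Fin (m + 1)} {x : Fin (m + 1) → ℝ} (hx : x i = 0) :
    ∃ u, insertZeroMap m i u = x := by
  refine ⟨fun j => x (i.succAbove j), ?_⟩
  ext j
  rcases Fin.eq_self_or_eq_succAbove i j with rfl | ⟨j, rfl⟩
  · rw [insertZeroMap_apply_same, hx]
  · rw [insertZeroMap_apply_succAbove]

theorem range_snoc_eq_insert {α : Type*} {d : ℕ} (f : Fin d → α) (x : α) :
    Set.range (Fin.snoc f x : Fin (d + 1) → α) = insert x (Set.range f) := by
  ext y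
  constructor
  · rintro ⟨b, rfl⟩
    refine Fin.lastCases ?_ (fun b => ?_) b
    · simp
    · simp
  · rintro (rfl | ⟨b, rfl⟩)
    · exact ⟨Fin.last d, by simp⟩
    · exact ⟨b.castSucc, by simp⟩

theorem span_snoc_insertZeroMap {d m : ℕ} {i : Fin (m + 1)} {W : Submodule ℝ (Fin (m + 1) → ℝ)}
    {F : Fin d → Fin m → ℝ} {v : Fin (m + 1) → ℝ} (hv : v ∈ W) (hvi : v i = 1)
    (hF : Submodule.span ℝ (Set.range F) = W.comap (insertZeroMap m i)) :
    Submodule.span ℝ (Set.range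
      (Fin.snoc (fun b => insertZeroMap m i (F b)) v : Fin (d + 1) → Fin (m + 1) → ℝ)) = W := by
  have hmap : Submodule.span ℝ (Set.range fun b => insertZeroMap m i (F b)) =
      (W.comap (insertZeroMap m i)).map (insertZeroMap m i) := by
    rw [← hF, Submodule.map_span, ← Set.range_comp]
    rfl
  rw [range_snoc_eq_insert, Submodule.span_insert, hmap]
  apply le_antisymm
  · exact sup_le (by simpa using hv) (Submodule.map_comap_le _ _)
  · intro x hx
    obtain ⟨u, hu⟩ := exists_insertZeroMap_eq (i := i) (x := x - x i • v) (by simp [hvi])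
    rw [← add_sub_cancel (x i • v) x]
    refine Submodule.add_mem_sup (Submodule.smul_mem _ _ (Submodule.mem_span_singleton_self v)) ?_
    refine ⟨u, ?_, hu⟩
    show insertZeroMap m i u ∈ W
    rw [hu]
    exact W.sub_mem hx (W.smul_mem _ hv)

theorem comap_insertZeroMap_eq_span {d m : ℕ} {i : Fin (m + 1)}
    {W : Submodule ℝ (Fin (m + 1) → ℝ)} {F : Fin d → Fin m → ℝ} {v : Fin (m + 1) → ℝ}
    (hvi : v i = 1) (hW : Submodule.span ℝ (Set.range
      (Fin.snoc (fun b => insertZeroMap m i (F b)) v : Fin (d + 1) → Fin (m + 1) → ℝ)) = W) :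
    Submodule.span ℝ (Set.range F) = W.comap (insertZeroMap m i) := by
  have hmap : Submodule.span ℝ (Set.range fun b => insertZeroMap m i (F b)) =
      (Submodule.span ℝ (Set.range F)).map (insertZeroMap m i) := by
    rw [Submodule.map_span, ← Set.range_comp]
    rfl
  rw [range_snoc_eq_insert, Submodule.span_insert, hmap] at hW
  apply le_antisymm
  · rw [← Submodule.map_le_iff_le_comap]
    exact le_sup_right.trans hW.le
  · intro u hu
    rw [Submodule.mem_comap, ← hW, Submodule.mem_sup] at hu
    obtain ⟨y, hy, _, ⟨u', hu', rfl⟩, h⟩ := hu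
    obtain ⟨t, rfl⟩ := Submodule.mem_span_singleton.1 hy
    have ht := congrFun h i
    simp only [Pi.add_apply, Pi.smul_apply, insertZeroMap_apply_same, hvi, smul_eq_mul, mul_one,
      add_zero] at ht
    rw [ht, zero_smul, zero_add] at h
    exact insertZeroMap_injective m i h ▸ hu'

theorem signChange_image_comap_eq_span {d m : ℕ} {i : Fin (m + 1)}
    {W : Submodule ℝ (Fin (m + 1) → ℝ)} {F : Fin d → Fin m → ℝ}
    (hF : Submodule.span ℝ (Set.range F) = W.comap (insertZeroMap m i)) :
    signChange m i '' {u | insertZeroMap m i u ∈ W} =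
      (Submodule.span ℝ (Set.range fun b => signChange m i (F b)) : Set (Fin m → ℝ)) := by
  have h1 : Submodule.span ℝ (Set.range fun b => signChange m i (F b)) =
      (W.comap (insertZeroMap m i)).map (signChangeLinear m i) := by
    rw [← hF, Submodule.map_span, ← Set.range_comp]
    rfl
  rw [h1]
  rfl

theorem isTotallyPositive_signedRestriction {d m : ℕ} {i : Fin (m + 1)}
    {W : Submodule ℝ (Fin (m + 1) → ℝ)} {F : Fin d → Fin m → ℝ} {v : Fin (m + 1) → ℝ}
    (hvi : v i = 1) (hW : Submodule.span ℝ (Set.range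
      (Fin.snoc (fun b => insertZeroMap m i (F b)) v : Fin (d + 1) → Fin (m + 1) → ℝ)) = W)
    (h : IsTotallyPositive (d + 1) (m + 1) (W : Set (Fin (m + 1) → ℝ))) :
    IsTotallyPositive d m (signChange m i '' {u | insertZeroMap m i u ∈ W}) := by
  obtain ⟨c, hc⟩ := h.exists_minorsHaveSign (congrArg _ hW)
  rw [signChange_image_comap_eq_span (comap_insertZeroMap_eq_span hvi hW)]
  exact (hc.signedRestriction hvi).isTotallyPositive

theorem exists_strictMono_mem_range {d m : ℕ} (hd : d ≤ m) (i : Fin (m + 1)) :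
    ∃ s : Fin (d + 1) → Fin (m + 1), StrictMono s ∧ ∃ a, s a = i := by
  obtain ⟨t, hit, ht⟩ := Finset.exists_superset_card_eq (s := {i}) (n := d + 1) (by simp)
    (by simpa using hd)
  refine ⟨t.orderEmbOfFin ht, (t.orderEmbOfFin ht).strictMono, ?_⟩
  have : i ∈ Set.range (t.orderEmbOfFin ht) := by
    rw [Finset.range_orderEmbOfFin]
    exact hit (Finset.mem_singleton_self i)
  exact this

theorem IsTotallyPositive.exists_apply_eq_one {d m : ℕ} (hd : d ≤ m)
    {W : Submodule ℝ (Fin (m + 1) → ℝ)}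
    (h : IsTotallyPositive (d + 1) (m + 1) (W : Set (Fin (m + 1) → ℝ))) (i : Fin (m + 1)) :
    ∃ v ∈ W, v i = 1 := by
  obtain ⟨M, hM, hpos⟩ := h
  obtain ⟨s, hs, a, ha⟩ := exists_strictMono_mem_range hd i
  have hne : ∃ b, M i b ≠ 0 := by
    by_contra! h0
    exact (hpos s hs).ne' (Matrix.det_eq_zero_of_row_eq_zero a fun b => by simp [ha, h0])
  obtain ⟨b, hb⟩ := hne
  refine ⟨(M i b)⁻¹ • fun r => M r b, W.smul_mem _ ?_, by simp [hb]⟩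
  rw [← SetLike.mem_coe, ← hM]
  exact Submodule.subset_span ⟨b, rfl⟩

theorem finrank_comap_insertZeroMap {d m : ℕ} {i : Fin (m + 1)}
    {W : Submodule ℝ (Fin (m + 1) → ℝ)} (hW : Module.finrank ℝ W = d + 1)
    {v : Fin (m + 1) → ℝ} (hv : v ∈ W) (hvi : v i = 1) :
    Module.finrank ℝ (W.comap (insertZeroMap m i)) = d := by
  set f : W →ₗ[ℝ] ℝ := (LinearMap.proj i).comp W.subtype with hf
  have hsurj : LinearMap.range f = ⊤ := by
    rw [LinearMap.range_eq_top]
    exact fun t => ⟨t • ⟨v, hv⟩, by simp [hf, hvi]⟩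
  have hker : (LinearMap.ker f).map W.subtype =
      (W.comap (insertZeroMap m i)).map (insertZeroMap m i) := by
    ext x
    constructor
    · rintro ⟨y, hy, rfl⟩
      obtain ⟨u, hu⟩ := exists_insertZeroMap_eq (i := i) (x := (y : Fin (m + 1) → ℝ)) hy
      exact ⟨u, show insertZeroMap m i u ∈ W from hu ▸ y.2, hu⟩
    · rintro ⟨u, hu, rfl⟩
      exact ⟨⟨_, hu⟩, insertZeroMap_apply_same m i u, rfl⟩
  have h1 := f.finrank_range_add_finrank_ker
  rw [hsurj, finrank_top, Module.finrank_self, hW, ← Submodule.finrank_map_subtype_eq, hker,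
    (Submodule.equivMapOfInjective _ (insertZeroMap_injective m i) _).symm.finrank_eq] at h1
  omega

theorem exists_span_range_eq {m d : ℕ} {W : Submodule ℝ (Fin m → ℝ)}
    (hW : Module.finrank ℝ W = d) :
    ∃ F : Fin d → Fin m → ℝ, Submodule.span ℝ (Set.range F) = W := by
  have b := Module.finBasisOfFinrankEq ℝ W hW
  refine ⟨fun a => b a, ?_⟩
  have := congrArg (Submodule.map W.subtype) b.span_eq
  rw [Submodule.map_span, ← Set.range_comp, Submodule.map_subtype_top] at this
  exact this

theorem coe_span_singleton_sup {m : ℕ} (V : Submodule ℝ (Fin m → ℝ)) (w : Fin m → ℝ) :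
    ((Submodule.span ℝ {w} ⊔ V : Submodule ℝ (Fin m → ℝ)) : Set (Fin m → ℝ)) =
      {y | ∃ v ∈ (V : Set (Fin m → ℝ)), ∃ t : ℝ, y = v + t • w} := by
  ext y
  simp only [SetLike.mem_coe, Submodule.mem_sup, Submodule.mem_span_singleton, Set.mem_ofPred_eq]
  constructor
  · rintro ⟨_, ⟨t, rfl⟩, v, hv, rfl⟩
    exact ⟨v, hv, t, add_comm _ _⟩
  · rintro ⟨v, hv, t, rfl⟩
    exact ⟨_, ⟨t, rfl⟩, v, hv, add_comm _ _⟩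

theorem span_singleton_sup_eq_of_sub_mem {m : ℕ} {V : Submodule ℝ (Fin m → ℝ)}
    {w w' : Fin m → ℝ} (h : w' - w ∈ V) :
    Submodule.span ℝ {w'} ⊔ V = Submodule.span ℝ {w} ⊔ V := by
  have key : ∀ x y : Fin m → ℝ, x - y ∈ V →
      Submodule.span ℝ {x} ⊔ V ≤ Submodule.span ℝ {y} ⊔ V := fun x y hxy =>
    sup_le ((Submodule.span_singleton_le_iff_mem _ _).2 (by
      rw [← add_sub_cancel y x]
      exact Submodule.add_mem_sup (Submodule.mem_span_singleton_self y) hxy)) le_sup_right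
  exact le_antisymm (key _ _ h) (key _ _ (by simpa using V.neg_mem h))

theorem insertZeroMap_lift {m : ℕ} {e : Fin (m + 1) → Fin (m + 2)}
    {L : (Fin (m + 1) → ℝ) →ₗ[ℝ] (Fin (m + 2) → ℝ)}
    (hL : ∀ x j, L x (e j) = x j) (i : Fin (m + 1)) (u : Fin m → ℝ) :
    insertZeroMap (m + 1) (e i) (fun j => L (insertZeroMap m i u) ((e i).succAbove j)) =
      L (insertZeroMap m i u) := by
  ext j
  rcases Fin.eq_self_or_eq_succAbove (e i) j with rfl | ⟨j, rfl⟩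
  · rw [insertZeroMap_apply_same, hL, insertZeroMap_apply_same]
  · rw [insertZeroMap_apply_succAbove]

theorem signedRestriction_of_lift {m d : ℕ} (hdm : d + 1 ≤ m)
    {V : Submodule ℝ (Fin (m + 1) → ℝ)} (hV : Module.finrank ℝ V = d + 1)
    {w : Fin (m + 1) → ℝ} {e : Fin (m + 1) → Fin (m + 2)} (he : StrictMono e)
    {L : (Fin (m + 1) → ℝ) →ₗ[ℝ] (Fin (m + 2) → ℝ)} (hL : ∀ x j, L x (e j) = x j)
    (hA : IsTotallyPositive (d + 2) (m + 1)
      {y | ∃ v ∈ (V : Set (Fin (m + 1) → ℝ)), ∃ t : ℝ, y = v + t • w})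
    (hT : IsTotallyPositive (d + 1) (m + 2) (V.map L : Set (Fin (m + 2) → ℝ)))
    (hw : PosOriented (V : Set (Fin (m + 1) → ℝ)) w) (i : Fin (m + 1)) :
    (∃ v ∈ V, v i ≠ 0) ∧
    Module.finrank ℝ (Submodule.comap (insertZeroMap m i) V) = d ∧
    (∃ w' : Fin m → ℝ, insertZeroMap m i w' - w ∈ V) ∧
    ∀ w' : Fin m → ℝ, insertZeroMap m i w' - w ∈ V →
      IsTotallyPositive (d + 1) m
        {y | ∃ v ∈ signChange m i '' {u : Fin m → ℝ | insertZeroMap m i u ∈ V}, ∃ t : ℝ,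
          y = v + t • signChange m i w'} ∧
      IsTotallyPositive d (m + 1)
        (signChange (m + 1) (e i) '' {u | insertZeroMap (m + 1) (e i) u ∈ V.map L}) ∧
      PosOriented (signChange m i '' {u : Fin m → ℝ | insertZeroMap m i u ∈ V})
        (signChange m i w') := by
  obtain ⟨v, hv, hvi⟩ : ∃ v ∈ V, v i = 1 := by
    obtain ⟨_, ⟨v, hv, rfl⟩, h⟩ := hT.exists_apply_eq_one (by omega) (e i)
    exact ⟨v, hv, (hL v i).symm.trans h⟩
  have hfin := finrank_comap_insertZeroMap hV hv hvi
  refine ⟨⟨v, hv, hvi ▸ one_ne_zero⟩, hfin, ?_, fun w' hw' => ?_⟩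
  · obtain ⟨w', h⟩ := exists_insertZeroMap_eq (i := i) (x := w - w i • v) (by simp [hvi])
    exact ⟨w', by rw [h, sub_sub_cancel_left]; exact V.neg_mem (V.smul_mem _ hv)⟩
  obtain ⟨F, hF⟩ := exists_span_range_eq hfin
  have hN := span_snoc_insertZeroMap hv hvi hF
  set N : Fin (d + 1) → Fin (m + 1) → ℝ := Fin.snoc (fun b => insertZeroMap m i (F b)) v with hNdef
  set A := Submodule.span ℝ {w} ⊔ V with hAdef
  rw [← coe_span_singleton_sup, ← hAdef] at hA
  have hcons : (Fin.snoc (fun b => insertZeroMap m i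
      ((Fin.cons w' F : Fin (d + 1) → Fin m → ℝ) b)) v : Fin (d + 2) → Fin (m + 1) → ℝ) =
      Fin.cons (insertZeroMap m i w') N := by
    rw [hNdef, Fin.cons_snoc_eq_snoc_cons]
    congr 1
    ext b
    refine Fin.cases ?_ (fun b => ?_) b <;> rfl
  have hspanA : Submodule.span ℝ (Set.range (Fin.cons (insertZeroMap m i w') N :
      Fin (d + 2) → Fin (m + 1) → ℝ)) = A := by
    rw [Fin.range_cons, Submodule.span_insert, hN, span_singleton_sup_eq_of_sub_mem hw']
  have hsignCons : (fun b => signChange m i ((Fin.cons w' F : Fin (d + 1) → Fin m → ℝ) b)) =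
      Fin.cons (signChange m i w') fun b => signChange m i (F b) := by
    ext b
    refine Fin.cases ?_ (fun b => ?_) b <;> rfl
  obtain ⟨ε, hε⟩ := hA.exists_minorsHaveSign (congrArg _ hspanA)
  obtain ⟨δ, hδ⟩ : ∃ δ, MinorsHaveSign N δ := by
    obtain ⟨δ, hδ⟩ := hT.exists_minorsHaveSign (F := fun b => L (N b)) (congrArg _ (by
      rw [← hN, Submodule.map_span, ← Set.range_comp]
      rfl))
    exact ⟨δ, fun s hs => by simpa [hL] using hδ _ (he.comp hs)⟩
  have hδε : 0 < δ * ε := by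
    rw [← posOriented_span_iff hdm hδ hε, hN]
    obtain ⟨u, hwu, hu⟩ := hw
    exact ⟨u, by simpa using V.add_mem hw' hwu, hu⟩
  have hδ' := hδ.signedRestriction hvi
  rw [← hcons] at hε
  have hε' := hε.signedRestriction hvi
  rw [hsignCons] at hε'
  have himage := signChange_image_comap_eq_span hF
  refine ⟨?_, ?_, ?_⟩
  · rw [himage, ← coe_span_singleton_sup, ← Submodule.span_insert, ← Fin.range_cons]
    exact hε'.isTotallyPositive
  · refine isTotallyPositive_signedRestriction (v := L v) ((hL v i).trans hvi)
      (F := fun b j => L (insertZeroMap m i (F b)) ((e i).succAbove j)) ?_ hT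
    simp_rw [insertZeroMap_lift hL]
    rw [← hN, Submodule.map_span, range_snoc_eq_insert, hNdef, range_snoc_eq_insert,
      Set.image_insert_eq, ← Set.range_comp]
    rfl
  · obtain ⟨m, rfl⟩ : ∃ m', m = m' + 1 := ⟨m - 1, by omega⟩
    rw [himage, posOriented_span_iff (by omega) hδ' hε']
    exact hδε

/-- The linear map `x ↦ (ξ x, x)`. -/
def consLinear {m : ℕ} (ξ : (Fin m → ℝ) →ₗ[ℝ] ℝ) : (Fin m → ℝ) →ₗ[ℝ] (Fin (m + 1) → ℝ) where
  toFun x := Fin.cons (ξ x) x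
  map_add' x y := by
    ext j
    refine Fin.cases ?_ (fun j => ?_) j <;> simp
  map_smul' c x := by
    ext j
    refine Fin.cases ?_ (fun j => ?_) j <;> simp

/-- The linear map `x ↦ (x, ξ x)`. -/
def snocLinear {m : ℕ} (ξ : (Fin m → ℝ) →ₗ[ℝ] ℝ) : (Fin m → ℝ) →ₗ[ℝ] (Fin (m + 1) → ℝ) where
  toFun x := Fin.snoc x (ξ x)
  map_add' x y := by
    ext j
    refine Fin.lastCases ?_ (fun j => ?_) j <;> simp
  map_smul' c x := by
    ext j
    refine Fin.lastCases ?_ (fun j => ?_) j <;> simp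

theorem signChange_image_lift {m : ℕ} {V : Submodule ℝ (Fin (m + 1) → ℝ)}
    {e : Fin (m + 1) → Fin (m + 2)}
    {L : (Fin (m + 1) → ℝ) →ₗ[ℝ] (Fin (m + 2) → ℝ)} (hL : ∀ x j, L x (e j) = x j)
    {i : Fin (m + 1)} {Φ : (Fin m → ℝ) → Fin (m + 1) → ℝ}
    (hΦ : ∀ u, signChange (m + 1) (e i)
      (fun j => L (insertZeroMap m i u) ((e i).succAbove j)) = Φ (signChange m i u)) :
    signChange (m + 1) (e i) '' {u | insertZeroMap (m + 1) (e i) u ∈ V.map L} =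
      {y | ∃ v ∈ signChange m i '' {u : Fin m → ℝ | insertZeroMap m i u ∈ V}, y = Φ v} := by
  ext y
  constructor
  · rintro ⟨x, ⟨v, hv, hvx⟩, rfl⟩
    obtain ⟨u, rfl⟩ := exists_insertZeroMap_eq (i := i) (x := v) (by
      rw [← hL v i, hvx, insertZeroMap_apply_same])
    refine ⟨_, ⟨u, hv, rfl⟩, ?_⟩
    rw [← hΦ, hvx]
    simp_rw [insertZeroMap_apply_succAbove]
  · rintro ⟨_, ⟨u, hu, rfl⟩, rfl⟩
    refine ⟨_, ?_, hΦ u⟩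
    rw [Set.mem_ofPred_eq, insertZeroMap_lift hL]
    exact Submodule.mem_map_of_mem hu

theorem signChange_cons_lift {m : ℕ} (ξ : (Fin (m + 1) → ℝ) →ₗ[ℝ] ℝ) (i : Fin (m + 1))
    (u : Fin m → ℝ) :
    signChange (m + 1) i.succ
      (fun j => consLinear ξ (insertZeroMap m i u) (i.succ.succAbove j)) =
      Fin.cons (ξ (insertZeroMap m i (signChange m i (signChange m i u)))) (signChange m i u) := by
  rw [signChange_signChange]
  ext j
  refine Fin.cases ?_ (fun j => ?_) j
  · simp [signChange, consLinear]
  · simp [signChange, consLinear, insertZeroMap_apply_succAbove]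

theorem signChange_snoc_lift {m : ℕ} (ξ : (Fin (m + 1) → ℝ) →ₗ[ℝ] ℝ) (i : Fin (m + 1))
    (u : Fin m → ℝ) :
    signChange (m + 1) i.castSucc
      (fun j => snocLinear ξ (insertZeroMap m i u) (i.castSucc.succAbove j)) =
      Fin.snoc (signChange m i u)
        (-ξ (insertZeroMap m i (signChange m i (signChange m i u)))) := by
  rw [signChange_signChange]
  ext j
  refine Fin.lastCases ?_ (fun j => ?_) j
  · have : i.castSucc.succAbove (Fin.last m) = Fin.last (m + 1) :=
      Fin.succAbove_of_le_castSucc _ _ (Fin.castSucc_le_castSucc_iff.2 (Fin.le_last i))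
    simp [signChange, snocLinear, this, Nat.lt_succ_iff.1 i.2]
  · have : i.castSucc.succAbove j.castSucc = (i.succAbove j).castSucc :=
      Fin.castSucc_succAbove_castSucc
    simp only [signChange, snocLinear, LinearMap.coe_mk, AddHom.coe_mk, this, Fin.snoc_castSucc,
      insertZeroMap_apply_succAbove, Fin.val_castSucc]

/-- Lemma 3.27(ii), signed restriction: the signed restriction to the
`i`-th hyperplane of a left cyclic (resp. right cyclic) polarized arrangement of
`n = m+1 ≥ 2` hyperplanes in `k`-space is a left cyclic (resp. right cyclic) polarized
arrangement of `m` hyperplanes in `(k−1)`-space. -/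
theorem signedRestriction_preserves_leftRightCyclic
    (m k : ℕ) (hm : 1 ≤ m) (hk1 : 1 ≤ k) (hkm : k ≤ m)
    (V : Submodule ℝ (Fin (m + 1) → ℝ)) (hV : Module.finrank ℝ V = k)
    (w : Fin (m + 1) → ℝ) (hw : w ∉ V)
    (ξ : (Fin (m + 1) → ℝ) →ₗ[ℝ] ℝ)
    (i : Fin (m + 1)) :
    (IsLeftCyclic (m + 1) k (V : Set (Fin (m + 1) → ℝ)) w ξ →
      (∃ v ∈ V, v i ≠ 0) ∧
      Module.finrank ℝ (Submodule.comap (insertZeroMap m i) V) = k - 1 ∧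
      (∃ w' : Fin m → ℝ, insertZeroMap m i w' - w ∈ V) ∧
      (∀ w' : Fin m → ℝ, insertZeroMap m i w' - w ∈ V →
        IsLeftCyclic m (k - 1)
          (signChange m i '' {u : Fin m → ℝ | insertZeroMap m i u ∈ V})
          (signChange m i w')
          (fun u => ξ (insertZeroMap m i (signChange m i u))))) ∧
    (IsRightCyclic (m + 1) k (V : Set (Fin (m + 1) → ℝ)) w ξ →
      (∃ v ∈ V, v i ≠ 0) ∧
      Module.finrank ℝ (Submodule.comap (insertZeroMap m i) V) = k - 1 ∧
      (∃ w' : Fin m → ℝ, insertZeroMap m i w' - w ∈ V) ∧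
      (∀ w' : Fin m → ℝ, insertZeroMap m i w' - w ∈ V →
        IsRightCyclic m (k - 1)
          (signChange m i '' {u : Fin m → ℝ | insertZeroMap m i u ∈ V})
          (signChange m i w')
          (fun u => ξ (insertZeroMap m i (signChange m i u))))) := by
  obtain ⟨d, rfl⟩ : ∃ d, k = d + 1 := ⟨k - 1, by omega⟩
  constructor
  · rintro ⟨hA, hT, hP⟩
    have hL : ∀ x j, consLinear ξ x (Fin.succ j) = x j := fun x j => by simp [consLinear]
    have hmap : (V.map (consLinear ξ) : Set (Fin (m + 2) → ℝ)) =
        {y | ∃ v ∈ (V : Set (Fin (m + 1) → ℝ)), y = Fin.cons (ξ v) v} := by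
      ext y
      exact exists_congr fun v => and_congr_right fun _ => eq_comm
    obtain ⟨h1, h2, h3, h4⟩ := signedRestriction_of_lift hkm hV Fin.strictMono_succ hL hA
      (hmap ▸ hT) hP i
    refine ⟨h1, h2, h3, fun w' hw' => ?_⟩
    obtain ⟨h5, h6, h7⟩ := h4 w' hw'
    rw [signChange_image_lift hL
      (Φ := fun u => Fin.cons (ξ (insertZeroMap m i (signChange m i u))) u)
      (signChange_cons_lift ξ i)] at h6
    exact ⟨h5, h6, h7⟩
  · rintro ⟨hA, hT, hP⟩
    set ζ : (Fin (m + 1) → ℝ) →ₗ[ℝ] ℝ := (-1 : ℝ) ^ (d + 1) • ξ with hζ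
    have hL : ∀ x j, snocLinear ζ x (Fin.castSucc j) = x j := fun x j => by simp [snocLinear]
    have hmap : (V.map (snocLinear ζ) : Set (Fin (m + 2) → ℝ)) =
        {y | ∃ v ∈ (V : Set (Fin (m + 1) → ℝ)), y = Fin.snoc v ((-1) ^ (d + 1) * ξ v)} := by
      ext y
      exact exists_congr fun v => and_congr_right fun _ => eq_comm
    obtain ⟨h1, h2, h3, h4⟩ := signedRestriction_of_lift hkm hV Fin.strictMono_castSucc hL hA
      (hmap ▸ hT) hP i
    refine ⟨h1, h2, h3, fun w' hw' => ?_⟩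
    obtain ⟨h5, h6, h7⟩ := h4 w' hw'
    rw [signChange_image_lift hL
      (Φ := fun u => Fin.snoc u (-ζ (insertZeroMap m i (signChange m i u))))
      (signChange_snoc_lift ζ i)] at h6
    have hneg : ∀ x, -ζ x = (-1) ^ d * ξ x := fun x => by
      rw [hζ, LinearMap.smul_apply, smul_eq_mul, pow_succ]
      ring
    simp_rw [hneg] at h6
    exact ⟨h5, h6, h7⟩
end
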